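/- arXiv:1004.4012 — 3 statements merged into one kernel-verified Lean document; each statement's English description precedes it below -/
import Mathlib

section
/- Fix an integer d ≥ 1 and integers c_1, …, c_d ≥ 2. There exist constants C > 0 and c > 0 depending only on d and c_1, …, c_d with the following property. For every finite field F_q with gcd(c_j, q) = 1 for all j, every polynomial P(x) = ∑_{j=1}^d a_j x_j^{c_j} ∈ F_q[x_1,…,x_d] with a_j ≠ 0 for all j, and all sets E, F ⊆ F_q^d with |E|·|F| ≥ C q^{d+1}, the distance set satisfies |Δ_P(E,F)| ≥ c q. -/
open Polynomial in
theorem stepanov_count {L : Type*} [Field L] [Fintype L] [DecidableEq L] (p s μ c : ℕ) [Fact p.Prime] [CharP L p]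
    (hs : s ≠ 0) (hμ : μ ≠ 0) (hcard : Fintype.card L = ((p ^ s) ^ μ) ^ 2)
    (hc : Nat.Coprime c (p ^ s)) (hc0 : c ≠ 0) (hcQ : c + 2 ≤ (p ^ s) ^ μ)
    (f : L[X]) (hf : f.natDegree = c) (t : L) :
    (Finset.univ.filter (fun x : L => ∑ i ∈ Finset.range (2 * μ), (f.eval x) ^ ((p ^ s) ^ i) = t)).card
      ≤ (p ^ s) ^ (μ - 1) * (p ^ s) ^ μ + (2 * c + 2) * (p ^ s) ^ μ := by
  classical
  obtain ⟨ν, rfl⟩ : ∃ ν, μ = ν + 1 := ⟨μ - 1, by omega⟩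
  simp only [Nat.add_sub_cancel]
  set q := p ^ s with hq
  have hq2 : 2 ≤ q := (Fact.out : p.Prime).two_le.trans (Nat.le_self_pow hs p)
  set R := q ^ ν with hR
  set Q := q ^ (ν + 1) with hQ
  have hQR : Q = q * R := by rw [hQ, hR, pow_succ, mul_comm]
  have hRpos : 0 < R := by positivity
  set M := R + c + 2 with hM
  -- z
  set z : L[X] := ∑ i ∈ Finset.range (ν + 1), f ^ (q ^ i) with hz
  have hf0 : f ≠ 0 := by rintro rfl; simp at hf; omega
  have hzdeg : z.natDegree = c * R := by
    rw [hz, Finset.sum_range_succ, natDegree_add_eq_right_of_natDegree_lt]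
    · rw [natDegree_pow, hf, mul_comm]
    · rw [natDegree_pow, hf]
      refine lt_of_le_of_lt (natDegree_sum_le_of_forall_le (n := (q^ν - 1) * c) _ _ ?_) ?_
      · intro i hi
        rw [natDegree_pow, hf]
        refine Nat.mul_le_mul_right _ ?_
        have := Nat.pow_lt_pow_right (a := q) (by omega) (Finset.mem_range.mp hi)
        omega
      · exact Nat.mul_lt_mul_of_pos_right (by omega) (by omega)
  have hz0 : z ≠ 0 := by
    intro h; rw [h] at hzdeg; simp at hzdeg; omega
  -- index type
  let I := Fin R × Fin q × Fin M
  let D := Q * R + c * Q + M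
  let B : I → L[X] := fun k => X ^ (Q * (k.1 : ℕ)) * (C t - z) ^ (k.2.1 : ℕ) * X ^ (k.2.2 : ℕ)
  have htz : (C t - z).natDegree ≤ c * R := by
    rw [← hzdeg]; exact (natDegree_sub_le _ _).trans (by simp)
  have hB : ∀ k, B k ∈ degreeLT L D := by
    rintro ⟨⟨j, hj⟩, ⟨b, hb⟩, ⟨e, he⟩⟩
    rw [mem_degreeLT]
    refine lt_of_le_of_lt degree_le_natDegree ?_
    rw [Nat.cast_lt]
    simp only [B]
    have h1 : (X ^ (Q * j) * (C t - z) ^ b * X ^ e : L[X]).natDegree ≤ Q * j + b * (c * R) + e := by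
      refine natDegree_mul_le.trans (add_le_add (natDegree_mul_le.trans (add_le_add ?_ ?_)) ?_)
      · simp
      · exact natDegree_pow_le.trans (Nat.mul_le_mul_left _ htz)
      · simp
    refine lt_of_le_of_lt h1 ?_
    have h2 : Q * j ≤ Q * R := Nat.mul_le_mul_left _ hj.le
    have h3 : b * (c * R) ≤ c * Q := by
      rw [hQR]; calc b * (c * R) ≤ q * (c * R) := Nat.mul_le_mul_right _ hb.le
        _ = _ := by ring
    simp only [D]; omega
  let Φ : (I → L) →ₗ[L] degreeLT L D := Fintype.linearCombination L (fun k => (⟨B k, hB k⟩ : degreeLT L D))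
  have hker : LinearMap.ker Φ ≠ ⊥ := by
    have : FiniteDimensional L (degreeLT L D) := (degreeLTEquiv L D).symm.finiteDimensional
    apply LinearMap.ker_ne_bot_of_finrank_lt
    rw [(degreeLTEquiv L D).finrank_eq]
    simp only [Module.finrank_fintype_fun_eq_card, Fintype.card_fin, I, Fintype.card_prod, D, hM]
    rw [show R * (q * (R + c + 2)) = Q * (R + c + 2) by rw [hQR]; ring]
    have : R * 2 ≤ Q := by rw [hQR, mul_comm]; exact Nat.mul_le_mul_right _ hq2
    nlinarith
  obtain ⟨α, hα, hα0⟩ := (Submodule.ne_bot_iff _).mp hker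
  have hα' : ∑ k, α k • B k = 0 := by
    have := congrArg (Subtype.val) (LinearMap.mem_ker.mp hα)
    simpa [Φ, Fintype.linearCombination_apply] using this
  have hQp : Q = p ^ (s * (ν + 1)) := by rw [hQ, hq, ← pow_mul]
  have hbij : Function.Bijective (fun x : L => x ^ Q) := by
    rw [hQp]
    exact (iterateFrobeniusEquiv L p (s*(ν+1))).bijective
  choose β hβ using fun k => hbij.2 (α k)
  simp only at hβ
  let T : I → L[X] := fun k => C (β k) * (X ^ (k.1 : ℕ) * z ^ (k.2.1 : ℕ) * X ^ (Q * (k.2.2 : ℕ)))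
  let H : L[X] := ∑ k, T k
  have hT0 : ∀ k, T k ≠ 0 ↔ β k ≠ 0 := by
    intro k
    simp [T, hz0]
  have hTdeg : ∀ k, β k ≠ 0 → (T k).natDegree = k.1 + R * (c * k.2.1 + q * k.2.2) := by
    intro k hk
    simp only [T]
    rw [natDegree_C_mul hk, natDegree_mul (by simp [hz0]) (by simp), natDegree_mul (by simp) (by simp [hz0]),
      natDegree_pow, natDegree_pow, natDegree_pow, hzdeg, natDegree_X, hQR]
    ring
  have hinj : ∀ k k' : I, (k.1 : ℕ) + R * (c * k.2.1 + q * k.2.2) = k'.1 + R * (c * k'.2.1 + q * k'.2.2) → k = k' := by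
    rintro ⟨⟨j, hj⟩, ⟨b, hb⟩, ⟨e, he⟩⟩ ⟨⟨j', hj'⟩, ⟨b', hb'⟩, ⟨e', he'⟩⟩ h
    simp only at h
    have h1 : j = j' := by
      have := congrArg (· % R) h
      simpa [Nat.add_mul_mod_self_left, Nat.mod_eq_of_lt hj, Nat.mod_eq_of_lt hj'] using this
    subst h1
    have h2 : c * b + q * e = c * b' + q * e' := Nat.eq_of_mul_eq_mul_left hRpos (by omega)
    have h3 : b = b' := by
      have : c * b ≡ c * b' [MOD q] := by
        have := congrArg (· % q) h2
        rw [Nat.ModEq]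
        simpa [Nat.add_mul_mod_self_left] using this
      have := Nat.ModEq.cancel_left_of_coprime (by rw [Nat.gcd_comm]; exact hc) this
      exact Nat.ModEq.eq_of_lt_of_lt this hb hb'
    subst h3
    have h4 : e = e' := Nat.eq_of_mul_eq_mul_left (show 0 < q by omega) (by omega)
    subst h4; rfl
  obtain ⟨k0, hk0⟩ : ∃ k, β k ≠ 0 := by
    by_contra! h
    apply hα0
    ext k
    rw [← hβ k, h k]
    simp; omega
  have hpair : Set.Pairwise { i | i ∈ (Finset.univ : Finset I) ∧ T i ≠ 0 } (Function.onFun Ne (natDegree ∘ T)) := by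
    intro k hk k' hk' hne h
    simp only [Function.comp] at h
    rw [hTdeg k ((hT0 k).1 hk.2), hTdeg k' ((hT0 k').1 hk'.2)] at h
    exact hne (hinj _ _ h)
  have hpair' : Set.Pairwise { i | i ∈ (Finset.univ : Finset I) ∧ T i ≠ 0 } (Function.onFun Ne (degree ∘ T)) := by
    intro k hk k' hk' hne h
    exact hpair hk hk' hne (natDegree_eq_of_degree_eq h)
  have hH0 : H ≠ 0 := by
    have := degree_sum_eq_of_disjoint T Finset.univ hpair'
    intro h
    change H.degree = _ at this
    rw [h, degree_zero] at this
    have h2 := Finset.le_sup (f := fun i => degree (T i)) (Finset.mem_univ k0)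
    rw [← this] at h2
    simp at h2
    exact (hT0 k0).2 hk0 h2
  have hHdeg : H.natDegree ≤ R * Q + (2 * c + 2) * Q := by
    refine natDegree_sum_le_of_forall_le _ _ ?_
    intro k _
    by_cases hk : β k = 0
    · simp [T, hk]
    rw [hTdeg k hk]
    obtain ⟨⟨j, hj⟩, ⟨b, hb⟩, ⟨e, he⟩⟩ := k
    simp only
    have h1 : j ≤ Q := by nlinarith
    have h2 : R * (c * b) ≤ c * Q := by
      rw [hQR]; calc R * (c * b) ≤ R * (c * q) := by gcongr
        _ = _ := by ring
    have h3 : R * (q * e) ≤ Q * (R + c + 1) := by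
      rw [hQR]; calc R * (q * e) ≤ R * (q * (R + c + 1)) := by gcongr; omega
        _ = _ := by ring
    nlinarith
  have hroots : (Finset.univ.filter (fun x : L => ∑ i ∈ Finset.range (2 * (ν + 1)), (f.eval x) ^ (q ^ i) = t)) ⊆ H.roots.toFinset := by
    intro x hx
    simp only [Finset.mem_filter, Finset.mem_univ, true_and] at hx
    rw [Multiset.mem_toFinset, mem_roots hH0, IsRoot.def]
    have hadd : ∀ (s' : Finset ℕ) (g : ℕ → L), (∑ i ∈ s', g i) ^ Q = ∑ i ∈ s', g i ^ Q := by
      intro s' g; rw [hQp]; exact sum_pow_char_pow p _ _ _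
    have hadd2 : ∀ (g : I → L), (∑ i, g i) ^ Q = ∑ i, g i ^ Q := by
      intro g; rw [hQp]; exact sum_pow_char_pow p _ _ _
    have hzx : (z.eval x) ^ Q = t - z.eval x := by
      rw [eq_sub_iff_add_eq, ← hx, hz, eval_finsetSum, hadd, two_mul (ν + 1), Finset.sum_range_add _ (ν + 1) (ν + 1), add_comm]
      simp only [eval_pow]
      congr 1
      refine Finset.sum_congr rfl fun i _ => ?_
      rw [← pow_mul, pow_add q (ν + 1) i, mul_comm]
    have hxr : x ^ (Q * Q) = x := by
      rw [← sq, ← hcard]; exact FiniteField.pow_card x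
    have : (H.eval x) ^ Q = 0 := by
      rw [eval_finsetSum, hadd2]
      have h0 := congrArg (eval x) hα'
      rw [eval_finsetSum, eval_zero] at h0
      rw [← h0]
      refine Finset.sum_congr rfl fun k _ => ?_
      simp only [T, B, eval_mul, eval_pow, eval_X, eval_C, eval_smul, smul_eq_mul, mul_pow, hβ, eval_sub, ← hzx]
      have e1 : (x ^ (Q * (k.2.2 : ℕ))) ^ Q = x ^ (k.2.2 : ℕ) := by
        rw [← pow_mul, show Q * (k.2.2 : ℕ) * Q = (Q * Q) * k.2.2 by ring, pow_mul, hxr]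
      rw [e1, ← pow_mul, ← pow_mul, ← pow_mul, mul_comm Q, mul_comm Q]
    exact pow_eq_zero_iff (by omega) |>.mp this
  calc _ ≤ H.roots.toFinset.card := Finset.card_le_card hroots
    _ ≤ H.roots.card := Multiset.toFinset_card_le _
    _ ≤ H.natDegree := card_roots' _
    _ ≤ _ := hHdeg
theorem ext_sum_bound {K L : Type*} [Field K] [Fintype K] [Field L] [Fintype L] [Algebra K L]
    (ψ : AddChar K ℂ) (hψ : ψ ≠ 1) (μ c : ℕ) (hμ : μ ≠ 0) (hfin : Module.finrank K L = 2 * μ)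
    (hc : Nat.Coprime c (Fintype.card K)) (hc0 : c ≠ 0) (hcQ : c + 2 ≤ (Fintype.card K) ^ μ)
    (f : Polynomial K) (hf : f.natDegree = c) :
    ‖∑ x : L, ψ (Algebra.trace K L (Polynomial.aeval x f))‖
      ≤ ((Fintype.card K : ℝ) * (2 * c + 2)) * (Fintype.card K : ℝ) ^ μ := by
  classical
  obtain ⟨p, hp⟩ := CharP.exists K
  obtain ⟨⟨s, hs⟩, hpp, hcardK⟩ := FiniteField.card K p
  have : Fact p.Prime := ⟨hpp⟩
  have : CharP L p := charP_of_injective_algebraMap (algebraMap K L).injective p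
  simp only [PNat.mk_coe] at hcardK
  have hcardL : Fintype.card L = ((p ^ s) ^ μ) ^ 2 := by
    rw [Module.card_eq_pow_finrank (K := K), hfin, hcardK, ← pow_mul (p ^ s), mul_comm μ]
  set N : K → ℕ := fun t => (Finset.univ.filter (fun x : L => Algebra.trace K L (Polynomial.aeval x f) = t)).card with hN
  set U : ℝ := (p ^ s) ^ (μ - 1) * (p ^ s) ^ μ + (2 * c + 2) * (p ^ s) ^ μ with hU
  have hNU : ∀ t, (N t : ℝ) ≤ U := by
    intro t
    have h := stepanov_count p s μ c (by omega) hμ hcardL (hcardK ▸ hc) hc0 (hcardK ▸ hcQ)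
      (f.map (algebraMap K L)) (by rw [Polynomial.natDegree_map, hf]) (algebraMap K L t)
    have h2 : N t ≤ (p ^ s) ^ (μ - 1) * (p ^ s) ^ μ + (2 * c + 2) * (p ^ s) ^ μ := by
      refine le_trans (le_of_eq ?_) h
      rw [hN]
      refine congrArg Finset.card ?_
      ext x
      simp only [Finset.mem_filter, Finset.mem_univ, true_and]
      rw [← (algebraMap K L).injective.eq_iff, FiniteField.algebraMap_trace_eq_sum_pow,
        hfin, Nat.card_eq_fintype_card, hcardK, Polynomial.eval_map_algebraMap]
    rw [hU]; exact_mod_cast h2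
  have hsum : ∑ t, (N t : ℝ) = ((p ^ s) ^ μ) ^ 2 := by
    have := Finset.card_eq_sum_card_fiberwise (s := (Finset.univ : Finset L)) (t := (Finset.univ : Finset K))
      (f := fun x => Algebra.trace K L (Polynomial.aeval x f)) (by simp)
    rw [Finset.card_univ, hcardL] at this
    exact_mod_cast this.symm
  have hψ0 : ∑ t, ψ t = 0 := AddChar.sum_eq_zero_of_ne_one hψ
  have hS : ∑ x : L, ψ (Algebra.trace K L (Polynomial.aeval x f)) = ∑ t, ψ t * ((N t : ℂ) - U) := by
    simp only [mul_sub, Finset.sum_sub_distrib, ← Finset.sum_mul, hψ0, zero_mul, sub_zero]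
    rw [← Finset.sum_fiberwise_of_maps_to (t := (Finset.univ : Finset K)) (g := fun x => Algebra.trace K L (Polynomial.aeval x f)) (by simp)]
    refine Finset.sum_congr rfl fun t _ => ?_
    rw [Finset.sum_congr rfl (g := fun _ => ψ t)]
    · simp [hN, mul_comm]
    · intro x hx
      rw [(Finset.mem_filter.mp hx).2]
  rw [hS]
  have hqpos : (0:ℝ) < (p:ℝ)^s := by have := hpp.pos; positivity
  calc _ ≤ ∑ t, ‖ψ t * ((N t : ℂ) - U)‖ := norm_sum_le _ _
    _ = ∑ t, (U - N t) := by
      refine Finset.sum_congr rfl fun t _ => ?_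
      rw [norm_mul, AddChar.norm_apply, one_mul, ← Complex.ofReal_natCast, ← Complex.ofReal_sub, Complex.norm_real,
        Real.norm_of_nonpos (by linarith [hNU t])]
      ring
    _ = _ := by
      rw [Finset.sum_sub_distrib, hsum, Finset.sum_const, Finset.card_univ, hcardK, hU]
      obtain ⟨ν, rfl⟩ : ∃ ν, μ = ν + 1 := ⟨μ - 1, by omega⟩
      simp only [Nat.add_sub_cancel, nsmul_eq_mul]
      push_cast
      ring
    _ ≤ _ := le_rfl

open Filter Topology in
theorem roots_bound_aux {k : ℕ} (ω : Fin k → ℂ) (R B : ℝ) (hR : 0 < R) (n0 : ℕ)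
    (h : ∀ μ ≥ n0, ‖∑ i, ω i ^ (2 * μ)‖ ≤ B * R ^ (2 * μ)) (i : Fin k) : ‖ω i‖ ≤ R := by
  classical
  by_contra! hi
  obtain ⟨i0, -, hi0⟩ := Finset.exists_max_image (Finset.univ : Finset (Fin k)) (fun i => ‖ω i‖) ⟨i, Finset.mem_univ _⟩
  set ρ := ‖ω i0‖ with hρ
  have hρR : R < ρ := hi.trans_le (hi0 i (Finset.mem_univ _))
  have hρ0 : 0 < ρ := hR.trans hρR
  set v : Fin k → ℂ := fun i => (ω i / ρ) ^ 2 with hv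
  have hvn : ∀ i, ‖v i‖ = (‖ω i‖ / ρ) ^ 2 := by
    intro i; simp [hv, abs_of_pos hρ0]
  have hvle : ∀ i, ‖v i‖ ≤ 1 := by
    intro i; rw [hvn]
    have := hi0 i (Finset.mem_univ _)
    exact pow_le_one₀ (by positivity) ((div_le_one hρ0).2 this)
  have hv0 : ‖v i0‖ = 1 := by rw [hvn, ← hρ, div_self hρ0.ne']; simp
  let u : Fin k → Circle := fun i => if hh : ‖v i‖ = 1 then ⟨v i, by simpa [Submonoid.unitSphere] using hh⟩ else 1
  have hu : ∀ i, ‖v i‖ = 1 → (u i : ℂ) = v i := by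
    intro i hh; simp [u, hh]
  have hcl := mapClusterPt_one_atTop_pow u
  set δ : ℝ := 1 / (4 * (k + 1)) with hδ
  have hδ0 : 0 < δ := by positivity
  have hnb : {w : Fin k → Circle | ∀ i, 1 / 2 < (w i : ℂ).re} ∈ 𝓝 (1 : Fin k → Circle) := by
    have : IsOpen {w : Fin k → Circle | ∀ i, 1 / 2 < (w i : ℂ).re} := by
      simp only [Set.ofPred_forall]
      refine isOpen_iInter_of_finite fun i => ?_
      exact isOpen_lt continuous_const (by fun_prop)
    refine this.mem_nhds ?_
    intro i; norm_num
  have hfreq := hcl.frequently hnb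
  have hev1 : ∀ᶠ n in atTop, ∀ i, ‖v i‖ ≠ 1 → ‖v i ^ n‖ < δ := by
    rw [eventually_all]
    intro i
    by_cases hh : ‖v i‖ = 1
    · simp [hh]
    · have hlt : ‖v i‖ < 1 := lt_of_le_of_ne (hvle i) hh
      have := tendsto_pow_atTop_nhds_zero_of_lt_one (norm_nonneg _) hlt
      filter_upwards [this.eventually (gt_mem_nhds hδ0)] with n hn _
      rwa [norm_pow]
  have hev2 : ∀ᶠ n in atTop, B * ((R / ρ) ^ 2) ^ n < 1 / 4 := by
    have h1 : (R / ρ) ^ 2 < 1 := pow_lt_one₀ (by positivity) ((div_lt_one hρ0).2 hρR) (by norm_num)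
    have := (tendsto_pow_atTop_nhds_zero_of_lt_one (by positivity) h1).const_mul B
    rw [mul_zero] at this
    exact this.eventually (gt_mem_nhds (by norm_num))
  obtain ⟨n, hn, hn1, hn2, hn3⟩ := (hfreq.and_eventually (hev1.and (hev2.and (eventually_ge_atTop n0)))).exists
  have hbound := h n hn3
  have hsum : ∑ i, ω i ^ (2 * n) = (ρ : ℂ) ^ (2 * n) * ∑ i, v i ^ n := by
    rw [Finset.mul_sum]
    refine Finset.sum_congr rfl fun i _ => ?_
    simp only [hv]
    rw [← pow_mul, ← mul_pow, mul_div_cancel₀]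
    exact_mod_cast hρ0.ne'
  have h3 : ‖∑ i, v i ^ n‖ < 1 / 4 := by
    rw [hsum, norm_mul, norm_pow, Complex.norm_real, Real.norm_of_nonneg hρ0.le] at hbound
    refine lt_of_le_of_lt ?_ hn2
    rw [← pow_mul, div_pow, mul_div_assoc', le_div_iff₀ (by positivity)]
    linarith
  have h4 : (∑ i, v i ^ n).re < 1 / 4 := (Complex.re_le_norm _).trans_lt h3
  rw [Complex.re_sum, ← Finset.add_sum_erase _ _ (Finset.mem_univ i0)] at h4
  have h5 : ∀ i, ‖v i‖ = 1 → 1 / 2 < (v i ^ n).re := by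
    intro i hh
    have := hn i
    simpa [hu i hh] using this
  have h6 : ∑ i ∈ Finset.univ.erase i0, (-δ) ≤ ∑ i ∈ Finset.univ.erase i0, (v i ^ n).re := by
    refine Finset.sum_le_sum fun i _ => ?_
    by_cases hh : ‖v i‖ = 1
    · linarith [h5 i hh]
    · have h7 := hn1 i hh
      have h8 := Complex.abs_re_le_norm (v i ^ n)
      linarith [neg_abs_le (v i ^ n).re]
  rw [Finset.sum_const, nsmul_eq_mul] at h6
  have h9 : ((Finset.univ.erase i0).card : ℝ) ≤ k := by
    have := Finset.card_le_univ (Finset.univ.erase i0)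
    rw [Fintype.card_fin] at this
    exact_mod_cast this
  have h10 : (k : ℝ) * δ ≤ 1 / 4 := by
    rw [hδ, mul_one_div, div_le_iff₀ (by positivity)]; linarith
  have := h5 i0 hv0
  nlinarith

theorem roots_bound (s : Multiset ℂ) (R B : ℝ) (hR : 0 < R) (n0 : ℕ)
    (h : ∀ μ ≥ n0, ‖(s.map (fun z => z ^ (2 * μ))).sum‖ ≤ B * R ^ (2 * μ)) : ∀ z ∈ s, ‖z‖ ≤ R := by
  induction s using Quotient.inductionOn with
  | h l =>
    intro z hz
    have hz' : z ∈ l := hz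
    obtain ⟨i, rfl⟩ := List.mem_iff_get.mp hz'
    refine roots_bound_aux l.get R B hR n0 ?_ i
    intro μ hμ
    have := h μ hμ
    simp only [Multiset.quot_mk_to_coe, Multiset.map_coe, Multiset.sum_coe] at this
    have e : ∑ i, l.get i ^ (2 * μ) = (l.map (fun z => z ^ (2 * μ))).sum := by
      rw [← List.sum_ofFn]
      congr 1
      apply List.ext_get <;> simp
    rw [e]; exact this
namespace LD
open Polynomial

/-- power series attached to the reversed polynomial -/
noncomputable def rv {R : Type*} [Field R] (h : R[X]) : PowerSeries R := (h.reverse : PowerSeries R)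

/-- logarithmic derivative of the reversed polynomial -/
noncomputable def ld {R : Type*} [Field R] (h : R[X]) : PowerSeries R :=
  PowerSeries.derivative R (rv h) * (rv h)⁻¹

/-- power sum of the roots of exponent `j + 1` -/
noncomputable def pw {R : Type*} [Field R] (h : R[X]) (j : ℕ) : R := - PowerSeries.coeff j (ld h)

variable {R : Type*} [Field R]

theorem rv_const {h : R[X]} (hh : h ≠ 0) : PowerSeries.constantCoeff (rv h) ≠ 0 := by
  rw [rv, ← PowerSeries.coeff_zero_eq_constantCoeff_apply, Polynomial.coeff_coe, coeff_zero_reverse]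
  simpa using hh

theorem rv_mul (g h : R[X]) : rv (g * h) = rv g * rv h := by
  rw [rv, reverse_mul_of_domain, Polynomial.coe_mul]; rfl

theorem ld_mul {g h : R[X]} (hg : g ≠ 0) (hh : h ≠ 0) : ld (g * h) = ld g + ld h := by
  have h1 := PowerSeries.mul_inv_cancel (rv g) (rv_const hg)
  have h2 := PowerSeries.mul_inv_cancel (rv h) (rv_const hh)
  rw [ld, rv_mul, PowerSeries.mul_inv_rev, Derivation.leibniz, ld, ld]
  simp only [smul_eq_mul]
  linear_combination (PowerSeries.derivative R (rv h) * (rv h)⁻¹) * h1 + (PowerSeries.derivative R (rv g) * (rv g)⁻¹) * h2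

theorem pw_mul {g h : R[X]} (hg : g ≠ 0) (hh : h ≠ 0) (j : ℕ) : pw (g * h) j = pw g j + pw h j := by
  simp [pw, ld_mul hg hh]; ring

theorem pw_one (j : ℕ) : pw (1 : R[X]) j = 0 := by
  have := pw_mul (one_ne_zero (α := R[X])) one_ne_zero j
  simpa using this

theorem pw_pow {g : R[X]} (hg : g ≠ 0) (n j : ℕ) : pw (g ^ n) j = n * pw g j := by
  induction n with
  | zero => simp [pw_one]
  | succ n ih => rw [pow_succ, pw_mul (pow_ne_zero _ hg) hg, ih]; push_cast; ring

theorem pw_map {S : Type*} [Field S] (φ : R →+* S) {h : R[X]} (hh : h ≠ 0) (j : ℕ) :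
    pw (h.map φ) j = φ (pw h j) := by
  have hrv : rv (h.map φ) = PowerSeries.map φ (rv h) := by
    rw [rv, rv, ← Polynomial.polynomial_map_coe]
    congr 1
    ext n
    simp [coeff_reverse, natDegree_map]
  have hd : ∀ s : PowerSeries R, PowerSeries.derivative S (PowerSeries.map φ s) = PowerSeries.map φ (PowerSeries.derivative R s) := by
    intro s; ext n; simp [PowerSeries.coeff_derivative]
  have hld : ld (h.map φ) = PowerSeries.map φ (ld h) := by
    have h1 := PowerSeries.mul_inv_cancel (rv h) (rv_const hh)
    have hm : h.map φ ≠ 0 := by simpa using hh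
    have h2 := PowerSeries.mul_inv_cancel (rv (h.map φ)) (rv_const hm)
    rw [ld, ld, map_mul, ← hd, ← hrv]
    congr 1
    have h3 : rv (h.map φ) * PowerSeries.map φ (rv h)⁻¹ = 1 := by
      rw [hrv, ← map_mul, h1, map_one]
    linear_combination (-(PowerSeries.map φ (rv h)⁻¹)) * h2 * (-1) - (rv (h.map φ))⁻¹ * h3
  rw [pw, pw, hld, PowerSeries.coeff_map, map_neg]

theorem pw_linear (a : R) (j : ℕ) : pw (X - C a) j = a ^ (j + 1) := by
  have hr : rv (X - C a) = 1 - PowerSeries.C a * PowerSeries.X := by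
    rw [rv]
    have : (X - C a : R[X]).reverse = 1 - C a * X := by
      rw [reverse, natDegree_X_sub_C]
      ext n
      rw [coeff_reflect]
      rcases n with _ | _ | n
      · simp
      · simp [coeff_one]
      · rw [revAt_eq_self_of_lt (by omega)]
        simp [coeff_one, coeff_X, coeff_C]
    rw [this]; simp
  have hne : (X - C a : R[X]) ≠ 0 := X_sub_C_ne_zero a
  have h1 := PowerSeries.mul_inv_cancel (rv (X - C a)) (rv_const hne)
  have hd : PowerSeries.derivative R (rv (X - C a)) = - PowerSeries.C a := by
    rw [hr]; ext n
    rw [PowerSeries.coeff_derivative]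
    rcases n with _ | n
    · simp [PowerSeries.coeff_one]
    · simp [PowerSeries.coeff_one, PowerSeries.coeff_C, PowerSeries.coeff_X]
  have h2 : ld (X - C a) = - PowerSeries.mk (fun j => a ^ (j + 1)) := by
    have h3 : rv (X - C a) * PowerSeries.mk (fun j => a ^ (j + 1)) = PowerSeries.C a := by
      rw [hr]; ext n
      rcases n with _ | n
      · simp [sub_mul, mul_assoc]
      · simp [sub_mul, mul_assoc, PowerSeries.coeff_succ_X_mul, PowerSeries.coeff_C]; ring
    rw [ld, hd]
    linear_combination (-PowerSeries.mk (fun j => a ^ (j + 1))) * h1 + (rv (X - C a))⁻¹ * h3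
  rw [pw, h2]; simp

theorem pw_multiset (s : Multiset R) (j : ℕ) :
    pw ((s.map (fun a => X - C a)).prod) j = (s.map (fun a => a ^ (j + 1))).sum := by
  induction s using Multiset.induction_on with
  | empty => simp [pw_one]
  | cons a s ih =>
    rw [Multiset.map_cons, Multiset.prod_cons, pw_mul (X_sub_C_ne_zero a), ih, pw_linear,
      Multiset.map_cons, Multiset.sum_cons]
    exact (monic_multiset_prod_of_monic _ _ fun a _ => monic_X_sub_C a).ne_zero

/-- adding a constant times `T ^ (j+1)` to the reversed polynomial. -/
theorem pw_shift {g h : R[X]} {n c : ℕ} (hc : c + 1 ≤ n) (hg : g.Monic) (hgn : g.natDegree = n)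
    (a : R) (hh : h = g + C a * X ^ (n - (c + 1))) :
    pw h c = pw g c - (c + 1) * a ∧ ∀ j < c, pw h j = pw g j := by
  have hdeg : (C a * X ^ (n - (c + 1)) : R[X]).degree < g.degree := by
    rw [degree_eq_natDegree hg.ne_zero, hgn]
    refine lt_of_le_of_lt (degree_C_mul_X_pow_le _ _) ?_
    exact_mod_cast (by omega)
  have hhm : h.Monic := by rw [hh]; exact hg.add_of_left hdeg
  have hhn : h.natDegree = n := by
    rw [hh, natDegree_eq_of_degree_eq (degree_add_eq_left_of_degree_lt hdeg), hgn]
  have hrv : rv h = rv g + PowerSeries.C a * PowerSeries.X ^ (c + 1) := by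
    have : h.reverse = g.reverse + C a * X ^ (c + 1) := by
      rw [reverse, reverse, hhn, hgn, hh, reflect_add, reflect_C_mul, reflect_monomial,
        revAt_le (by omega)]
      congr 3
      omega
    rw [rv, this]; simp [rv]
  have h1 := PowerSeries.mul_inv_cancel (rv g) (rv_const hg.ne_zero)
  have h2 := PowerSeries.mul_inv_cancel (rv h) (rv_const hhm.ne_zero)
  -- ld h - ld g
  have hder : PowerSeries.derivative R (PowerSeries.C a * PowerSeries.X ^ (c + 1)) = PowerSeries.X ^ c * PowerSeries.C ((c + 1) * a) := by
    ext k
    rw [PowerSeries.coeff_derivative, PowerSeries.coeff_C_mul, PowerSeries.coeff_mul_C, PowerSeries.coeff_X_pow, PowerSeries.coeff_X_pow]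
    by_cases hk : k = c
    · subst hk; simp; ring
    · simp [hk]
  have key : ld h = ld g + PowerSeries.X ^ c * (PowerSeries.C ((c + 1) * a) * (rv h)⁻¹ -
      PowerSeries.X * (PowerSeries.C a * (rv g)⁻¹ * (rv h)⁻¹ * PowerSeries.derivative R (rv g))) := by
    have e1 : PowerSeries.derivative R (rv h) = PowerSeries.derivative R (rv g) + PowerSeries.X ^ c * PowerSeries.C ((c + 1) * a) := by
      rw [hrv, map_add, hder]
    have e2 : (rv h)⁻¹ = (rv g)⁻¹ - PowerSeries.C a * PowerSeries.X ^ (c + 1) * (rv g)⁻¹ * (rv h)⁻¹ := by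
      have : rv g = rv h - PowerSeries.C a * PowerSeries.X ^ (c + 1) := by rw [hrv]; ring
      linear_combination (-(rv g)⁻¹) * h2 * (-1) - (rv h)⁻¹ * h1 + (rv g)⁻¹ * (rv h)⁻¹ * this
    rw [ld, ld, e1]
    linear_combination (PowerSeries.derivative R (rv g)) * e2
  have hcst : PowerSeries.constantCoeff (rv h)⁻¹ = 1 := by
    rw [PowerSeries.constantCoeff_inv, rv, ← PowerSeries.coeff_zero_eq_constantCoeff_apply, Polynomial.coeff_coe, coeff_zero_reverse, hhm.leadingCoeff, inv_one]
  constructor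
  · rw [pw, pw, key, map_add, PowerSeries.coeff_X_pow_mul']
    simp [hcst, PowerSeries.coeff_zero_eq_constantCoeff_apply]
    ring
  · intro j hj
    rw [pw, pw, key, map_add, PowerSeries.coeff_X_pow_mul', if_neg (by omega), add_zero]

end LD
namespace LD
open Polynomial

section
variable {K : Type*} [Field K] [Fintype K]

theorem trace_pow_adjoin {L : Type*} [Field L] [Fintype L] [Algebra K L] (x : L) (j : ℕ) :
    Algebra.trace K L (x ^ (j + 1)) = (Module.finrank (IntermediateField.adjoin K {x}) L : K) * pw (minpoly K x) j := by
  classical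
  let F := IntermediateField.adjoin K {x}
  have hx : IsIntegral K x := IsIntegral.of_finite K x
  let g : F := IntermediateField.AdjoinSimple.gen K x
  have hg : algebraMap F L g = x := IntermediateField.AdjoinSimple.algebraMap_gen K x
  have h1 : Algebra.trace K L (x ^ (j + 1)) = Module.finrank F L • Algebra.trace K F (g ^ (j + 1)) := by
    rw [← hg, ← map_pow, ← Algebra.trace_trace (S := F), Algebra.trace_algebraMap, map_nsmul]
  rw [h1, nsmul_eq_mul]
  congr 1
  let E := AlgebraicClosure F
  apply (algebraMap K E).injective
  rw [trace_eq_sum_embeddings E, ← pw_map (algebraMap K E) (minpoly.ne_zero hx)]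
  have hsp : ((minpoly K x).map (algebraMap K E)).Splits := IsAlgClosed.splits _
  rw [hsp.eq_prod_roots_of_monic ((minpoly.monic hx).map _), pw_multiset]
  have hnd : ((minpoly K x).aroots E).Nodup := nodup_aroots_iff_of_splits (minpoly.ne_zero hx) hsp |>.2 (Algebra.IsSeparable.isSeparable K x)
  change _ = (((minpoly K x).aroots E).map _).sum
  rw [show (((minpoly K x).aroots E).map (fun a => a ^ (j + 1))).sum
      = ∑ a ∈ ((minpoly K x).aroots E).toFinset, a ^ (j + 1) by
    rw [Finset.sum, Multiset.toFinset_val, hnd.dedup]]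
  symm
  refine Finset.sum_bij (fun a ha => (IntermediateField.algHomAdjoinIntegralEquiv (K := E) K hx).symm
    ⟨a, Multiset.mem_toFinset.1 ha⟩) ?_ ?_ ?_ ?_
  · intro a ha; exact Finset.mem_univ _
  · intro a ha b hb h
    simpa using h
  · intro σ _
    refine ⟨(IntermediateField.algHomAdjoinIntegralEquiv (K := E) K hx σ).1, Multiset.mem_toFinset.2
      (IntermediateField.algHomAdjoinIntegralEquiv (K := E) K hx σ).2, ?_⟩
    simp
  · intro a ha
    rw [map_pow, IntermediateField.algHomAdjoinIntegralEquiv_symm_apply_gen]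

theorem mon_finite (n : ℕ) : {h : K[X] | h.Monic ∧ h.natDegree = n}.Finite := by
  have : Finite (degreeLT K n) := Finite.of_equiv _ (degreeLTEquiv K n).symm.toEquiv
  have : Finite {h : K[X] // h.Monic ∧ h.natDegree = n} := Finite.of_equiv _ (monicEquivDegreeLT n).symm
  exact Set.finite_coe_iff.mp this

theorem irr_finite (N : ℕ) : {h : K[X] | h.Monic ∧ Irreducible h ∧ h.natDegree ≤ N}.Finite := by
  refine Set.Finite.subset (Set.Finite.biUnion (Set.finite_le_nat N) (fun n _ => mon_finite (K := K) n)) ?_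
  rintro h ⟨h1, h2, h3⟩
  simp only [Set.mem_iUnion]
  exact ⟨_, h3, h1, rfl⟩

end

/-- monic polynomials of degree `n` -/
noncomputable def mon (K : Type*) [Field K] [Fintype K] (n : ℕ) : Finset K[X] := (mon_finite (K := K) n).toFinset

/-- monic irreducible polynomials of degree at most `N` -/
noncomputable def irr (K : Type*) [Field K] [Fintype K] (N : ℕ) : Finset K[X] := (irr_finite (K := K) N).toFinset

section
variable {K : Type*} [Field K] [Fintype K]

theorem mem_mon {n : ℕ} {h : K[X]} : h ∈ mon K n ↔ h.Monic ∧ h.natDegree = n := by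
  simp [mon]

theorem mem_irr {n : ℕ} {h : K[X]} : h ∈ irr K n ↔ h.Monic ∧ Irreducible h ∧ h.natDegree ≤ n := by
  simp [irr]

open Classical in
theorem count_identity {n : ℕ} {h : K[X]} (hm : h.Monic) (hn : h.natDegree = n) :
    n = ∑ π ∈ irr K n, ∑ j ∈ Finset.Icc 1 n, if π ^ j ∣ h then π.natDegree else 0 := by
  classical
  set nf := UniqueFactorizationMonoid.normalizedFactors h with hnf
  have hprod : nf.prod = h := by
    have := UniqueFactorizationMonoid.prod_normalizedFactors_eq hm.ne_zero
    rw [hm.normalize_eq_self] at this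
    exact this
  have hmem : ∀ π ∈ nf, π.Monic ∧ Irreducible π ∧ π ∣ h := by
    intro π hπ
    have h1 := UniqueFactorizationMonoid.irreducible_of_normalized_factor π hπ
    have h2 := UniqueFactorizationMonoid.normalize_normalized_factor π hπ
    refine ⟨?_, h1, UniqueFactorizationMonoid.dvd_of_mem_normalizedFactors hπ⟩
    rw [← h2]; exact monic_normalize h1.ne_zero
  have hdeg : n = ∑ π ∈ nf.toFinset, nf.count π * π.natDegree := by
    rw [← hn]
    conv_lhs => rw [← hprod]
    rw [natDegree_multiset_prod_of_monic _ (fun π hπ => (hmem π hπ).1), Finset.sum_multiset_map_count]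
    simp
  have hsub : nf.toFinset ⊆ irr K n := by
    intro π hπ
    obtain ⟨h1, h2, h3⟩ := hmem π (Multiset.mem_toFinset.mp hπ)
    exact mem_irr.2 ⟨h1, h2, hn ▸ natDegree_le_of_dvd h3 hm.ne_zero⟩
  have hstep : ∀ π ∈ irr K n, (∑ j ∈ Finset.Icc 1 n, if π ^ j ∣ h then π.natDegree else 0) = nf.count π * π.natDegree := by
    intro π hπ
    obtain ⟨h1, h2, h3⟩ := mem_irr.1 hπ
    have hmul := UniqueFactorizationMonoid.emultiplicity_eq_count_normalizedFactors h2 hm.ne_zero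
    rw [h1.normalize_eq_self] at hmul
    have hiff : ∀ j, π ^ j ∣ h ↔ j ≤ nf.count π := by
      intro j
      rw [pow_dvd_iff_le_emultiplicity, hmul, Nat.cast_le]
    have hle : nf.count π ≤ n := by
      have := natDegree_le_of_dvd ((hiff _).2 le_rfl) hm.ne_zero
      rw [natDegree_pow, hn] at this
      have := h2.natDegree_pos
      nlinarith
    rw [← Finset.sum_filter, Finset.sum_const, smul_eq_mul]
    congr 1
    have : Finset.filter (fun j => π ^ j ∣ h) (Finset.Icc 1 n) = Finset.Icc 1 (nf.count π) := by
      ext j; simp only [Finset.mem_filter, Finset.mem_Icc, hiff]; omega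
    rw [this]; simp
  rw [Finset.sum_congr rfl hstep]
  conv_lhs => rw [hdeg]
  refine Finset.sum_subset hsub ?_
  intro π _ hπ
  rw [Multiset.mem_toFinset] at hπ
  rw [Multiset.count_eq_zero_of_notMem hπ, zero_mul]

/-- the multiplicative function -/
noncomputable def lam (ψ : AddChar K ℂ) (s m : K) (c : ℕ) (h : K[X]) : ℂ := ψ (s * pw h c + m * pw h 0)

/-- coefficients of the L-function -/
noncomputable def Acoef (ψ : AddChar K ℂ) (s m : K) (c : ℕ) (n : ℕ) : ℂ := ∑ h ∈ mon K n, lam ψ s m c h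

/-- exponential sum over the extension, through irreducible polynomials -/
noncomputable def Ssum (ψ : AddChar K ℂ) (s m : K) (c : ℕ) (N k : ℕ) : ℂ :=
  ∑ π ∈ irr K N, ∑ j ∈ Finset.Icc 1 N, if π.natDegree * j = k then (π.natDegree : ℂ) * lam ψ s m c π ^ j else 0

variable (ψ : AddChar K ℂ) (s m : K) (c : ℕ)

theorem lam_mul {g h : K[X]} (hg : g ≠ 0) (hh : h ≠ 0) : lam ψ s m c (g * h) = lam ψ s m c g * lam ψ s m c h := by
  simp only [lam]
  rw [← AddChar.map_add_eq_mul, pw_mul hg hh, pw_mul hg hh]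
  congr 1; ring

theorem lam_one : lam ψ s m c (1 : K[X]) = 1 := by
  simp [lam, pw_one]

theorem lam_pow {g : K[X]} (hg : g ≠ 0) (n : ℕ) : lam ψ s m c (g ^ n) = lam ψ s m c g ^ n := by
  induction n with
  | zero => simp [lam_one]
  | succ n ih => rw [pow_succ, lam_mul ψ s m c (pow_ne_zero _ hg) hg, ih, pow_succ]

theorem Acoef_zero : Acoef ψ s m c 0 = 1 := by
  have : mon K 0 = {1} := by
    ext h
    rw [mem_mon, Finset.mem_singleton]
    constructor
    · rintro ⟨h1, h2⟩; exact h1.natDegree_eq_zero.mp h2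
    · rintro rfl; exact ⟨monic_one, natDegree_one⟩
  rw [Acoef, this, Finset.sum_singleton, lam_one]

theorem Acoef_eq_zero (hψ : ψ ≠ 1) (hs : s ≠ 0) (hc : c ≠ 0) (hcK : ((c : K) + 1) ≠ 0) {n : ℕ} (hn : c + 1 ≤ n) :
    Acoef ψ s m c n = 0 := by
  obtain ⟨b, hb⟩ := (AddChar.ne_one_iff).1 hψ
  set a : K := - b / (s * (c + 1)) with ha
  have hab : - (s * ((c + 1) * a)) = b := by
    rw [ha]; field_simp
  have hmap : ∀ a : K, ∀ h ∈ mon K n, h + C a * X ^ (n - (c + 1)) ∈ mon K n := by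
    intro a h hh
    obtain ⟨h1, h2⟩ := mem_mon.1 hh
    have hdeg : (C a * X ^ (n - (c + 1)) : K[X]).degree < h.degree := by
      rw [degree_eq_natDegree h1.ne_zero, h2]
      refine lt_of_le_of_lt (degree_C_mul_X_pow_le _ _) ?_
      exact_mod_cast (by omega)
    refine mem_mon.2 ⟨h1.add_of_left hdeg, ?_⟩
    rw [natDegree_eq_of_degree_eq (degree_add_eq_left_of_degree_lt hdeg), h2]
  have hlam : ∀ h ∈ mon K n, lam ψ s m c (h + C a * X ^ (n - (c + 1))) = ψ b * lam ψ s m c h := by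
    intro h hh
    obtain ⟨h1, h2⟩ := mem_mon.1 hh
    obtain ⟨h3, h4⟩ := pw_shift hn h1 h2 a rfl
    simp only [lam]
    rw [h3, h4 0 (by omega), ← AddChar.map_add_eq_mul, ← hab]
    congr 1; ring
  have key : Acoef ψ s m c n = ψ b * Acoef ψ s m c n := by
    conv_rhs => rw [Acoef, Finset.mul_sum]
    rw [← Finset.sum_congr rfl hlam, Acoef]
    symm
    refine Finset.sum_nbij' (fun h => h + C a * X ^ (n - (c + 1))) (fun h => h + C (-a) * X ^ (n - (c + 1))) (hmap a) (hmap (-a)) ?_ ?_ ?_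
    · intro h _; simp
    · intro h _; simp
    · intro h _; rfl
  have : (1 - ψ b) * Acoef ψ s m c n = 0 := by linear_combination key
  rcases mul_eq_zero.mp this with h | h
  · exact absurd (sub_eq_zero.mp h).symm hb
  · exact h

theorem sum_dvd (n j : ℕ) {π : K[X]} (hπ : π.Monic) [DecidablePred (fun h : K[X] => π ^ j ∣ h)] :
    ∑ h ∈ mon K n, (if π ^ j ∣ h then lam ψ s m c h else 0) =
      if π.natDegree * j ≤ n then lam ψ s m c π ^ j * Acoef ψ s m c (n - π.natDegree * j) else 0 := by
  have hπj : (π ^ j).Monic := hπ.pow j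
  have hπd : (π ^ j).natDegree = π.natDegree * j := by rw [natDegree_pow, mul_comm]
  split_ifs with hle
  · rw [← Finset.sum_filter, Acoef, Finset.mul_sum]
    symm
    refine Finset.sum_bij (fun g _ => π ^ j * g) ?_ ?_ ?_ ?_
    · intro g hg
      obtain ⟨h1, h2⟩ := mem_mon.1 hg
      refine Finset.mem_filter.2 ⟨mem_mon.2 ⟨hπj.mul h1, ?_⟩, dvd_mul_right _ _⟩
      rw [hπj.natDegree_mul h1, hπd, h2]; omega
    · intro g _ g' _ h
      exact mul_left_cancel₀ hπj.ne_zero h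
    · intro h hh
      obtain ⟨hh1, g, rfl⟩ := Finset.mem_filter.1 hh
      obtain ⟨h1, h2⟩ := mem_mon.1 hh1
      have hgm : g.Monic := hπj.of_mul_monic_left h1
      refine ⟨g, mem_mon.2 ⟨hgm, ?_⟩, rfl⟩
      rw [hπj.natDegree_mul hgm, hπd] at h2; omega
    · intro g hg
      obtain ⟨h1, h2⟩ := mem_mon.1 hg
      rw [lam_mul ψ s m c hπj.ne_zero h1.ne_zero, lam_pow ψ s m c hπ.ne_zero]
  · refine Finset.sum_eq_zero fun h hh => ?_
    obtain ⟨h1, h2⟩ := mem_mon.1 hh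
    rw [if_neg]
    intro hd
    have := natDegree_le_of_dvd hd h1.ne_zero
    omega

theorem recurrence (n : ℕ) :
    (n : ℂ) * Acoef ψ s m c n = ∑ k ∈ Finset.Icc 1 n, Ssum ψ s m c n k * Acoef ψ s m c (n - k) := by
  classical
  have h1 : (n : ℂ) * Acoef ψ s m c n = ∑ π ∈ irr K n, ∑ j ∈ Finset.Icc 1 n,
      (π.natDegree : ℂ) * ∑ h ∈ mon K n, (if π ^ j ∣ h then lam ψ s m c h else 0) := by
    rw [Acoef, Finset.mul_sum]
    have : ∀ h ∈ mon K n, (n : ℂ) * lam ψ s m c h = ∑ π ∈ irr K n, ∑ j ∈ Finset.Icc 1 n,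
        (π.natDegree : ℂ) * (if π ^ j ∣ h then lam ψ s m c h else 0) := by
      intro h hh
      obtain ⟨h1, h2⟩ := mem_mon.1 hh
      conv_lhs => rw [show (n : ℂ) = _ from congrArg (Nat.cast (R := ℂ)) (count_identity h1 h2)]
      push_cast
      simp only [Finset.sum_mul]
      refine Finset.sum_congr rfl fun π _ => Finset.sum_congr rfl fun j _ => ?_
      split_ifs <;> simp
    rw [Finset.sum_congr rfl this, Finset.sum_comm]
    refine Finset.sum_congr rfl fun π _ => ?_
    rw [Finset.sum_comm]
    simp only [Finset.mul_sum]
  rw [h1]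
  simp only [Ssum, Finset.sum_mul]
  conv_rhs => rw [Finset.sum_comm]
  refine Finset.sum_congr rfl fun π hπ => ?_
  obtain ⟨hπ1, hπ2, -⟩ := mem_irr.1 hπ
  conv_rhs => rw [Finset.sum_comm]
  refine Finset.sum_congr rfl fun j hj => ?_
  rw [sum_dvd ψ s m c n j hπ1]
  have hpos := hπ2.natDegree_pos
  have hj1 := (Finset.mem_Icc.1 hj).1
  simp only [ite_mul, zero_mul]
  rw [Finset.sum_ite_eq]
  have : 1 ≤ π.natDegree * j := Nat.mul_pos hpos hj1
  simp only [Finset.mem_Icc, this, true_and]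
  split_ifs
  · ring
  · simp

theorem Ssum_eq {N k : ℕ} (hN : k ≤ N) : Ssum ψ s m c N k = Ssum ψ s m c k k := by
  simp only [Ssum]
  symm
  have hz : ∀ M, ∀ π ∈ irr K M, ∀ j ∈ Finset.Icc 1 M, ¬ (π.natDegree ≤ k ∧ j ≤ k) → 
      (if π.natDegree * j = k then (π.natDegree : ℂ) * lam ψ s m c π ^ j else 0) = 0 := by
    intro M π hπ j hj h
    rw [if_neg]
    intro h'
    apply h
    have h1 := (mem_irr.1 hπ).2.1.natDegree_pos
    have h2 := (Finset.mem_Icc.1 hj).1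
    constructor <;> nlinarith
  have : ∀ π ∈ irr K k, ∑ j ∈ Finset.Icc 1 k, (if π.natDegree * j = k then (π.natDegree : ℂ) * lam ψ s m c π ^ j else 0)
     = ∑ j ∈ Finset.Icc 1 N, (if π.natDegree * j = k then (π.natDegree : ℂ) * lam ψ s m c π ^ j else 0) := by
    intro π hπ
    refine Finset.sum_subset (Finset.Icc_subset_Icc_right hN) ?_
    intro j hj hj'
    refine hz N π (mem_irr.2 ?_) j hj ?_
    · obtain ⟨a, b, d⟩ := mem_irr.1 hπ; exact ⟨a, b, d.trans hN⟩
    · rintro ⟨-, h⟩; exact hj' (Finset.mem_Icc.2 ⟨(Finset.mem_Icc.1 hj).1, h⟩)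
  rw [Finset.sum_congr rfl this]
  refine Finset.sum_subset ?_ ?_
  · intro π hπ
    obtain ⟨a, b, d⟩ := mem_irr.1 hπ; exact mem_irr.2 ⟨a, b, d.trans hN⟩
  · intro π hπ hπ'
    refine Finset.sum_eq_zero fun j hj => hz N π hπ j hj ?_
    rintro ⟨h, -⟩
    obtain ⟨a, b, d⟩ := mem_irr.1 hπ
    exact hπ' (mem_irr.2 ⟨a, b, h⟩)

end
end LD
namespace LD
open Polynomial
section
variable {K : Type*} [Field K] [Fintype K]

theorem card_minpoly {L : Type*} [Field L] [Fintype L] [Algebra K L] [DecidableEq K[X]] {π : K[X]} (hm : π.Monic)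
    (hi : Irreducible π) (hd : π.natDegree ∣ Module.finrank K L) :
    (Finset.univ.filter (fun x : L => minpoly K x = π)).card = π.natDegree := by
  classical
  have hdvd : π ∣ X ^ (Nat.card K) ^ (Module.finrank K L) - X :=
    (hi.natDegree_dvd_iff_dvd_X_pow_card_pow_sub_X).1 hd
  have hcard : (Nat.card K) ^ (Module.finrank K L) = Fintype.card L := by
    rw [Nat.card_eq_fintype_card, ← Module.card_eq_pow_finrank]
  rw [hcard] at hdvd
  have hne : (X ^ Fintype.card L - X : L[X]) ≠ 0 := FiniteField.X_pow_card_sub_X_ne_zero L Fintype.one_lt_card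
  have hsp : (π.map (algebraMap K L)).Splits := by
    have hX : (X ^ Fintype.card L - X : L[X]).Splits := by
      rw [splits_iff_card_roots, FiniteField.roots_X_pow_card_sub_X,
        FiniteField.X_pow_card_sub_X_natDegree_eq L Fintype.one_lt_card]
      rfl
    refine Splits.of_dvd hX hne ?_
    have := Polynomial.map_dvd (algebraMap K L) hdvd
    simpa using this
  have hsep : π.Separable := PerfectField.separable_of_irreducible hi
  have := card_rootSet_eq_natDegree (K := L) hsep hsp
  rw [← this, ← Set.toFinset_card]
  congr 1
  ext x
  simp only [Finset.mem_filter, Finset.mem_univ, true_and, Set.mem_toFinset, mem_rootSet]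
  constructor
  · rintro rfl; exact ⟨hm.ne_zero, minpoly.aeval _ _⟩
  · rintro ⟨-, h⟩; exact (minpoly.eq_of_irreducible_of_monic hi h hm).symm

variable (ψ : AddChar K ℂ) (s m : K) (c : ℕ)

theorem Ssum_ext {L : Type*} [Field L] [Fintype L] [Algebra K L] (κ : ℕ) (hκ : Module.finrank K L = κ) :
    ∑ x : L, ψ (Algebra.trace K L (aeval x (C s * X ^ (c + 1) + C m * X : K[X]))) = Ssum ψ s m c κ κ := by
  classical
  have hκ0 : 0 < κ := by rw [← hκ]; exact Module.finrank_pos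
  have hmaps : ∀ x ∈ (Finset.univ : Finset L), minpoly K x ∈ irr K κ := by
    intro x _
    have hx : IsIntegral K x := IsIntegral.of_finite K x
    exact mem_irr.2 ⟨minpoly.monic hx, minpoly.irreducible hx, hκ ▸ minpoly.natDegree_le x⟩
  rw [← Finset.sum_fiberwise_of_maps_to hmaps, Ssum]
  refine Finset.sum_congr rfl fun π hπ => ?_
  obtain ⟨h1, h2, h3⟩ := mem_irr.1 hπ
  have hpos := h2.natDegree_pos
  have hterm : ∀ x ∈ Finset.univ.filter (fun x : L => minpoly K x = π),
      π.natDegree ∣ κ ∧ ψ (Algebra.trace K L (aeval x (C s * X ^ (c + 1) + C m * X : K[X]))) = lam ψ s m c π ^ (κ / π.natDegree) := by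
    intro x hx
    have hxm : minpoly K x = π := (Finset.mem_filter.1 hx).2
    have hxi : IsIntegral K x := IsIntegral.of_finite K x
    have hfin : π.natDegree * Module.finrank (IntermediateField.adjoin K {x}) L = κ := by
      rw [← hxm, ← IntermediateField.adjoin.finrank hxi, Module.finrank_mul_finrank, hκ]
    refine ⟨⟨_, hfin.symm⟩, ?_⟩
    have hq : κ / π.natDegree = Module.finrank (IntermediateField.adjoin K {x}) L := by
      rw [← hfin, Nat.mul_div_cancel_left _ hpos]
    rw [hq, lam, ← AddChar.map_nsmul_eq_pow]
    congr 1
    have e : aeval x (C s * X ^ (c + 1) + C m * X : K[X]) = s • x ^ (c + 1) + m • x ^ (0 + 1) := by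
      simp [Algebra.smul_def]
    rw [e, map_add, map_smul, map_smul, trace_pow_adjoin, trace_pow_adjoin, hxm]
    simp only [smul_eq_mul, nsmul_eq_mul]
    ring
  by_cases hdvd : π.natDegree ∣ κ
  · rw [Finset.sum_congr rfl (fun x hx => (hterm x hx).2), Finset.sum_const, card_minpoly h1 h2 (hκ ▸ hdvd)]
    rw [Finset.sum_eq_single (κ / π.natDegree)]
    · rw [if_pos (Nat.mul_div_cancel' hdvd), nsmul_eq_mul]
    · intro j _ hj
      rw [if_neg]
      rintro rfl
      apply hj; rw [Nat.mul_div_cancel_left _ hpos]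
    · intro h
      exfalso; apply h
      exact Finset.mem_Icc.2 ⟨Nat.div_pos h3 hpos, Nat.div_le_self _ _⟩
  · rw [Finset.sum_eq_zero (fun x hx => absurd (hterm x hx).1 hdvd)]
    symm
    refine Finset.sum_eq_zero fun j _ => if_neg ?_
    rintro rfl
    exact hdvd (dvd_mul_right _ _)

theorem exists_roots (hψ : ψ ≠ 1) (hs : s ≠ 0) (hc : c ≠ 0) (hcK : ((c : K) + 1) ≠ 0) :
    ∃ r : Multiset ℂ, r.card = c ∧ ∀ k, Ssum ψ s m c (k + 1) (k + 1) = - (r.map (fun z => z ^ (k + 1))).sum := by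
  classical
  set A := Acoef ψ s m c with hA
  have hA0 : ∀ n, c + 1 ≤ n → A n = 0 := fun n hn => Acoef_eq_zero ψ s m c hψ hs hc hcK hn
  have hA1 : A 0 = 1 := Acoef_zero ψ s m c
  let P : ℂ[X] := X ^ c + ∑ i ∈ Finset.range c, C (A (c - i)) * X ^ i
  have hlow : (∑ i ∈ Finset.range c, C (A (c - i)) * X ^ i : ℂ[X]).degree < (c : WithBot ℕ) := by
    refine (degree_sum_le _ _).trans_lt ?_
    rw [Finset.sup_lt_iff (WithBot.bot_lt_coe _)]
    intro i hi
    refine (degree_C_mul_X_pow_le _ _).trans_lt ?_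
    exact_mod_cast Finset.mem_range.1 hi
  have hPm : P.Monic := monic_X_pow_add hlow
  have hPd : P.natDegree = c := by
    rw [natDegree_add_eq_left_of_degree_lt (by rwa [degree_X_pow]), natDegree_X_pow]
  have hcoef : ∀ n, PowerSeries.coeff n (rv P) = A n := by
    intro n
    rw [rv, Polynomial.coeff_coe, reverse, hPd, coeff_reflect]
    by_cases hn : n ≤ c
    · rw [revAt_le hn]
      simp only [P, coeff_add, coeff_X_pow, finsetSum_coeff, coeff_C_mul, mul_ite, mul_one, mul_zero]
      rcases Nat.eq_zero_or_pos n with rfl | hn0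
      · rw [Finset.sum_eq_zero]
        · simp [hA1]
        · intro i hi
          have := Finset.mem_range.1 hi
          rw [if_neg (by omega)]
      · rw [if_neg (by omega), Finset.sum_eq_single (c - n)]
        · rw [if_pos rfl, zero_add]; congr 1; omega
        · intro i _ hi; rw [if_neg (by omega)]
        · intro h; exact absurd (Finset.mem_range.2 (by omega)) h
    · rw [revAt_eq_self_of_lt (by omega), hA0 n (by omega), coeff_eq_zero_of_natDegree_lt (by omega)]
  have hder : PowerSeries.derivative ℂ (rv P) = PowerSeries.mk (fun k => Ssum ψ s m c (k + 1) (k + 1)) * rv P := by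
    ext n
    rw [PowerSeries.coeff_derivative, hcoef, PowerSeries.coeff_mul]
    have := recurrence ψ s m c (n + 1)
    push_cast at this
    rw [← hA] at this
    rw [mul_comm, this, Finset.Nat.sum_antidiagonal_eq_sum_range_succ_mk]
    symm
    refine Finset.sum_bij (fun k _ => k + 1) ?_ ?_ ?_ ?_
    · intro k hk
      have := Finset.mem_range.1 hk
      exact Finset.mem_Icc.2 ⟨by omega, by omega⟩
    · intro k _ l _ h; exact Nat.succ_injective h
    · intro k hk
      have := Finset.mem_Icc.1 hk
      exact ⟨k - 1, Finset.mem_range.2 (by omega), by omega⟩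
    · intro k hk
      have := Finset.mem_range.1 hk
      rw [PowerSeries.coeff_mk, hcoef, Ssum_eq ψ s m c (N := n + 1) (k := k + 1) (by omega), Nat.add_sub_add_right]
  have hpw : ∀ k, pw P k = - Ssum ψ s m c (k + 1) (k + 1) := by
    intro k
    rw [pw, ld, hder, mul_assoc, PowerSeries.mul_inv_cancel _ (rv_const hPm.ne_zero), mul_one, PowerSeries.coeff_mk]
  have hsp : P.Splits := IsAlgClosed.splits _
  refine ⟨P.roots, ?_, ?_⟩
  · rw [← hPd, hsp.natDegree_eq_card_roots]
  · intro k
    rw [← pw_multiset, ← hsp.eq_prod_roots_of_monic hPm, hpw, neg_neg]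

theorem weil (hψ : ψ ≠ 1) (hs : s ≠ 0) (hc : c ≠ 0) (hcK : Nat.Coprime (c + 1) (Fintype.card K)) :
    ‖∑ x : K, ψ (s * x ^ (c + 1) + m * x)‖ ≤ c * Real.sqrt (Fintype.card K) := by
  classical
  obtain ⟨p, hp⟩ := CharP.exists K
  obtain ⟨⟨e, he⟩, hpp, hcardK⟩ := FiniteField.card K p
  simp only [PNat.mk_coe] at hcardK
  have : Fact p.Prime := ⟨hpp⟩
  have hcK' : ((c : K) + 1) ≠ 0 := by
    intro h
    have h1 : ((c + 1 : ℕ) : K) = 0 := by exact_mod_cast h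
    rw [CharP.cast_eq_zero_iff K p] at h1
    have h2 : p ∣ Fintype.card K := by rw [hcardK]; exact dvd_pow_self p (by omega)
    have := Nat.dvd_gcd h1 h2
    rw [hcK] at this
    exact hpp.one_lt.ne' (Nat.dvd_one.1 this)
  obtain ⟨r, hr, hS⟩ := exists_roots ψ s m c hψ hs hc hcK'
  have hq1 : 1 < Fintype.card K := Fintype.one_lt_card
  have hqpos : (0 : ℝ) < Fintype.card K := by exact_mod_cast (by omega)
  set f : K[X] := C s * X ^ (c + 1) + C m * X with hf
  have hfd : f.natDegree = c + 1 := by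
    rw [hf, natDegree_add_eq_left_of_natDegree_lt]
    · exact natDegree_C_mul_X_pow _ _ hs
    · rw [natDegree_C_mul_X_pow _ _ hs]
      exact (natDegree_C_mul_le _ _).trans_lt (by simp; omega)
  have hroots : ∀ z ∈ r, ‖z‖ ≤ Real.sqrt (Fintype.card K) := by
    refine roots_bound r _ ((Fintype.card K : ℝ) * (2 * (c + 1 : ℕ) + 2)) (Real.sqrt_pos.2 hqpos) (c + 3) ?_
    intro μ hμ
    have : Fintype (FiniteField.Extension K p (2 * μ)) := Fintype.ofFinite _
    have hne : NeZero (2 * μ) := ⟨by omega⟩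
    have hfin : Module.finrank K (FiniteField.Extension K p (2 * μ)) = 2 * μ := FiniteField.finrank_extension K p (2 * μ)
    have hb := ext_sum_bound (L := FiniteField.Extension K p (2 * μ)) ψ hψ μ (c + 1) (by omega) hfin hcK (by omega)
      (by have := Nat.lt_pow_self hq1 (n := μ); omega) f hfd
    rw [hf, Ssum_ext ψ s m c (2 * μ) hfin] at hb
    obtain ⟨k, hk⟩ : ∃ k, 2 * μ = k + 1 := ⟨2 * μ - 1, by omega⟩
    rw [pow_mul (Real.sqrt _), Real.sq_sqrt hqpos.le]
    rw [hk, hS, norm_neg] at hb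
    rw [hk]
    exact hb
  have h1 : ∑ x : K, ψ (s * x ^ (c + 1) + m * x) = Ssum ψ s m c 1 1 := by
    rw [← Ssum_ext (L := K) ψ s m c 1 (Module.finrank_self K)]
    refine Finset.sum_congr rfl fun x _ => ?_
    rw [Algebra.trace_self_apply]
    simp
  rw [h1, hS 0, norm_neg]
  simp only [zero_add, pow_one, Multiset.map_id']
  calc _ ≤ (r.map (fun z => ‖z‖)).sum := by
        exact norm_multiset_sum_le r
    _ ≤ (r.map (fun z => ‖z‖)).card • Real.sqrt (Fintype.card K) := by
        apply Multiset.sum_le_card_nsmul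
        intro y hy
        obtain ⟨z, hz, rfl⟩ := Multiset.mem_map.1 hy
        exact hroots z hz
    _ = _ := by rw [Multiset.card_map, hr, nsmul_eq_mul]

end
end LD
namespace LD

theorem plancherel {M W ι : Type*} [Fintype M] [DecidableEq W] (χ : M → W → ℂ) (Q : ℝ)
    (h : ∀ w w', ∑ m, χ m w * (starRingEnd ℂ) (χ m w') = if w = w' then (Q : ℂ) else 0)
    (S : Finset ι) (g : ι → W) :
    ∑ m, ‖∑ x ∈ S, χ m (g x)‖ ^ 2 = Q * ∑ x ∈ S, ∑ y ∈ S, if g x = g y then (1 : ℝ) else 0 := by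
  have : ((∑ m, ‖∑ x ∈ S, χ m (g x)‖ ^ 2 : ℝ) : ℂ)
      = ((Q * ∑ x ∈ S, ∑ y ∈ S, if g x = g y then (1 : ℝ) else 0 : ℝ) : ℂ) := by
    push_cast
    simp_rw [← Complex.mul_conj', map_sum, Finset.sum_mul_sum]
    rw [Finset.sum_comm, Finset.mul_sum]
    refine Finset.sum_congr rfl fun x _ => ?_
    rw [Finset.sum_comm, Finset.mul_sum]
    refine Finset.sum_congr rfl fun y _ => ?_
    rw [h]
    split_ifs <;> simp
  exact_mod_cast this

theorem collide {W ι : Type*} [DecidableEq W] (S : Finset ι) (g : ι → W) :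
    (S.card : ℝ) ^ 2 ≤ (S.image g).card * ∑ x ∈ S, ∑ y ∈ S, if g x = g y then (1 : ℝ) else 0 := by
  classical
  have hm : ∀ x ∈ S, g x ∈ S.image g := fun x hx => Finset.mem_image_of_mem g hx
  have h1 : (S.card : ℝ) = ∑ t ∈ S.image g, ((S.filter (fun x => g x = t)).card : ℝ) := by
    exact_mod_cast Finset.card_eq_sum_card_fiberwise hm
  have h2 : ∑ x ∈ S, ∑ y ∈ S, (if g x = g y then (1 : ℝ) else 0)
      = ∑ t ∈ S.image g, ((S.filter (fun x => g x = t)).card : ℝ) ^ 2 := by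
    rw [← Finset.sum_fiberwise_of_maps_to hm]
    refine Finset.sum_congr rfl fun t _ => ?_
    rw [Finset.sum_congr rfl (g := fun _ => ((S.filter (fun x => g x = t)).card : ℝ)), Finset.sum_const, nsmul_eq_mul, sq]
    intro x hx
    have := (Finset.mem_filter.1 hx).2
    subst this
    rw [Finset.sum_boole]
    simp_rw [eq_comm]
  rw [h2, h1]
  exact sq_sum_le_card_mul_sum_sq

variable {K : Type*} [Field K] [Fintype K] [DecidableEq K] {d : ℕ}

theorem orth_one (ψ : AddChar K ℂ) (hψ : ψ.IsPrimitive) (w w' : K) :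
    ∑ s, ψ (s * w) * (starRingEnd ℂ) (ψ (s * w')) = if w = w' then ((Fintype.card K : ℝ) : ℂ) else 0 := by
  have := AddChar.sum_mulShift (w - w') hψ
  simp_rw [← AddChar.map_neg_eq_conj, ← AddChar.map_add_eq_mul, ← sub_eq_add_neg, ← mul_sub]
  rw [this]
  simp only [sub_eq_zero]
  split_ifs <;> simp

theorem map_sum_aux (ψ : AddChar K ℂ) {ι : Type*} (S : Finset ι) (f : ι → K) :
    ψ (∑ j ∈ S, f j) = ∏ j ∈ S, ψ (f j) := by
  classical
  induction S using Finset.induction_on with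
  | empty => simp
  | insert j S hj ih => rw [Finset.sum_insert hj, Finset.prod_insert hj, AddChar.map_add_eq_mul, ih]

theorem prod_sum (ψ : AddChar K ℂ) (f : Fin d → K → K) :
    ∑ x : Fin d → K, ψ (∑ j, f j (x j)) = ∏ j, ∑ t, ψ (f j t) := by
  rw [Finset.prod_univ_sum, Fintype.piFinset_univ]
  refine Finset.sum_congr rfl fun x _ => ?_
  exact map_sum_aux ψ _ _

theorem orth_d (ψ : AddChar K ℂ) (hψ : ψ.IsPrimitive) (w w' : Fin d → K) :
    ∑ m : Fin d → K, ψ (∑ j, m j * w j) * (starRingEnd ℂ) (ψ (∑ j, m j * w' j))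
      = if w = w' then (((Fintype.card K : ℝ) ^ d : ℝ) : ℂ) else 0 := by
  simp_rw [← AddChar.map_neg_eq_conj, ← AddChar.map_add_eq_mul, ← sub_eq_add_neg, ← Finset.sum_sub_distrib, ← mul_sub]
  rw [prod_sum ψ (fun j t => t * (w j - w' j))]
  simp_rw [AddChar.sum_mulShift _ hψ, sub_eq_zero]
  split_ifs with h
  · subst h; simp
  · obtain ⟨j, hj⟩ := Function.ne_iff.1 h
    exact Finset.prod_eq_zero (Finset.mem_univ j) (by simp [hj])

theorem bilin (ψ : AddChar K ℂ) (hψ : ψ.IsPrimitive) (φ : (Fin d → K) → ℂ) (M : ℝ) (hM : 0 ≤ M)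
    (hφ : ∀ m : Fin d → K, ‖∑ x, φ x * ψ (∑ j, m j * x j)‖ ≤ M) (E F : Finset (Fin d → K)) :
    ‖∑ p ∈ E ×ˢ F, φ (p.1 - p.2)‖ ^ 2 ≤ M ^ 2 * (E.card * F.card) := by
  classical
  set Q : ℝ := (Fintype.card K : ℝ) ^ d with hQ
  have hQ0 : 0 < Q := pow_pos (by exact_mod_cast Fintype.card_pos) _
  let χ : (Fin d → K) → (Fin d → K) → ℂ := fun m x => ψ (∑ j, m j * x j)
  have horth : ∀ w w', ∑ m, χ m w * (starRingEnd ℂ) (χ m w') = if w = w' then (Q : ℂ) else 0 := orth_d ψ hψ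
  have hsub : ∀ m x y, χ m (x - y) = χ m x * (starRingEnd ℂ) (χ m y) := by
    intro m x y
    simp only [χ, Pi.sub_apply]
    rw [← AddChar.map_neg_eq_conj, ← AddChar.map_add_eq_mul, ← sub_eq_add_neg, ← Finset.sum_sub_distrib]
    simp_rw [mul_sub]
  have hinv : ∀ z, (Q : ℂ) * φ z = ∑ m, (∑ x, φ x * χ m x) * (starRingEnd ℂ) (χ m z) := by
    intro z
    simp_rw [Finset.sum_mul]
    rw [Finset.sum_comm]
    simp_rw [mul_assoc, ← Finset.mul_sum, horth]
    simp [mul_comm]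
  have hkey : (Q : ℂ) * ∑ p ∈ E ×ˢ F, φ (p.1 - p.2)
      = ∑ m, (∑ x, φ x * χ m x) * ((starRingEnd ℂ) (∑ x ∈ E, χ m x) * ∑ y ∈ F, χ m y) := by
    rw [Finset.mul_sum]
    simp_rw [hinv]
    rw [Finset.sum_comm]
    refine Finset.sum_congr rfl fun m _ => ?_
    rw [← Finset.mul_sum]
    congr 1
    rw [map_sum, Finset.sum_mul_sum, Finset.sum_product]
    simp_rw [hsub, map_mul, Complex.conj_conj]
  have hE : ∑ m, ‖∑ x ∈ E, χ m x‖ ^ 2 = Q * E.card := by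
    have := plancherel χ Q horth E id
    simpa using this
  have hF : ∑ m, ‖∑ x ∈ F, χ m x‖ ^ 2 = Q * F.card := by
    have := plancherel χ Q horth F id
    simpa using this
  have h1 : Q * ‖∑ p ∈ E ×ˢ F, φ (p.1 - p.2)‖ ≤ M * ∑ m, ‖∑ x ∈ E, χ m x‖ * ‖∑ x ∈ F, χ m x‖ := by
    have : Q * ‖∑ p ∈ E ×ˢ F, φ (p.1 - p.2)‖ = ‖(Q : ℂ) * ∑ p ∈ E ×ˢ F, φ (p.1 - p.2)‖ := by
      rw [norm_mul, Complex.norm_real, Real.norm_of_nonneg hQ0.le]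
    rw [this, hkey, Finset.mul_sum]
    refine (norm_sum_le _ _).trans (Finset.sum_le_sum fun m _ => ?_)
    rw [norm_mul, norm_mul, RCLike.norm_conj]
    exact mul_le_mul_of_nonneg_right (hφ m) (by positivity)
  have h2 := Finset.sum_mul_sq_le_sq_mul_sq Finset.univ (fun m => ‖∑ x ∈ E, χ m x‖) (fun m => ‖∑ x ∈ F, χ m x‖)
  rw [hE, hF] at h2
  have h3 : (Q * ‖∑ p ∈ E ×ˢ F, φ (p.1 - p.2)‖) ^ 2 ≤ M ^ 2 * (Q * E.card * (Q * F.card)) := by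
    refine (pow_le_pow_left₀ (by positivity) h1 2).trans ?_
    rw [mul_pow]
    exact mul_le_mul_of_nonneg_left h2 (by positivity)
  have h4 : Q ^ 2 * ‖∑ p ∈ E ×ˢ F, φ (p.1 - p.2)‖ ^ 2 ≤ Q ^ 2 * (M ^ 2 * (E.card * F.card)) := by
    linarith [h3]
  exact le_of_mul_le_mul_left h4 (by positivity)

theorem exists_prim (K : Type*) [Field K] [Fintype K] : ∃ ψ : AddChar K ℂ, ψ.IsPrimitive := by
  have : ∃ ψ : AddChar K ℂ, ψ 1 ≠ 1 := AddChar.exists_apply_ne_zero.2 one_ne_zero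
  obtain ⟨ψ, h⟩ := this
  refine ⟨ψ, AddChar.IsPrimitive.of_ne_one ?_⟩
  rintro rfl
  exact h rfl

theorem phi_bound (ψ : AddChar K ℂ) (hψ : ψ.IsPrimitive) (e : Fin d → ℕ) (he : ∀ j, 2 ≤ e j)
    (hg : ∀ j, Nat.gcd (e j) (Fintype.card K) = 1) (a : Fin d → K) (ha : ∀ j, a j ≠ 0) (s : K) (hs : s ≠ 0)
    (m : Fin d → K) :
    ‖∑ x : Fin d → K, ψ (s * ∑ j, a j * (x j) ^ (e j)) * ψ (∑ j, m j * x j)‖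
      ≤ (∏ j, (e j : ℝ)) * Real.sqrt (Fintype.card K) ^ d := by
  have hne : ψ ≠ 1 := by
    intro h
    have := hψ (one_ne_zero (α := K))
    apply this
    rw [h]; ext x; simp
  simp_rw [← AddChar.map_add_eq_mul, Finset.mul_sum, ← Finset.sum_add_distrib]
  rw [prod_sum ψ (fun j t => s * (a j * t ^ (e j)) + m j * t), norm_prod]
  have : Real.sqrt (Fintype.card K) ^ d = ∏ _j : Fin d, Real.sqrt (Fintype.card K) := by simp
  rw [this, ← Finset.prod_mul_distrib]
  refine Finset.prod_le_prod (fun _ _ => norm_nonneg _) fun j _ => ?_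
  obtain ⟨c, hc⟩ : ∃ c, e j = c + 1 := ⟨e j - 1, by have := he j; omega⟩
  have h2 := he j
  have hw := weil ψ (s * a j) (m j) c hne (mul_ne_zero hs (ha j)) (by omega) (by rw [← hc]; exact hg j)
  simp_rw [← mul_assoc]
  rw [hc]
  refine hw.trans (mul_le_mul_of_nonneg_right ?_ (Real.sqrt_nonneg _))
  push_cast; linarith

end LD

/-- Erdos-Falconer type result for diagonal polynomials over finite fields. -/
theorem stmt6 (d : ℕ) (hd : 1 ≤ d) (e : Fin d → ℕ) (he : ∀ j, 2 ≤ e j) :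
    ∃ C : ℝ, 0 < C ∧ ∃ c : ℝ, 0 < c ∧
      ∀ (K : Type) [Field K] [Fintype K] [DecidableEq K],
        (∀ j, Nat.gcd (e j) (Fintype.card K) = 1) →
        ∀ a : Fin d → K, (∀ j, a j ≠ 0) →
          ∀ E F : Finset (Fin d → K),
            C * (Fintype.card K : ℝ) ^ (d + 1) ≤ (E.card : ℝ) * (F.card : ℝ) →
            c * (Fintype.card K : ℝ) ≤
              (((E ×ˢ F).image
                (fun p => ∑ j, a j * (p.1 j - p.2 j) ^ (e j))).card : ℝ) := by
  set B : ℝ := ∏ j, (e j : ℝ) with hB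
  have hB0 : 0 ≤ B := Finset.prod_nonneg fun j _ => by positivity
  refine ⟨1, one_pos, 1 / (1 + B ^ 2), by positivity, ?_⟩
  intro K _ _ _ hg a ha E F hEF
  obtain ⟨ψ, hψ⟩ := LD.exists_prim K
  set q : ℝ := (Fintype.card K : ℝ) with hq
  have hq0 : 0 < q := by rw [hq]; exact_mod_cast Fintype.card_pos
  set g : (Fin d → K) × (Fin d → K) → K := fun p => ∑ j, a j * (p.1 j - p.2 j) ^ (e j) with hgdef
  set N : ℝ := (E.card : ℝ) * (F.card : ℝ) with hN
  have hN1 : q ^ (d + 1) ≤ N := by linarith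
  have hN0 : 0 < N := lt_of_lt_of_le (by positivity) hN1
  have hpl := LD.plancherel (fun s w => ψ (s * w)) q (LD.orth_one ψ hψ) (E ×ˢ F) g
  have hcol := LD.collide (E ×ˢ F) g
  have hcard : ((E ×ˢ F).card : ℝ) = N := by rw [Finset.card_product]; push_cast; rfl
  rw [hcard] at hcol
  set T : ℝ := ∑ x ∈ E ×ˢ F, ∑ y ∈ E ×ˢ F, if g x = g y then (1 : ℝ) else 0 with hT
  have hsne : ∀ s : K, s ≠ 0 → ‖∑ x ∈ E ×ˢ F, ψ (s * g x)‖ ^ 2 ≤ B ^ 2 * q ^ d * N := by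
    intro s hs
    have := LD.bilin ψ hψ (fun x => ψ (s * ∑ j, a j * (x j) ^ (e j))) (B * Real.sqrt q ^ d)
      (by positivity) (LD.phi_bound ψ hψ e he hg a ha s hs) E F
    rw [mul_pow, ← pow_mul, mul_comm d 2, pow_mul, Real.sq_sqrt hq0.le] at this
    exact this
  have hs0 : ‖∑ x ∈ E ×ˢ F, ψ (0 * g x)‖ ^ 2 = N ^ 2 := by
    rw [← hcard]; simp
  have hup : ∑ s : K, ‖∑ x ∈ E ×ˢ F, ψ (s * g x)‖ ^ 2 ≤ (1 + B ^ 2) * N ^ 2 := by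
    rw [← Finset.add_sum_erase _ _ (Finset.mem_univ (0 : K)), hs0]
    have h1 : ∑ s ∈ Finset.univ.erase (0 : K), ‖∑ x ∈ E ×ˢ F, ψ (s * g x)‖ ^ 2 ≤ q * (B ^ 2 * q ^ d * N) := by
      refine (Finset.sum_le_sum fun s hs => hsne s (Finset.ne_of_mem_erase hs)).trans ?_
      rw [Finset.sum_const, nsmul_eq_mul]
      refine mul_le_mul_of_nonneg_right ?_ (by positivity)
      rw [hq]; exact_mod_cast Finset.card_le_univ _
    have h2 : q * (B ^ 2 * q ^ d * N) = (B ^ 2 * N) * q ^ (d + 1) := by ring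
    have h3 : (B ^ 2 * N) * q ^ (d + 1) ≤ (B ^ 2 * N) * N := mul_le_mul_of_nonneg_left hN1 (by positivity)
    nlinarith
  have hqT : q * T ≤ (1 + B ^ 2) * N ^ 2 := hpl ▸ hup
  set D : ℝ := (((E ×ˢ F).image g).card : ℝ) with hD
  have hD0 : 0 ≤ D := by positivity
  have h5 : q * N ^ 2 ≤ (D * (1 + B ^ 2)) * N ^ 2 := by
    calc q * N ^ 2 ≤ q * (D * T) := mul_le_mul_of_nonneg_left hcol hq0.le
      _ = D * (q * T) := by ring
      _ ≤ D * ((1 + B ^ 2) * N ^ 2) := mul_le_mul_of_nonneg_left hqT hD0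
      _ = _ := by ring
  have h6 : q ≤ D * (1 + B ^ 2) := le_of_mul_le_mul_right h5 (by positivity)
  rw [one_div, inv_mul_eq_div, div_le_iff₀ (by positivity)]
  exact h6
end

section
/- Fix an odd integer d ≥ 3. There exists a constant c > 0 depending only on d such that for every finite field F_q of odd characteristic, every polynomial P(x) = ∑_{j=1}^d a_j x_j^2 ∈ F_q[x_1,…,x_d] with a_j ≠ 0 for all j, and ALL sets E, F ⊆ F_q^d (with no lower bound assumed on |E|·|F|), the distance set satisfies |Δ_P(E,F)| ≥ c · min( q , q^{−(d−1)/2} √(|E|·|F|) ). -/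
noncomputable def etaC (K : Type) [Field K] [Fintype K] [DecidableEq K] : MulChar K ℂ :=
  (quadraticChar K).ringHomComp (Int.castRingHom ℂ)

lemma etaC_apply {K : Type} [Field K] [Fintype K] [DecidableEq K] (x : K) :
    etaC K x = ((quadraticChar K x : ℤ) : ℂ) := rfl

lemma etaC_sq {K : Type} [Field K] [Fintype K] [DecidableEq K] {x : K} (hx : x ≠ 0) :
    etaC K x ^ 2 = 1 := by
  rw [etaC_apply, ← Int.cast_pow, quadraticChar_sq_one hx, Int.cast_one]

lemma etaC_norm {K : Type} [Field K] [Fintype K] [DecidableEq K] {x : K} (hx : x ≠ 0) :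
    ‖etaC K x‖ = 1 := by
  have h := congrArg norm (etaC_sq hx)
  rw [norm_pow, norm_one] at h
  exact (pow_eq_one_iff_of_nonneg (norm_nonneg _) two_ne_zero).1 h

lemma etaC_ne_one {K : Type} [Field K] [Fintype K] [DecidableEq K] (h2 : ringChar K ≠ 2) :
    etaC K ≠ 1 := by
  intro h
  apply quadraticChar_ne_one h2
  exact (MulChar.ringHomComp_eq_one_iff (RingHom.injective_int _)).1 h

lemma gauss_norm {K : Type} [Field K] [Fintype K] [DecidableEq K] (h2 : ringChar K ≠ 2)
    {ψ : AddChar K ℂ} (hψ : ψ.IsPrimitive) :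
    ‖gaussSum (etaC K) ψ‖ ^ 2 = (Fintype.card K : ℝ) := by
  have h := gaussSum_sq (etaC_ne_one h2) ((quadraticChar_isQuadratic K).comp (Int.castRingHom ℂ)) hψ
  have h' := congrArg norm h
  change ‖gaussSum (etaC K) ψ ^ 2‖ = ‖etaC K (-1) * _‖ at h'
  rw [norm_pow, norm_mul, etaC_norm (by simp), one_mul] at h'
  simpa using h'

lemma map_sum_prod {K : Type} [Field K] {ι : Type*} (ψ : AddChar K ℂ) (s : Finset ι) (f : ι → K) :
    ψ (∑ i ∈ s, f i) = ∏ i ∈ s, ψ (f i) := by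
  classical
  induction s using Finset.induction_on with
  | empty => simp
  | insert a s ha ih => rw [Finset.sum_insert ha, Finset.prod_insert ha, AddChar.map_add_eq_mul, ih]

lemma quad1 {K : Type} [Field K] [Fintype K] [DecidableEq K] (h2 : ringChar K ≠ 2)
    {ψ : AddChar K ℂ} (hψ : ψ.IsPrimitive) {s : K} (hs : s ≠ 0) :
    ∑ x, ψ (s * x ^ 2) = etaC K s * gaussSum (etaC K) ψ := by
  have h1 : ∑ x, ψ (s * x ^ 2) = ∑ y, (etaC K y + 1) * ψ (s * y) := by
    rw [← Finset.sum_fiberwise (s := Finset.univ) (g := fun x : K => x ^ 2)]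
    refine Finset.sum_congr rfl fun y _ => ?_
    have h := quadraticChar_card_sqrts h2 y
    rw [Finset.sum_congr rfl (g := fun _ => ψ (s * y))
      (fun x hx => by rw [(Finset.mem_filter.1 hx).2])]
    rw [Finset.sum_const, nsmul_eq_mul, etaC_apply]
    congr 1
    have h' : (((({x : K | x ^ 2 = y} : Set K).toFinset.card : ℕ) : ℤ) : ℂ) =
      (((quadraticChar K) y + 1 : ℤ) : ℂ) := by rw [h]
    push_cast at h'
    rw [← h']
    congr 2
    ext x; simp
  rw [h1]
  simp only [add_mul, one_mul, Finset.sum_add_distrib]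
  have h3 : ∑ y, ψ (s * y) = 0 := by
    have := AddChar.sum_mulShift s hψ
    simp only [mul_comm s]
    rw [this, if_neg hs]; simp
  rw [h3, add_zero]
  have h4 := gaussSum_mulShift (etaC K) ψ (Units.mk0 s hs)
  rw [← h4, ← mul_assoc]
  simp only [Units.val_mk0]
  rw [← pow_two, etaC_sq hs, one_mul]
  rfl

lemma four_ne {K : Type} [Field K] (h2 : ringChar K ≠ 2) : (4 : K) ≠ 0 := by
  have := Ring.two_ne_zero h2
  have h : (4 : K) = 2 * 2 := by norm_num
  rw [h]; exact mul_ne_zero this this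

lemma quad2 {K : Type} [Field K] [Fintype K] [DecidableEq K] (h2 : ringChar K ≠ 2)
    {ψ : AddChar K ℂ} (hψ : ψ.IsPrimitive) {s : K} (hs : s ≠ 0) (m : K) :
    ∑ x, ψ (s * x ^ 2 + m * x) = etaC K s * gaussSum (etaC K) ψ * ψ (-(m ^ 2 / (4 * s))) := by
  have h20 := Ring.two_ne_zero h2
  have h40 := four_ne h2
  rw [← quad1 h2 hψ hs, Finset.sum_mul,
    ← Equiv.sum_comp (Equiv.addRight (m / (2 * s))) (fun x => ψ (s * x ^ 2) * _)]
  refine Finset.sum_congr rfl fun x _ => ?_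
  rw [← AddChar.map_add_eq_mul]
  congr 1
  simp only [Equiv.coe_addRight]
  have : (4 : K) = 2 * 2 := by norm_num
  rw [this]
  field_simp
  ring

lemma salie {K : Type} [Field K] [Fintype K] [DecidableEq K] (h2 : ringChar K ≠ 2)
    {ψ : AddChar K ℂ} (hψ : ψ.IsPrimitive) (t M : K) :
    ‖gaussSum (etaC K) ψ * ∑ s ∈ Finset.univ.erase (0 : K),
      etaC K s * ψ (-(s * t) - M / (4 * s))‖ ≤ 3 * (Fintype.card K : ℝ) := by
  have h40 := four_ne h2
  obtain ⟨c, m, hc, hm⟩ : ∃ c m : K, c ≠ 0 ∧ m ^ 2 / c = M := by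
    by_cases hM : M = 0
    · exact ⟨1, 0, one_ne_zero, by simp [hM]⟩
    · exact ⟨M, M, hM, by field_simp⟩
  have key : etaC K c * (gaussSum (etaC K) ψ * ∑ s ∈ Finset.univ.erase (0 : K),
      etaC K s * ψ (-(s * t) - M / (4 * s))) =
      ∑ s ∈ Finset.univ.erase (0 : K), ∑ x, ψ (s * (c * x ^ 2 - t) + m * x) := by
    rw [Finset.mul_sum, Finset.mul_sum]
    refine Finset.sum_congr rfl fun s hs => ?_
    have hs0 : s ≠ 0 := Finset.ne_of_mem_erase hs
    have : ∀ x, ψ (s * (c * x ^ 2 - t) + m * x) = ψ ((s * c) * x ^ 2 + m * x) * ψ (-(s * t)) := by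
      intro x; rw [← AddChar.map_add_eq_mul]; congr 1; ring
    simp only [this]
    rw [← Finset.sum_mul, quad2 h2 hψ (mul_ne_zero hs0 hc), map_mul, sub_eq_add_neg,
      AddChar.map_add_eq_mul]
    have : m ^ 2 / (4 * (s * c)) = M / (4 * s) := by rw [← hm]; field_simp
    rw [this]; ring
  have hall : ∑ s, ∑ x, ψ (s * (c * x ^ 2 - t) + m * x) =
      ∑ x ∈ Finset.univ.filter (fun x => c * x ^ 2 - t = 0), (Fintype.card K : ℂ) * ψ (m * x) := by
    rw [Finset.sum_comm, Finset.sum_filter]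
    refine Finset.sum_congr rfl fun x _ => ?_
    simp only [AddChar.map_add_eq_mul]
    rw [← Finset.sum_mul, AddChar.sum_mulShift _ hψ]
    split_ifs <;> simp
  have hcard : (Finset.univ.filter (fun x : K => c * x ^ 2 - t = 0)).card ≤ 2 := by
    have h := quadraticChar_card_sqrts h2 (t / c)
    have h5 : quadraticChar K (t / c) ≤ 1 := by
      rcases quadraticChar_isQuadratic K (t / c) with h | h | h <;> rw [h] <;> norm_num
    have h6 : (Finset.univ.filter (fun x : K => c * x ^ 2 - t = 0)) =
        ({x : K | x ^ 2 = t / c} : Set K).toFinset := by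
      ext x; simp [sub_eq_zero, eq_div_iff hc, mul_comm c]
    rw [h6]; omega
  have hn := congrArg norm key
  rw [norm_mul, etaC_norm hc, one_mul] at hn
  have e := Finset.add_sum_erase Finset.univ (fun s => ∑ x, ψ (s * (c * x ^ 2 - t) + m * x)) (Finset.mem_univ (0:K))
  rw [hn, eq_sub_of_add_eq' e, hall]
  refine (norm_sub_le _ _).trans ?_
  have b1 : ‖∑ x ∈ Finset.univ.filter (fun x => c * x ^ 2 - t = 0), (Fintype.card K : ℂ) * ψ (m * x)‖ ≤ 2 * (Fintype.card K : ℝ) := by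
    refine (norm_sum_le _ _).trans ?_
    simp only [norm_mul, AddChar.norm_apply, mul_one, Finset.sum_const, nsmul_eq_mul, Complex.norm_natCast]
    gcongr
    exact_mod_cast hcard
  have b2 : ‖∑ x, ψ (0 * (c * x ^ 2 - t) + m * x)‖ ≤ (Fintype.card K : ℝ) := by
    refine (norm_sum_le _ _).trans ?_
    simp [AddChar.norm_apply]
  linarith

lemma orth {d : ℕ} {K : Type} [Field K] [Fintype K] [DecidableEq K]
    {ψ : AddChar K ℂ} (hψ : ψ.IsPrimitive) (w : Fin d → K) :
    ∑ m : Fin d → K, ψ (∑ j, m j * w j) = if w = 0 then (Fintype.card K : ℂ) ^ d else 0 := by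
  simp only [map_sum_prod]
  have h := Finset.prod_univ_sum (fun _ : Fin d => (Finset.univ : Finset K))
    (fun j x => ψ (x * w j))
  rw [Fintype.piFinset_univ] at h
  rw [← h]
  simp only [AddChar.sum_mulShift _ hψ]
  split_ifs with hw
  · simp [hw]
  · obtain ⟨j, hj⟩ := Function.ne_iff.1 hw
    exact Finset.prod_eq_zero (Finset.mem_univ j) (by simpa using hj)

noncomputable def khat {d : ℕ} {K : Type} [Field K] [Fintype K] [DecidableEq K]
    (ψ : AddChar K ℂ) (a : Fin d → K) (t : K) (m : Fin d → K) : ℂ :=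
  ∑ w : Fin d → K, if ∑ j, a j * w j ^ 2 = t then ψ (-∑ j, m j * w j) else 0

lemma khat_eq {d : ℕ} {K : Type} [Field K] [Fintype K] [DecidableEq K]
    {ψ : AddChar K ℂ} (hψ : ψ.IsPrimitive) (a : Fin d → K) (t : K) (m : Fin d → K) :
    (Fintype.card K : ℂ) * khat ψ a t m =
      ∑ s, ψ (-(s * t)) * ∏ j, ∑ x, ψ (s * a j * x ^ 2 + (-m j) * x) := by
  have h (s : K) := Finset.prod_univ_sum (fun _ : Fin d => (Finset.univ : Finset K))
    (fun j x => ψ (s * a j * x ^ 2 + (-m j) * x))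
  simp only [Fintype.piFinset_univ] at h
  simp only [h, ← map_sum_prod, Finset.mul_sum, khat]
  rw [Finset.sum_comm]
  refine Finset.sum_congr rfl fun w _ => ?_
  have : ∀ s, ψ (-(s * t)) * ψ (∑ j, (s * a j * w j ^ 2 + -m j * w j)) =
      ψ (s * (∑ j, a j * w j ^ 2 - t)) * ψ (-∑ j, m j * w j) := by
    intro s
    rw [← AddChar.map_add_eq_mul, ← AddChar.map_add_eq_mul, Finset.sum_add_distrib]
    congr 1
    rw [mul_sub, Finset.mul_sum]
    simp only [neg_mul, Finset.sum_neg_distrib, mul_assoc]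
    ring
  simp only [this]
  rw [← Finset.sum_mul, AddChar.sum_mulShift _ hψ]
  simp only [sub_eq_zero]
  split_ifs <;> simp

lemma khat_bound {k : ℕ} {K : Type} [Field K] [Fintype K] [DecidableEq K] (h2 : ringChar K ≠ 2)
    {ψ : AddChar K ℂ} (hψ : ψ.IsPrimitive) (a : Fin (2 * k + 1) → K) (ha : ∀ j, a j ≠ 0)
    (t : K) (m : Fin (2 * k + 1) → K) :
    ‖khat ψ a t m - if m = 0 then (Fintype.card K : ℂ) ^ (2 * k) else 0‖ ≤
      3 * (Fintype.card K : ℝ) ^ k := by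
  have hq : (0 : ℝ) < Fintype.card K := by exact_mod_cast Fintype.card_pos
  have h40 := four_ne h2
  have h := khat_eq hψ a t m
  rw [← Finset.add_sum_erase Finset.univ _ (Finset.mem_univ (0:K))] at h
  have h0 : ψ (-(0 * t)) * ∏ j, ∑ x, ψ (0 * a j * x ^ 2 + (-m j) * x) =
      (Fintype.card K : ℂ) * if m = 0 then (Fintype.card K : ℂ) ^ (2 * k) else 0 := by
    simp only [zero_mul, neg_zero, AddChar.map_zero_eq_one, one_mul, zero_add]
    have e0 : ∀ j, ∑ x, ψ (-m j * x) = ((if -m j = 0 then Fintype.card K else 0 : ℕ) : ℂ) := by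
      intro j
      rw [← AddChar.sum_mulShift _ hψ]
      exact Finset.sum_congr rfl fun x _ => by rw [mul_comm]
    simp only [e0]
    split_ifs with hm
    · simp [hm]; ring
    · obtain ⟨j, hj⟩ := Function.ne_iff.1 hm
      rw [mul_zero]
      exact Finset.prod_eq_zero (Finset.mem_univ j) (by simpa using hj)
  rw [h0] at h
  have h1 : ∑ s ∈ Finset.univ.erase (0 : K),
      ψ (-(s * t)) * ∏ j, ∑ x, ψ (s * a j * x ^ 2 + (-m j) * x) =
      (∏ j, etaC K (a j)) * gaussSum (etaC K) ψ ^ (2 * k) *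
      (gaussSum (etaC K) ψ * ∑ s ∈ Finset.univ.erase (0 : K),
      etaC K s * ψ (-(s * t) - (∑ j, m j ^ 2 / a j) / (4 * s))) := by
    rw [Finset.mul_sum, Finset.mul_sum]
    refine Finset.sum_congr rfl fun s hs => ?_
    have hs0 : s ≠ 0 := Finset.ne_of_mem_erase hs
    have e : ∀ j, ∑ x, ψ (s * a j * x ^ 2 + (-m j) * x) =
      etaC K s * etaC K (a j) * gaussSum (etaC K) ψ * ψ (-((m j ^ 2 / a j) / (4 * s))) := by
      intro j
      rw [quad2 h2 hψ (mul_ne_zero hs0 (ha j)), map_mul]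
      congr 2
      have := ha j
      field_simp
    simp only [e, Finset.prod_mul_distrib, ← map_sum_prod, Finset.prod_const, Finset.card_univ,
      Fintype.card_fin, Finset.sum_neg_distrib, ← Finset.sum_div]
    rw [sub_eq_add_neg, AddChar.map_add_eq_mul, pow_succ (etaC K s), pow_mul, etaC_sq hs0, one_pow]
    ring
  rw [h1] at h
  have h3 : (Fintype.card K : ℂ) * (khat ψ a t m - if m = 0 then (Fintype.card K : ℂ) ^ (2 * k) else 0) = (∏ j, etaC K (a j)) * gaussSum (etaC K) ψ ^ (2 * k) *
      (gaussSum (etaC K) ψ * ∑ s ∈ Finset.univ.erase (0 : K),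
      etaC K s * ψ (-(s * t) - (∑ j, m j ^ 2 / a j) / (4 * s))) := by
    rw [mul_sub, h]; ring
  have h4 := congrArg norm h3
  rw [norm_mul, norm_mul, norm_mul, norm_pow, pow_mul ‖gaussSum (etaC K) ψ‖, gauss_norm h2 hψ, norm_prod,
    Finset.prod_congr rfl (fun j _ => etaC_norm (ha j)), Finset.prod_const_one, one_mul,
    Complex.norm_natCast] at h4
  have h5 := salie h2 hψ t (∑ j, m j ^ 2 / a j)
  refine le_of_mul_le_mul_left ?_ hq
  rw [h4]
  calc _ ≤ (Fintype.card K : ℝ) ^ k * (3 * (Fintype.card K : ℝ)) := by gcongr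
    _ = _ := by ring

noncomputable def shat {d : ℕ} {K : Type} [Field K] (ψ : AddChar K ℂ)
    (E : Finset (Fin d → K)) (m : Fin d → K) : ℂ := ∑ x ∈ E, ψ (∑ j, m j * x j)

lemma planch {d : ℕ} {K : Type} [Field K] [Fintype K] [DecidableEq K]
    {ψ : AddChar K ℂ} (hψ : ψ.IsPrimitive) (E : Finset (Fin d → K)) :
    ∑ m, ‖shat ψ E m‖ ^ 2 = (Fintype.card K : ℝ) ^ d * E.card := by
  have h : ∑ m, shat ψ E m * (starRingEnd ℂ) (shat ψ E m) = (Fintype.card K : ℂ) ^ d * E.card := by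
    have e : ∀ m, shat ψ E m * (starRingEnd ℂ) (shat ψ E m) =
        ∑ x ∈ E, ∑ y ∈ E, ψ (∑ j, m j * (x - y) j) := by
      intro m
      simp only [shat, map_sum, Finset.sum_mul_sum, ← AddChar.map_neg_eq_conj,
        ← AddChar.map_add_eq_mul, Pi.sub_apply, sub_eq_add_neg]
      simp only [Finset.sum_add_distrib, Finset.sum_neg_distrib, mul_add, mul_neg]
    simp only [e]
    rw [Finset.sum_comm]
    have : ∀ x ∈ E, ∑ m : Fin d → K, ∑ y ∈ E, ψ (∑ j, m j * (x - y) j) =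
        (Fintype.card K : ℂ) ^ d := by
      intro x hx
      rw [Finset.sum_comm]
      simp only [orth hψ, sub_eq_zero]
      simp [hx]
    rw [Finset.sum_congr rfl this]
    simp [mul_comm]
  simp only [Complex.mul_conj'] at h
  exact_mod_cast h

lemma nu_eq {d : ℕ} {K : Type} [Field K] [Fintype K] [DecidableEq K]
    {ψ : AddChar K ℂ} (hψ : ψ.IsPrimitive) (a : Fin d → K) (t : K) (E F : Finset (Fin d → K)) :
    (Fintype.card K : ℂ) ^ d *
      ((E ×ˢ F).filter (fun p => ∑ j, a j * (p.1 j - p.2 j) ^ 2 = t)).card =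
    ∑ m, khat ψ a t m * (shat ψ E m * (starRingEnd ℂ) (shat ψ F m)) := by
  have e : ∀ m, khat ψ a t m * (shat ψ E m * (starRingEnd ℂ) (shat ψ F m)) =
      ∑ p ∈ E ×ˢ F, ∑ w : Fin d → K, if ∑ j, a j * w j ^ 2 = t then
        ψ (∑ j, m j * (p.1 - p.2 - w) j) else 0 := by
    intro m
    have e1 : shat ψ E m * (starRingEnd ℂ) (shat ψ F m) =
        ∑ p ∈ E ×ˢ F, ψ (∑ j, m j * p.1 j + -∑ j, m j * p.2 j) := by
      simp only [shat, map_sum, Finset.sum_mul_sum, ← AddChar.map_neg_eq_conj,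
        ← AddChar.map_add_eq_mul]
      rw [← Finset.sum_product']
    rw [e1, Finset.mul_sum, khat]
    refine Finset.sum_congr rfl fun p _ => ?_
    rw [Finset.sum_mul]
    refine Finset.sum_congr rfl fun w _ => ?_
    rw [ite_mul, zero_mul, ← AddChar.map_add_eq_mul]
    congr 2
    simp only [Pi.sub_apply, mul_sub, Finset.sum_sub_distrib]
    ring
  simp only [e]
  rw [Finset.sum_comm, Finset.card_filter]
  push_cast
  rw [Finset.mul_sum]
  refine Finset.sum_congr rfl fun p _ => ?_
  rw [Finset.sum_comm]
  have : ∀ w : Fin d → K, (∑ m : Fin d → K, if ∑ j, a j * w j ^ 2 = t then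
        ψ (∑ j, m j * (p.1 - p.2 - w) j) else 0) =
        if p.1 - p.2 = w then (if ∑ j, a j * w j ^ 2 = t then (Fintype.card K : ℂ) ^ d else 0) else 0 := by
    intro w
    by_cases hw : ∑ j, a j * w j ^ 2 = t
    · simp only [hw, if_true, orth hψ, sub_eq_zero]
    · simp [hw]
  simp only [this]
  rw [Finset.sum_ite_eq]
  simp

lemma nu_bound {k : ℕ} {K : Type} [Field K] [Fintype K] [DecidableEq K] (h2 : ringChar K ≠ 2)
    (a : Fin (2 * k + 1) → K) (ha : ∀ j, a j ≠ 0) (t : K) (E F : Finset (Fin (2 * k + 1) → K)) :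
    (((E ×ˢ F).filter (fun p => ∑ j, a j * (p.1 j - p.2 j) ^ 2 = t)).card : ℝ) ≤
      (E.card * F.card : ℝ) / Fintype.card K +
        3 * (Fintype.card K : ℝ) ^ k * √(E.card * F.card : ℝ) := by
  have hψ := AddChar.FiniteField.primitiveChar_to_Complex_isPrimitive K
  set ψ := AddChar.FiniteField.primitiveChar_to_Complex K
  have hq : (0 : ℝ) < Fintype.card K := by exact_mod_cast Fintype.card_pos
  have h := nu_eq hψ a t E F
  set δ : (Fin (2 * k + 1) → K) → ℂ := fun m => if m = 0 then (Fintype.card K : ℂ) ^ (2 * k) else 0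
    with hδ
  have e : ∑ m, khat ψ a t m * (shat ψ E m * (starRingEnd ℂ) (shat ψ F m)) =
      (Fintype.card K : ℂ) ^ (2 * k) * (E.card * F.card) +
      ∑ m, (khat ψ a t m - δ m) * (shat ψ E m * (starRingEnd ℂ) (shat ψ F m)) := by
    simp only [sub_mul, Finset.sum_sub_distrib]
    have : ∑ m, δ m * (shat ψ E m * (starRingEnd ℂ) (shat ψ F m)) =
        (Fintype.card K : ℂ) ^ (2 * k) * (E.card * F.card) := by
      simp [hδ, ite_mul, shat]
    rw [this]; ring
  rw [e] at h
  have h4 := congrArg norm h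
  rw [norm_mul, norm_pow, Complex.norm_natCast, Complex.norm_natCast] at h4
  have h5 : ‖∑ m, (khat ψ a t m - δ m) * (shat ψ E m * (starRingEnd ℂ) (shat ψ F m))‖ ≤
      3 * (Fintype.card K : ℝ) ^ k * ((Fintype.card K : ℝ) ^ (2 * k + 1) * √(E.card * F.card : ℝ)) := by
    refine (norm_sum_le _ _).trans ?_
    calc _ ≤ ∑ m, 3 * (Fintype.card K : ℝ) ^ k * (‖shat ψ E m‖ * ‖shat ψ F m‖) := by
          refine Finset.sum_le_sum fun m _ => ?_
          rw [norm_mul, norm_mul, RCLike.norm_conj]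
          gcongr
          exact khat_bound h2 hψ a ha t m
      _ = 3 * (Fintype.card K : ℝ) ^ k * ∑ m, (‖shat ψ E m‖ * ‖shat ψ F m‖) := by
          rw [Finset.mul_sum]
      _ ≤ _ := by
          gcongr
          refine (Real.sum_mul_le_sqrt_mul_sqrt _ _ _).trans (le_of_eq ?_)
          rw [planch hψ, planch hψ, ← Real.sqrt_mul (by positivity)]
          rw [show (Fintype.card K : ℝ) ^ (2 * k + 1) * E.card * ((Fintype.card K : ℝ) ^ (2 * k + 1) * F.card) = ((Fintype.card K : ℝ) ^ (2 * k + 1)) ^ 2 * (E.card * F.card) by ring]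
          rw [Real.sqrt_mul (by positivity), Real.sqrt_sq (by positivity)]
  have h6 := norm_add_le ((Fintype.card K : ℂ) ^ (2 * k) * (E.card * F.card))
    (∑ m, (khat ψ a t m - δ m) * (shat ψ E m * (starRingEnd ℂ) (shat ψ F m)))
  rw [← h4] at h6
  simp only [norm_mul, norm_pow, Complex.norm_natCast] at h6
  have hqd : (0 : ℝ) < (Fintype.card K : ℝ) ^ (2 * k + 1) := by positivity
  refine le_of_mul_le_mul_left ?_ hqd
  refine (h6.trans (add_le_add_right h5 _)).trans (le_of_eq ?_)
  field_simp
  ring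

/-- In odd dimensions `d ≥ 3`, for `P(x) = ∑ a_j x_j²` with `a_j ≠ 0`
over a finite field of odd characteristic, and for ALL sets `E, F ⊆ F_q^d`,
`|Δ_P(E,F)| ≥ c·min(q, q^{-(d-1)/2}√(|E||F|))`. -/
theorem stmt15 (d : ℕ) (hd : 3 ≤ d) (hodd : Odd d) :
    ∃ c : ℝ, 0 < c ∧
      ∀ (K : Type) [Field K] [Fintype K] [DecidableEq K],
        ringChar K ≠ 2 →
        ∀ a : Fin d → K, (∀ j, a j ≠ 0) →
        ∀ E F : Finset (Fin d → K),
          c * min (Fintype.card K : ℝ)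
              ((Fintype.card K : ℝ) ^ (-(((d : ℝ) - 1) / 2)) *
                Real.sqrt ((E.card : ℝ) * (F.card : ℝ))) ≤
            (((E ×ˢ F).image
              (fun p => ∑ j, a j * (p.1 j - p.2 j) ^ 2)).card : ℝ) := by
  obtain ⟨k, rfl⟩ := hodd
  refine ⟨1 / 4, by norm_num, ?_⟩
  intro K _ _ _ h2 a ha E F
  have hq : (0 : ℝ) < Fintype.card K := by exact_mod_cast Fintype.card_pos
  have hpow : (Fintype.card K : ℝ) ^ (-((((2 * k + 1 : ℕ) : ℝ) - 1) / 2)) =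
      ((Fintype.card K : ℝ) ^ k)⁻¹ := by
    rw [← Real.rpow_natCast, ← Real.rpow_neg hq.le]
    congr 1; push_cast; ring
  rw [hpow]
  set f : (Fin (2 * k + 1) → K) × (Fin (2 * k + 1) → K) → K :=
    fun p => ∑ j, a j * (p.1 j - p.2 j) ^ 2 with hf
  have hN := Finset.card_eq_sum_card_image f (E ×ˢ F)
  rw [Finset.card_product] at hN
  have hN' : (E.card * F.card : ℝ) ≤ ((E ×ˢ F).image f).card *
      ((E.card * F.card : ℝ) / Fintype.card K +
        3 * (Fintype.card K : ℝ) ^ k * √(E.card * F.card : ℝ)) := by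
    have hN2 : (E.card * F.card : ℝ) = ∑ b ∈ (E ×ˢ F).image f, (((E ×ˢ F).filter (fun p => f p = b)).card : ℝ) := by exact_mod_cast hN
    refine hN2.le.trans ?_
    refine (Finset.sum_le_card_nsmul _ _ _ fun t _ => nu_bound h2 a ha t E F).trans (le_of_eq ?_)
    rw [nsmul_eq_mul]
  set D : ℝ := (((E ×ˢ F).image f).card : ℝ) with hD
  have hD0 : 0 ≤ D := by positivity
  set N : ℝ := (E.card * F.card : ℝ) with hNd
  have hN0 : 0 ≤ N := by positivity
  set q : ℝ := (Fintype.card K : ℝ) with hqd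
  rcases hN0.eq_or_lt with h0 | hpos
  · rw [← h0]; simp [hq.le, hD0]
  set M := min q ((q ^ k)⁻¹ * √N) with hM
  have hs : 0 < √N := Real.sqrt_pos.2 hpos
  have hM0 : 0 < M := lt_min hq (by positivity)
  have a1 : N / q ≤ N / M := by gcongr; exact min_le_left _ _
  have a2 : q ^ k * √N ≤ N / M := by
    rw [le_div_iff₀ hM0]
    calc q ^ k * √N * M ≤ q ^ k * √N * ((q ^ k)⁻¹ * √N) := by gcongr; exact min_le_right _ _
      _ = √N * √N := by field_simp
      _ = N := Real.mul_self_sqrt hN0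
  have a3 : N ≤ D * (4 * (N / M)) := by
    refine hN'.trans ?_
    gcongr
    linarith
  have a4 : N * M ≤ N * (4 * D) := by
    calc N * M ≤ D * (4 * (N / M)) * M := by gcongr
      _ = _ := by field_simp
  have a5 := le_of_mul_le_mul_left a4 hpos
  linarith
end

section
/- Let d ≥ 2 and let P(x) = x_1^2 + … + x_d^2 ∈ F_q[x_1,…,x_d]. For every finite field F_q of odd characteristic and every set E ⊆ F_q^d with |E| ≥ 2 q^{(d+1)/2}, the distance set Δ_P(E,E) equals all of F_q, i.e., |Δ_P(E,E)| = q. -/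
open Polynomial

lemma st_pow_dvd_hasse {L : Type*} [Field L] (f r : L[X]) (n k : ℕ) :
    f ^ (n - k) ∣ hasseDeriv k (f ^ n * r) := by
  induction n generalizing k with
  | zero => simp
  | succ n ih =>
    rw [pow_succ', mul_assoc, hasseDeriv_mul]
    apply Finset.dvd_sum
    rintro ⟨i, j⟩ hij
    rw [Finset.HasAntidiagonal.mem_antidiagonal] at hij
    simp only at hij ⊢
    rcases Nat.eq_zero_or_pos i with hi | hi
    · subst hi
      obtain rfl : j = k := by omega
      rw [hasseDeriv_zero']
      by_cases h : j ≤ n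
      · rw [show n + 1 - j = (n - j) + 1 by omega, pow_succ']
        exact mul_dvd_mul_left _ (ih j)
      · rw [show n + 1 - j = 0 by omega]; simp
    · exact Dvd.dvd.mul_left ((pow_dvd_pow f (by omega)).trans (ih j)) _

lemma st_exists_w {L : Type*} [Field L] (f : L[X]) (hf : f ≠ 0) (n k i : ℕ) (hk : k ≤ n) :
    ∃ w : L[X], w.natDegree ≤ i + k * f.natDegree ∧
      hasseDeriv k (f ^ n * X ^ i) = f ^ (n - k) * w := by
  obtain ⟨w, hw⟩ := st_pow_dvd_hasse f (X ^ i) n k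
  refine ⟨w, ?_, hw⟩
  by_cases hw0 : w = 0
  · simp [hw0]
  have h1 : (f ^ (n - k) * w).natDegree ≤ n * f.natDegree + i - k := by
    rw [← hw]
    refine (natDegree_hasseDeriv_le _ _).trans ?_
    rw [natDegree_mul (pow_ne_zero _ hf) (pow_ne_zero _ X_ne_zero), natDegree_pow, natDegree_X_pow]
  rw [natDegree_mul (pow_ne_zero _ hf) hw0, natDegree_pow] at h1
  have : (n - k) * f.natDegree + k * f.natDegree = n * f.natDegree := by
    rw [← add_mul, Nat.sub_add_cancel hk]
  omega

lemma st_dvd_of_hasse {L : Type*} [Field L] (p : L[X]) (x : L) (l : ℕ)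
    (h : ∀ k < l, (hasseDeriv k p).eval x = 0) : (X - C x) ^ l ∣ p := by
  have h1 : X ^ l ∣ taylor x p := by
    rw [X_pow_dvd_iff]
    intro d hd
    rw [taylor_coeff, h d hd]
  obtain ⟨u, hu⟩ := h1
  refine ⟨taylor (-x) u, ?_⟩
  have := congrArg (taylor (-x)) hu
  rw [taylor_taylor, taylor_mul, taylor_pow] at this
  simpa [sub_eq_add_neg] using this

lemma st_sq {L : Type*} [Field L] (f : L[X]) (hf : Squarefree f) (hd : 0 < f.natDegree) (e : L)
    (he : e ≠ 0) (n : ℕ) : ∀ r s : L[X], r.natDegree ≤ n → r ^ 2 * f = C e * s ^ 2 →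
    r = 0 ∧ s = 0 := by
  have hf0 : f ≠ 0 := hf.ne_zero
  have key : ∀ r s : L[X], r ^ 2 * f = C e * s ^ 2 → f ∣ s := by
    intro r s h
    have : f ∣ s ^ 2 := by
      have h2 : f ∣ C e * s ^ 2 := ⟨r ^ 2, by rw [← h]; ring⟩
      exact (IsUnit.dvd_mul_left (isUnit_C.2 he.isUnit)).1 h2
    exact (hf.dvd_pow_iff_dvd two_ne_zero).1 this
  induction n using Nat.strong_induction_on with
  | _ n ih =>
  intro r s hr h
  obtain ⟨s', rfl⟩ := key r s h
  have h2 : r ^ 2 = C e * s' ^ 2 * f := by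
    apply mul_right_cancel₀ hf0
    rw [h]; ring
  have h3 : f ∣ r := by
    have : f ∣ r ^ 2 := ⟨C e * s' ^ 2, by rw [h2]; ring⟩
    exact (hf.dvd_pow_iff_dvd two_ne_zero).1 this
  obtain ⟨r', rfl⟩ := h3
  by_cases hr0 : r' = 0
  · subst hr0
    simp [he, hf0] at h2 ⊢
    exact h2
  have h4 : r' ^ 2 * f = C e * s' ^ 2 := by
    apply mul_right_cancel₀ hf0
    rw [← h2]; ring
  rw [natDegree_mul hf0 hr0] at hr
  have := ih r'.natDegree (by omega) r' s' le_rfl h4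
  exact absurd this.1 hr0

lemma st_nonvanish {L : Type*} [Field L] [Fintype L] (f : L[X]) (hf : Squarefree f)
    (hd : 0 < f.natDegree) (h0 : f.eval 0 ≠ 0) (hQ : Odd (Fintype.card L)) (J : ℕ) (r s : ℕ → L[X])
    (hr : ∀ j, 2 * (r j).natDegree + f.natDegree < Fintype.card L)
    (hs : ∀ j, 2 * (s j).natDegree + f.natDegree < Fintype.card L)
    (h : ∑ j ∈ Finset.range J, (r j + s j * f ^ ((Fintype.card L - 1) / 2)) *
      X ^ (j * Fintype.card L) = 0) : ∀ j < J, r j = 0 ∧ s j = 0 := by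
  set Q := Fintype.card L with hQdef
  intro j
  induction j using Nat.strong_induction_on with
  | _ j ih =>
  intro hj
  have h1 : X ^ (j * Q) * X ^ Q ∣ X ^ (j * Q) * (r j + s j * f ^ ((Q - 1) / 2)) := by
    have e : X ^ (j * Q) * (r j + s j * f ^ ((Q - 1) / 2)) = 
      - ∑ i ∈ (Finset.range J).erase j, (r i + s i * f ^ ((Q - 1) / 2)) * X ^ (i * Q) := by
      rw [← Finset.add_sum_erase _ _ (Finset.mem_range.2 hj)] at h
      linear_combination h
    rw [e, dvd_neg]
    apply Finset.dvd_sum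
    intro i hi
    rw [Finset.mem_erase, Finset.mem_range] at hi
    rcases lt_or_gt_of_ne hi.1 with hlt | hgt
    · simp [ih i hlt hi.2]
    · apply Dvd.dvd.mul_left
      rw [← pow_add]
      apply pow_dvd_pow
      nlinarith
  have h2 : X ^ Q ∣ r j + s j * f ^ ((Q - 1) / 2) :=
    (mul_dvd_mul_iff_left (pow_ne_zero _ X_ne_zero)).1 h1
  have hpow : f ^ Q = expand L Q f := (FiniteField.expand_card f).symm
  have h3 : X ^ Q ∣ f ^ Q - C (f.eval 0) := by
    rw [hpow]
    have : X ∣ f - C (f.eval 0) := by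
      rw [X_dvd_iff]; simp [coeff_zero_eq_eval_zero]
    obtain ⟨u, hu⟩ := this
    refine ⟨expand L Q u, ?_⟩
    have := congrArg (expand L Q) hu
    simpa using this
  have h4 : X ^ Q ∣ (r j) ^ 2 * f - C (f.eval 0) * (s j) ^ 2 := by
    have e : (r j) ^ 2 * f - C (f.eval 0) * (s j) ^ 2 =
        (r j + s j * f ^ ((Q - 1) / 2)) * ((r j - s j * f ^ ((Q - 1) / 2)) * f)
        + (f ^ Q - C (f.eval 0)) * (s j) ^ 2 := by
      obtain ⟨k, hk⟩ := hQ
      have : (Q - 1) / 2 = k := by omega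
      rw [this, hk]; ring
    rw [e]
    exact dvd_add (Dvd.dvd.mul_right h2 _) (Dvd.dvd.mul_right h3 _)
  have h5 : (r j) ^ 2 * f - C (f.eval 0) * (s j) ^ 2 = 0 := by
    apply eq_zero_of_dvd_of_natDegree_lt h4
    rw [natDegree_X_pow]
    refine lt_of_le_of_lt (natDegree_sub_le _ _) (max_lt ?_ ?_)
    · refine lt_of_le_of_lt natDegree_mul_le ?_
      have := hr j
      rw [natDegree_pow]; omega
    · refine lt_of_le_of_lt natDegree_mul_le ?_
      have := hs j
      rw [natDegree_pow, natDegree_C]; omega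
  exact st_sq f hf hd _ h0 _ (r j) (s j) le_rfl (sub_eq_zero.1 h5)

lemma st_main {L : Type*} [Field L] [Fintype L] (f : L[X]) (hf : Squarefree f)
    (hd : 0 < f.natDegree) (h0 : f.eval 0 ≠ 0) (hQ : Odd (Fintype.card L)) (R : ℕ)
    (hR : Fintype.card L = R ^ 2) (hRm : 4 * f.natDegree + 5 ≤ R) (a : L) (S : Finset L)
    (hS : ∀ x ∈ S, (f.eval x) ^ ((Fintype.card L - 1) / 2) = a) :
    2 * S.card ≤ Fintype.card L + R * (7 * f.natDegree + 5) := by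
  classical
  have hf0 : f ≠ 0 := hf.ne_zero
  set Q := Fintype.card L with hQdef
  set m := f.natDegree with hm
  have hRodd : Odd R := by
    rw [hR] at hQ
    exact (Nat.odd_pow_iff two_ne_zero).1 hQ
  obtain ⟨J, hJ⟩ : ∃ J, 2 * J = R + (4 * m + 5) := by
    obtain ⟨k, hk⟩ := hRodd
    exact ⟨k + 2 * m + 3, by omega⟩
  obtain ⟨D, hD⟩ : ∃ D, D = (Q - m) / 2 := ⟨_, rfl⟩
  obtain ⟨hh, hhh⟩ : ∃ h, h = (Q - 1) / 2 := ⟨_, rfl⟩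
  have hRQ : R ≤ Q := by rw [hR]; nlinarith
  have hQR : (4 * m + 5) * R ≤ Q := by rw [hR]; nlinarith
  have hmQ : 2 * m + 2 ≤ Q := by nlinarith
  have hD1 : 2 * D + m ≤ Q := by omega
  have hD2 : Q ≤ 2 * D + m + 1 := by omega
  have hD4 : Q ≤ 4 * D := by omega
  have hDpos : 0 < D := by omega
  have hJR : J ≤ R := by omega
  choose! w0 hw0 using fun k i => st_exists_w f hf0 R k i
  choose! w1 hw1 using fun k i => st_exists_w f hf0 (R + hh) k i
  let B := D + J + R * m
  -- the linear map
  let T : ((Fin J × Fin D → L) × (Fin J × Fin D → L)) →ₗ[L] (Fin R × Fin B → L) :=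
    { toFun := fun v kb => ∑ p : Fin J × Fin D,
        (v.1 p * (w0 kb.1 p.2 * X ^ (p.1 : ℕ)).coeff kb.2
          + v.2 p * (a * (w1 kb.1 p.2 * X ^ (p.1 : ℕ)).coeff kb.2))
      map_add' := by
        intro u v; funext kb
        simp only [Prod.fst_add, Prod.snd_add, Pi.add_apply, ← Finset.sum_add_distrib]
        refine Finset.sum_congr rfl fun p _ => by ring
      map_smul' := by
        intro c v; funext kb
        simp only [Prod.smul_fst, Prod.smul_snd, Pi.smul_apply, smul_eq_mul, Finset.mul_sum,
          RingHom.id_apply]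
        refine Finset.sum_congr rfl fun p _ => by ring }
  have hdim : Module.finrank L (Fin R × Fin B → L) <
      Module.finrank L ((Fin J × Fin D → L) × (Fin J × Fin D → L)) := by
    rw [Module.finrank_prod, Module.finrank_fintype_fun_eq_card,
      Module.finrank_fintype_fun_eq_card]
    simp only [Fintype.card_prod, Fintype.card_fin]
    have e1 : J * D + J * D = R * D + (4 * m + 5) * D := by
      rw [← add_mul, ← add_mul, ← hJ]; ring
    have e2 : R * B = R * D + R * J + R ^ 2 * m := by simp only [B]; ring
    rw [e1, e2, ← hR]
    have e3 : R * J ≤ Q := by rw [hR, sq]; exact Nat.mul_le_mul_left _ hJR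
    have e4 : Q * m ≤ (4 * D) * m := Nat.mul_le_mul_right _ hD4
    nlinarith
  obtain ⟨v, hvker, hv0⟩ : ∃ v, T v = 0 ∧ v ≠ 0 := by
    have := LinearMap.ker_ne_bot_of_finrank_lt (f := T) hdim
    obtain ⟨v, hv, hv0⟩ := Submodule.exists_mem_ne_zero_of_ne_bot this
    exact ⟨v, hv, hv0⟩
  -- polynomials
  have hpolyzero : ∀ k < R, ∑ p : Fin J × Fin D,
      (C (v.1 p) * (w0 k p.2 * X ^ (p.1 : ℕ)) + C (v.2 p) * (C a * (w1 k p.2 * X ^ (p.1 : ℕ)))) =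
        0 := by
    intro k hk
    ext b
    by_cases hb : b < B
    · have := congrFun hvker (⟨k, hk⟩, ⟨b, hb⟩)
      simp only [T, LinearMap.coe_mk, AddHom.coe_mk, Pi.zero_apply] at this
      rw [finsetSum_coeff, coeff_zero, ← this]
      refine Finset.sum_congr rfl fun p _ => ?_
      rw [coeff_add, coeff_C_mul, coeff_C_mul, coeff_C_mul]
    · rw [finsetSum_coeff, coeff_zero]
      refine Finset.sum_eq_zero fun p _ => ?_
      have hkm : k * m ≤ R * m := Nat.mul_le_mul_right _ hk.le
      have hp1 := p.1.2
      have hp2 := p.2.2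
      have hb' : D + J + R * m ≤ b := not_lt.1 hb
      have d0 := (hw0 k p.2 hk.le).1
      have d1 := (hw1 k p.2 (by omega)).1
      rw [← hm] at d0 d1
      rw [coeff_add, coeff_C_mul, coeff_C_mul, coeff_C_mul, coeff_eq_zero_of_natDegree_lt,
        coeff_eq_zero_of_natDegree_lt]
      · simp
      · refine lt_of_le_of_lt natDegree_mul_le ?_
        rw [natDegree_X_pow]; omega
      · refine lt_of_le_of_lt natDegree_mul_le ?_
        rw [natDegree_X_pow]; omega
  let A : Fin J → L[X] := fun j => ∑ i : Fin D,
    (C (v.1 (j, i)) * (f ^ R * X ^ (i : ℕ)) + C (v.2 (j, i)) * (f ^ (R + hh) * X ^ (i : ℕ)))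
  let r : L[X] := ∑ j : Fin J, A j * X ^ ((j : ℕ) * Q)
  -- vanishing
  have hvan : ∀ x ∈ S, (X - C x) ^ R ∣ r := by
    intro x hx
    have h1 : (X - C x) ^ R ∣ ∑ j : Fin J, A j * C (x ^ (j : ℕ)) := by
      apply st_dvd_of_hasse
      intro k hk
      have hz := congrArg (eval x) (hpolyzero k hk)
      have : eval x (hasseDeriv k (∑ j : Fin J, A j * C (x ^ (j : ℕ)))) =
        eval x f ^ (R - k) * eval x (∑ p : Fin J × Fin D,
      (C (v.1 p) * (w0 k p.2 * X ^ (p.1 : ℕ)) + C (v.2 p) * (C a * (w1 k p.2 * X ^ (p.1 : ℕ))))) := by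
        rw [Fintype.sum_prod_type]
        simp only [map_sum, eval_finsetSum, Finset.mul_sum]
        refine Finset.sum_congr rfl fun j _ => ?_
        simp only [A, Finset.sum_mul, map_sum, eval_finsetSum]
        refine Finset.sum_congr rfl fun i _ => ?_
        have e : (C (v.1 (j, i)) * (f ^ R * X ^ (i : ℕ)) +
            C (v.2 (j, i)) * (f ^ (R + hh) * X ^ (i : ℕ))) * C (x ^ (j : ℕ)) =
            (v.1 (j, i) * x ^ (j : ℕ)) • (f ^ R * X ^ (i : ℕ)) +
            (v.2 (j, i) * x ^ (j : ℕ)) • (f ^ (R + hh) * X ^ (i : ℕ)) := by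
          simp only [smul_eq_C_mul, C_mul]; ring
        rw [e, map_add, map_smul, map_smul, (hw0 k i hk.le).2, (hw1 k i (by omega)).2,
          show R + hh - k = (R - k) + hh by omega]
        have hSx := hS x hx
        rw [← hhh] at hSx
        simp only [eval_add, eval_smul, eval_mul, eval_pow, eval_C, eval_X, smul_eq_mul, pow_add,
          hSx]
        ring
      rw [this, hz]; simp
    have h2 : (X - C x) ^ R ∣ ∑ j : Fin J, A j * (X ^ ((j : ℕ) * Q) - C (x ^ (j : ℕ))) := by
      apply Finset.dvd_sum
      intro j _
      apply Dvd.dvd.mul_left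
      have e : X ^ ((j : ℕ) * Q) - C (x ^ (j : ℕ)) = (X ^ (j : ℕ) - C (x ^ (j : ℕ))) ^ Q := by
        rw [← FiniteField.expand_card]
        simp [← pow_mul, mul_comm]
        rw [hQdef]
      rw [e]
      refine dvd_trans (pow_dvd_pow _ hRQ) (pow_dvd_pow_of_dvd ?_ _)
      rw [C_pow]
      exact sub_dvd_pow_sub_pow _ _ _
    have e : r = ∑ j : Fin J, A j * C (x ^ (j : ℕ)) +
        ∑ j : Fin J, A j * (X ^ ((j : ℕ) * Q) - C (x ^ (j : ℕ))) := by
      rw [← Finset.sum_add_distrib]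
      refine Finset.sum_congr rfl fun j _ => by ring
    rw [e]
    exact dvd_add h1 h2
  have hr0 : r ≠ 0 := by
    intro hr
    apply hv0
    let r' : ℕ → L[X] := fun j => if hj : j < J then
      ∑ i : Fin D, C (v.1 (⟨j, hj⟩, i)) * X ^ (i : ℕ) else 0
    let s' : ℕ → L[X] := fun j => if hj : j < J then
      ∑ i : Fin D, C (v.2 (⟨j, hj⟩, i)) * X ^ (i : ℕ) else 0
    have hdeg : ∀ u : Fin D → L, 2 * (∑ i : Fin D, C (u i) * X ^ (i : ℕ)).natDegree + m < Q := by
      intro u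
      have : (∑ i : Fin D, C (u i) * X ^ (i : ℕ)).natDegree ≤ D - 1 := by
        apply natDegree_sum_le_of_forall_le
        intro i _
        refine (natDegree_C_mul_X_pow_le _ _).trans ?_
        have := i.2; omega
      omega
    have hz : ∀ u : Fin D → L, ∑ i : Fin D, C (u i) * X ^ (i : ℕ) = 0 → ∀ i, u i = 0 := by
      intro u hu i
      have := congrArg (fun p => coeff p (i : ℕ)) hu
      simp only [finsetSum_coeff, coeff_C_mul, coeff_X_pow, coeff_zero] at this
      rw [Finset.sum_eq_single i] at this
      · simpa using this
      · intro b _ hb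
        rw [if_neg]; · simp
        intro h; exact hb (Fin.ext h.symm)
      · simp
    have hnv := st_nonvanish f hf hd h0 hQ J r' s' (by
        intro j
        by_cases hj : j < J
        · simp only [r', dif_pos hj]; exact hdeg _
        · simp only [r', dif_neg hj, natDegree_zero]; omega) (by
        intro j
        by_cases hj : j < J
        · simp only [s', dif_pos hj]; exact hdeg _
        · simp only [s', dif_neg hj, natDegree_zero]; omega) (by
        rw [← hQdef, ← hhh]
        apply mul_left_cancel₀ (pow_ne_zero R hf0)
        rw [mul_zero, ← hr, Finset.sum_range, Finset.mul_sum]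
        refine Finset.sum_congr rfl fun j _ => ?_
        simp only [r', s', dif_pos j.2, A, Fin.eta]
        rw [← mul_assoc, Finset.sum_mul, ← Finset.sum_add_distrib, Finset.mul_sum]
        congr 1
        refine Finset.sum_congr rfl fun i _ => by rw [pow_add]; ring)
    have h1 : ∀ j i, v.1 (j, i) = 0 := by
      intro j
      have := (hnv j j.2).1
      simp only [r', dif_pos j.2, Fin.eta] at this
      exact hz _ this
    have h2 : ∀ j i, v.2 (j, i) = 0 := by
      intro j
      have := (hnv j j.2).2
      simp only [s', dif_pos j.2, Fin.eta] at this
      exact hz _ this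
    ext p
    · exact h1 p.1 p.2
    · exact h2 p.1 p.2
  have hdegr : r.natDegree ≤ (R + hh) * m + (D - 1) + (J - 1) * Q := by
    apply natDegree_sum_le_of_forall_le
    intro j _
    refine natDegree_mul_le.trans ?_
    rw [natDegree_X_pow]
    apply add_le_add
    · apply natDegree_sum_le_of_forall_le
      intro i _
      have hi := i.2
      refine natDegree_add_le_of_degree_le ?_ ?_
      · refine (natDegree_C_mul_le _ _).trans (natDegree_mul_le.trans ?_)
        rw [natDegree_pow, natDegree_X_pow, ← hm]
        have : R * m ≤ (R + hh) * m := Nat.mul_le_mul_right _ (by omega)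
        omega
      · refine (natDegree_C_mul_le _ _).trans (natDegree_mul_le.trans ?_)
        rw [natDegree_pow, natDegree_X_pow, ← hm]
        omega
    · have := j.2
      exact Nat.mul_le_mul_right _ (by omega)
  have hprod : ∏ x ∈ S, (X - C x) ^ R ∣ r := by
    apply Finset.prod_dvd_of_coprime
    · intro x _ y _ hxy
      exact (isCoprime_X_sub_C_of_isUnit_sub (sub_ne_zero.2 hxy).isUnit).pow
    · exact hvan
  have hcard := natDegree_le_of_dvd hprod hr0
  rw [natDegree_prod _ _ (fun x _ => pow_ne_zero _ (X_sub_C_ne_zero x))] at hcard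
  simp only [natDegree_pow, natDegree_X_sub_C, mul_one, Finset.sum_const, smul_eq_mul] at hcard
  have hfin := hcard.trans hdegr
  obtain ⟨J', rfl⟩ : ∃ J', J = J' + 1 := ⟨J - 1, by omega⟩
  obtain ⟨D', rfl⟩ : ∃ D', D = D' + 1 := ⟨D - 1, by omega⟩
  simp only [Nat.add_sub_cancel] at hfin
  have hh2 : 2 * hh ≤ Q := by omega
  have hRpos : 0 < R := by omega
  have e1 : R * (2 * S.card) ≤ R * (2 * m + (m + R + (4 * m + 5)) * R) := by
    have e2 : 2 * hh * m ≤ Q * m := Nat.mul_le_mul_right _ hh2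
    have e3 : 2 * (J' * Q) + 2 * Q = (R + (4 * m + 5)) * Q := by rw [← hJ]; ring
    have e4 : R * (2 * m + (m + R + (4 * m + 5)) * R) = 2 * R * m + m * Q + (R + (4 * m + 5)) * Q := by
      rw [hR]; ring
    rw [e4, ← e3]
    nlinarith
  have e5 := Nat.le_of_mul_le_mul_left e1 hRpos
  rw [hR]
  nlinarith

lemma kl_charsum {L : Type*} [Field L] [Fintype L] [DecidableEq L] (hL : ringChar L ≠ 2)
    (R : ℕ) (hR : Fintype.card L = R ^ 2) (q : ℕ) (hq : 2 ≤ q) (hq0 : (q : L) = 0)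
    (hRq : 8 * q + 5 ≤ R) (c : L) (hc : c ≠ 0) :
    |∑ y : L, quadraticChar L ((y ^ q - y) ^ 2 - 4 * c)| ≤ ((R * (14 * q + 5) + 2 * q : ℕ) : ℤ) := by
  have h2 : (2 : L) ≠ 0 := Ring.two_ne_zero hL
  have h4 : (4 : L) ≠ 0 := by
    have : (4 : L) = 2 * 2 := by norm_num
    rw [this]; exact mul_ne_zero h2 h2
  set u : L[X] := X ^ q - X with hu
  set f : L[X] := u ^ 2 - C (4 * c) with hfdef
  have hev : ∀ y, f.eval y = (y ^ q - y) ^ 2 - 4 * c := by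
    intro y; simp [hfdef, hu]
  have hud : u.natDegree = q := by
    rw [hu]; compute_degree!
    · rw [if_neg (by omega)]; simp
    · omega
  have hdeg : f.natDegree = 2 * q := by
    rw [hfdef, natDegree_sub_C, natDegree_pow, hud]
  have hder : derivative f = - C 2 * u := by
    rw [hfdef, hu]
    simp [derivative_pow, hq0]
  have hsep : f.Separable := by
    refine ⟨C (-(4 * c)⁻¹), C ((8 * c)⁻¹ * -1) * u, ?_⟩
    rw [hder, hfdef]
    have e8 : (8 * c)⁻¹ * -1 * -2 = (4 * c)⁻¹ := by
      have : (8 : L) = 2 * 4 := by norm_num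
      rw [this]; field_simp
    calc C (-(4 * c)⁻¹) * (u ^ 2 - C (4 * c)) + C ((8 * c)⁻¹ * -1) * u * (-C 2 * u)
        = C (((8 * c)⁻¹ * -1 * -2) - (4 * c)⁻¹) * u ^ 2 + C ((4 * c)⁻¹ * (4 * c)) := by
          simp only [C_mul, C_sub, C_neg]; ring
      _ = 1 := by
          rw [e8, sub_self, inv_mul_cancel₀ (mul_ne_zero h4 hc)]; simp
  have hodd : Odd (Fintype.card L) := by
    rw [Nat.odd_iff]; exact FiniteField.odd_card_of_char_ne_two hL
  have hcard2 : (Fintype.card L - 1) / 2 = Fintype.card L / 2 := by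
    obtain ⟨k, hk⟩ := hodd; omega
  have h0 : f.eval 0 ≠ 0 := by
    rw [hev, zero_pow (by omega)]
    simpa using ⟨h4, hc⟩
  have hf0 : f ≠ 0 := hsep.ne_zero
  have main : ∀ a : ℤ, 2 * (Finset.univ.filter fun y : L => quadraticChar L (f.eval y) = a).card ≤
      Fintype.card L + R * (7 * f.natDegree + 5) := by
    intro a
    refine st_main f hsep.squarefree (by omega) h0 hodd R hR (by omega) (a : L) _ ?_
    intro x hx
    rw [Finset.mem_filter] at hx
    rw [hcard2, ← quadraticChar_eq_pow_of_char_ne_two' hL, hx.2]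
  have hzero : (Finset.univ.filter fun y : L => quadraticChar L (f.eval y) = 0).card ≤ 2 * q := by
    rw [← hdeg]
    refine le_trans (Finset.card_le_card (t := f.roots.toFinset) ?_)
      ((Multiset.toFinset_card_le _).trans (card_roots' f))
    intro x hx
    rw [Finset.mem_filter, quadraticChar_eq_zero_iff] at hx
    simp [hf0, hx.2]
  have hp := main 1
  have hm := main (-1)
  rw [hdeg] at hp hm
  simp only [← hev]
  have hsplit : ∀ a : ℤ, a = 0 ∨ a = 1 ∨ a = -1 →
      a = (if a = 1 then 1 else 0) - (if a = -1 then 1 else 0) ∧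
      (1 : ℤ) = (if a = 1 then 1 else 0) + (if a = -1 then 1 else 0) + (if a = 0 then 1 else 0) := by
    rintro a (rfl | rfl | rfl) <;> simp
  have hval : ∀ y : L, quadraticChar L (f.eval y) = 0 ∨ quadraticChar L (f.eval y) = 1 ∨
    quadraticChar L (f.eval y) = -1 := fun y => quadraticChar_isQuadratic L _
  have e1 : ∑ y : L, quadraticChar L (f.eval y) =
    ((Finset.univ.filter fun y : L => quadraticChar L (f.eval y) = 1).card : ℤ) -
    ((Finset.univ.filter fun y : L => quadraticChar L (f.eval y) = -1).card : ℤ) := by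
    rw [Finset.sum_congr rfl (fun y _ => (hsplit _ (hval y)).1), Finset.sum_sub_distrib]
    simp
  have e2 : (Fintype.card L : ℤ) =
    ((Finset.univ.filter fun y : L => quadraticChar L (f.eval y) = 1).card : ℤ) +
    ((Finset.univ.filter fun y : L => quadraticChar L (f.eval y) = -1).card : ℤ) +
    ((Finset.univ.filter fun y : L => quadraticChar L (f.eval y) = 0).card : ℤ) := by
    have : (Fintype.card L : ℤ) = ∑ y : L, (1 : ℤ) := by simp
    rw [this, Finset.sum_congr rfl (fun y _ => (hsplit _ (hval y)).2), Finset.sum_add_distrib,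
      Finset.sum_add_distrib]
    simp
  rw [e1]
  have e3 : 7 * (2 * q) + 5 = 14 * q + 5 := by ring
  rw [e3] at hp hm
  zify at hp hm hzero
  push_cast
  rw [abs_le]
  constructor <;> linarith

lemma kl_fiber {K L : Type*} [Field K] [Fintype K] [DecidableEq K] [Field L] [Fintype L]
    [DecidableEq L] [Algebra K L] (ψ : AddChar K ℂ) (hψ : ψ.IsPrimitive) (u : L) :
    (Finset.univ.filter fun y : L => y ^ Fintype.card K - y = u).card =
      if Algebra.trace K L u = 0 then Fintype.card K else 0 := by
  classical
  set q := Fintype.card K with hqdef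
  have hq : 1 < q := Fintype.one_lt_card
  have hle : ∀ u : L, (Finset.univ.filter fun y : L => y ^ q - y = u).card ≤
      if Algebra.trace K L u = 0 then q else 0 := by
    intro u
    split_ifs with h
    · have hd : (X ^ q - X - C u : L[X]).natDegree = q := by
        compute_degree!
        · rw [if_neg (by omega), if_neg (by omega)]; simp
        · omega
      have hne : (X ^ q - X - C u : L[X]) ≠ 0 := by
        intro h0; rw [h0] at hd; simp at hd; omega
      refine le_trans (Finset.card_le_card (t := (X ^ q - X - C u : L[X]).roots.toFinset) ?_)
        ((Multiset.toFinset_card_le _).trans ((card_roots' _).trans hd.le))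
      intro x hx
      rw [Finset.mem_filter] at hx
      simp only [Multiset.mem_toFinset, mem_roots hne, IsRoot, eval_sub, eval_pow, eval_X, eval_C]
      rw [hx.2]; simp
    · rw [Nat.le_zero, Finset.card_eq_zero, Finset.filter_eq_empty_iff]
      intro y _ hy
      apply h
      rw [← hy, map_sub, sub_eq_zero]
      have := Algebra.trace_eq_of_algEquiv (FiniteField.frobeniusAlgEquivOfAlgebraic K L) y
      rwa [FiniteField.coe_frobeniusAlgEquivOfAlgebraic] at this
  have hsum1 : ∑ u : L, (Finset.univ.filter fun y : L => y ^ q - y = u).card = Fintype.card L := by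
    rw [← Finset.card_eq_sum_card_fiberwise (f := fun y : L => y ^ q - y)]
    · simp
    · intro x _; simp
  have hsum2 : ∑ u : L, (if Algebra.trace K L u = 0 then q else 0) = Fintype.card L := by
    have : ((∑ u : L, (if Algebra.trace K L u = 0 then q else 0) : ℕ) : ℂ) = Fintype.card L := by
      push_cast
      have e : ∀ u : L, ((if Algebra.trace K L u = 0 then (q : ℂ) else 0)) =
          ∑ s : K, ψ (s * Algebra.trace K L u) := by
        intro u
        rw [AddChar.sum_mulShift _ hψ]
        split_ifs <;> simp [hqdef]
      rw [Finset.sum_congr rfl (fun u _ => e u), Finset.sum_comm]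
      rw [Finset.sum_eq_single 0]
      · simp
      · intro s _ hs
        let Ψ : AddChar L ℂ := (ψ.mulShift s).compAddMonoidHom (Algebra.trace K L).toAddMonoidHom
        have hΨ : Ψ ≠ 1 := by
          intro h1
          have h2 := hψ hs
          apply h2
          rw [AddChar.eq_one_iff]
          intro x
          obtain ⟨y, hy⟩ := Algebra.trace_surjective K L x
          have := DFunLike.congr_fun h1 y
          rw [← hy]
          simpa [Ψ] using this
        have := AddChar.sum_eq_zero_of_ne_one hΨ
        simpa [Ψ] using this
      · simp
    exact_mod_cast this
  have := (Finset.sum_eq_sum_iff_of_le (fun u _ => hle u)).1 (hsum1.trans hsum2.symm)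
  exact this u (Finset.mem_univ _)

lemma kl_count {K L : Type*} [Field K] [Fintype K] [DecidableEq K] [Field L] [Fintype L]
    [DecidableEq L] [Algebra K L] (hL : ringChar L ≠ 2) (ψ : AddChar K ℂ) (hψ : ψ.IsPrimitive)
    (c : L) (hc : c ≠ 0) :
    ∑ s : K, ∑ x : L, (if x = 0 then 0 else ψ (s * Algebra.trace K L (x + c * x⁻¹))) =
      Fintype.card L + 
        ((∑ y : L, quadraticChar L ((y ^ Fintype.card K - y) ^ 2 - 4 * c) : ℤ) : ℂ) := by
  classical
  have h2 : (2 : L) ≠ 0 := Ring.two_ne_zero hL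
  rw [Finset.sum_comm]
  have e1 : ∀ x : L, ∑ s : K, (if x = 0 then 0 else ψ (s * Algebra.trace K L (x + c * x⁻¹))) =
      ((∑ y : L, if x ≠ 0 ∧ y ^ Fintype.card K - y = x + c * x⁻¹ then 1 else 0 : ℕ) : ℂ) := by
    intro x
    by_cases hx : x = 0
    · simp [hx]
    · simp only [hx, if_false, ne_eq, not_false_eq_true, true_and]
      rw [AddChar.sum_mulShift _ hψ, Finset.sum_boole, Nat.cast_id, kl_fiber ψ hψ]
  rw [Finset.sum_congr rfl (fun x _ => e1 x), ← Nat.cast_sum, Finset.sum_comm]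
  have e2 : ∀ y : L, ((∑ x : L, if x ≠ 0 ∧ y ^ Fintype.card K - y = x + c * x⁻¹ then 1 else 0 : ℕ) : ℤ)
      = 1 + quadraticChar L ((y ^ Fintype.card K - y) ^ 2 - 4 * c) := by
    intro y
    set u := y ^ Fintype.card K - y
    rw [add_comm (1 : ℤ), ← quadraticChar_card_sqrts hL, Finset.sum_boole, Nat.cast_id]
    congr 1
    refine Finset.card_bij' (fun x _ => 2 * x - u) (fun z _ => (z + u) / 2) ?_ ?_ ?_ ?_
    · intro x hx
      rw [Finset.mem_filter] at hx
      obtain ⟨-, hx0, hx⟩ := hx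
      simp only [Set.mem_toFinset, Set.mem_ofPred_eq]
      rw [hx]; field_simp; ring
    · intro z hz
      simp only [Set.mem_toFinset, Set.mem_ofPred_eq] at hz
      have hz' : (z + u) * (u - z) = 4 * c := by linear_combination -hz
      have h4 : (4 : L) ≠ 0 := by
        have : (4 : L) = 2 * 2 := by norm_num
        rw [this]; exact mul_ne_zero h2 h2
      have hne : z + u ≠ 0 := by
        intro h0; rw [h0, zero_mul] at hz'
        exact mul_ne_zero h4 hc hz'.symm
      rw [Finset.mem_filter]
      refine ⟨Finset.mem_univ _, div_ne_zero hne h2, ?_⟩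
      field_simp
      linear_combination hz'
    · intro x _; field_simp; ring
    · intro z _; field_simp; ring
  have e3 : ((∑ y : L, ∑ x : L, if x ≠ 0 ∧ y ^ Fintype.card K - y = x + c * x⁻¹ then 1 else 0 : ℕ) : ℤ) =
    Fintype.card L + ∑ y : L, quadraticChar L ((y ^ Fintype.card K - y) ^ 2 - 4 * c) := by
    rw [Nat.cast_sum, Finset.sum_congr rfl (fun y _ => e2 y), Finset.sum_add_distrib]
    simp
  have := congrArg (fun z : ℤ => (z : ℂ)) e3
  simp only [Int.cast_natCast, Int.cast_add] at this
  exact this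

noncomputable def klLam {K : Type*} [Field K] [DecidableEq K] (ψ : AddChar K ℂ) (c : K) (h : K[X]) : ℂ :=
  if h.coeff 0 = 0 then 0 else ψ (-h.nextCoeff - c * (h.coeff 1 / h.coeff 0))

lemma klLam_mul {K : Type*} [Field K] [DecidableEq K] (ψ : AddChar K ℂ) (c : K) (g h : K[X])
    (hg : g.Monic) (hh : h.Monic) : klLam ψ c (g * h) = klLam ψ c g * klLam ψ c h := by
  unfold klLam
  rw [mul_coeff_zero, hg.nextCoeff_mul hh, mul_coeff_one]
  by_cases h1 : g.coeff 0 = 0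
  · simp [h1]
  by_cases h2 : h.coeff 0 = 0
  · simp [h2]
  rw [if_neg (mul_ne_zero h1 h2), if_neg h1, if_neg h2, ← AddChar.map_add_eq_mul]
  congr 1
  field_simp
  ring

lemma klLam_one {K : Type*} [Field K] [DecidableEq K] (ψ : AddChar K ℂ) (c : K) :
    klLam ψ c 1 = 1 := by
  have : (1 : K[X]).nextCoeff = 0 := by rw [← C_1, nextCoeff_C_eq_zero]
  simp [klLam, this, coeff_one]

lemma klLam_pow {K : Type*} [Field K] [DecidableEq K] (ψ : AddChar K ℂ) (c : K) (g : K[X])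
    (hg : g.Monic) (k : ℕ) : klLam ψ c (g ^ k) = klLam ψ c g ^ k := by
  induction k with
  | zero => simp [klLam_one]
  | succ k ih => rw [pow_succ, pow_succ, klLam_mul _ _ _ _ (hg.pow k) hg, ih]

noncomputable def klP {K : Type*} [Field K] (n : ℕ) (v : Fin n → K) : K[X] :=
  X ^ n + ∑ i : Fin n, C (v i) * X ^ (i : ℕ)

lemma klP_degree_lt {K : Type*} [Field K] (n : ℕ) (v : Fin n → K) :
    (∑ i : Fin n, C (v i) * X ^ (i : ℕ) : K[X]).degree < (n : WithBot ℕ) := by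
  refine lt_of_le_of_lt (degree_sum_le _ _) ?_
  rw [Finset.sup_lt_iff (by exact_mod_cast WithBot.bot_lt_coe n)]
  intro i _
  refine lt_of_le_of_lt (degree_C_mul_X_pow_le _ _) ?_
  exact_mod_cast i.2

lemma klP_monic {K : Type*} [Field K] (n : ℕ) (v : Fin n → K) : (klP n v).Monic :=
  monic_X_pow_add (klP_degree_lt n v)

lemma klP_natDegree {K : Type*} [Field K] (n : ℕ) (v : Fin n → K) : (klP n v).natDegree = n := by
  apply natDegree_eq_of_degree_eq_some
  unfold klP
  rw [degree_add_eq_left_of_degree_lt] <;> rw [degree_X_pow]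
  exact klP_degree_lt n v

lemma klP_coeff {K : Type*} [Field K] (n : ℕ) (v : Fin n → K) (i : Fin n) :
    (klP n v).coeff i = v i := by
  unfold klP
  rw [coeff_add, coeff_X_pow, if_neg i.2.ne, zero_add, finsetSum_coeff, Finset.sum_eq_single i]
  · simp
  · intro b _ hb
    rw [coeff_C_mul, coeff_X_pow, if_neg, mul_zero]
    intro h; exact hb (Fin.ext h.symm)
  · simp

noncomputable def klM (K : Type*) [Field K] [Fintype K] (n : ℕ) : Finset K[X] :=
  Finset.univ.map ⟨klP (K := K) n, fun v w h => by
    funext i; rw [← klP_coeff n v i, ← klP_coeff n w i, h]⟩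

lemma mem_klM {K : Type*} [Field K] [Fintype K] (n : ℕ) (h : K[X]) :
    h ∈ klM K n ↔ h.Monic ∧ h.natDegree = n := by
  unfold klM
  rw [Finset.mem_map]
  constructor
  · rintro ⟨v, -, rfl⟩
    exact ⟨klP_monic n v, klP_natDegree n v⟩
  · rintro ⟨hm, hn⟩
    refine ⟨fun i => h.coeff i, Finset.mem_univ _, ?_⟩
    change klP n _ = h
    ext k
    rcases lt_trichotomy k n with hk | hk | hk
    · exact klP_coeff n _ ⟨k, hk⟩
    · subst hk
      have h1 := klP_monic k (fun i : Fin k => h.coeff i)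
      rw [Monic, leadingCoeff, klP_natDegree] at h1
      rw [h1, ← hn]; exact hm.symm
    · rw [coeff_eq_zero_of_natDegree_lt, coeff_eq_zero_of_natDegree_lt]
      · omega
      · rw [klP_natDegree]; omega

noncomputable def klA {K : Type*} [Field K] [Fintype K] [DecidableEq K] (ψ : AddChar K ℂ) (c : K)
    (n : ℕ) : ℂ := ∑ h ∈ klM K n, klLam ψ c h

lemma klA_eq {K : Type*} [Field K] [Fintype K] [DecidableEq K] (ψ : AddChar K ℂ) (c : K)
    (n : ℕ) : klA ψ c n = ∑ v : Fin n → K, klLam ψ c (klP n v) := by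
  unfold klA klM
  rw [Finset.sum_map]; rfl

lemma klA_zero {K : Type*} [Field K] [Fintype K] [DecidableEq K] (ψ : AddChar K ℂ) (c : K) :
    klA ψ c 0 = 1 := by
  rw [klA_eq]
  simp [klP, klLam_one]

lemma klLam_klP {K : Type*} [Field K] [DecidableEq K] (ψ : AddChar K ℂ) (c : K) (n : ℕ)
    (v : Fin (n + 2) → K) : klLam ψ c (klP (n + 2) v) =
      if v 0 = 0 then 0 else ψ (- v (Fin.last _) - c * (v 1 / v 0)) := by
  have h0 := klP_coeff (n + 2) v 0
  have h1 := klP_coeff (n + 2) v 1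
  have hl := klP_coeff (n + 2) v (Fin.last _)
  have hn : (klP (n + 2) v).nextCoeff = v (Fin.last _) := by
    rw [nextCoeff_of_natDegree_pos (by rw [klP_natDegree]; omega), klP_natDegree, ← hl]; rfl
  simp only [Fin.val_zero, Fin.val_one] at h0 h1
  rw [klLam, h0, h1, hn]

lemma klA_one {K : Type*} [Field K] [Fintype K] [DecidableEq K] (ψ : AddChar K ℂ) (c : K) :
    klA ψ c 1 = ∑ x : K, if x = 0 then 0 else ψ (x + c * x⁻¹) := by
  rw [klA_eq, ← (Equiv.funUnique (Fin 1) K).symm.sum_comp, ← Equiv.sum_comp (Equiv.neg K)]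
  refine Finset.sum_congr rfl fun x _ => ?_
  have h0 := klP_coeff 1 ((Equiv.funUnique (Fin 1) K).symm (Equiv.neg K x)) 0
  have h1 := klP_monic 1 ((Equiv.funUnique (Fin 1) K).symm (Equiv.neg K x))
  have hd := klP_natDegree 1 ((Equiv.funUnique (Fin 1) K).symm (Equiv.neg K x))
  set p := klP 1 ((Equiv.funUnique (Fin 1) K).symm (Equiv.neg K x))
  rw [Monic, leadingCoeff, hd] at h1
  simp only [Fin.val_zero] at h0
  have hn : p.nextCoeff = p.coeff 0 := by
    rw [nextCoeff_of_natDegree_pos (by omega), hd]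
  have h0' : p.coeff 0 = - x := by rw [h0]; simp
  rw [klLam, hn, h1, h0']
  simp only [neg_eq_zero, neg_neg]
  split_ifs
  · rfl
  · congr 1; rw [one_div, inv_neg]; ring

lemma klA_two {K : Type*} [Field K] [Fintype K] [DecidableEq K] (ψ : AddChar K ℂ)
    (hψ : ψ.IsPrimitive) (c : K) (hc : c ≠ 0) :
    klA ψ c 2 = Fintype.card K := by
  rw [klA_eq, ← (finTwoArrowEquiv K).symm.sum_comp, Fintype.sum_prod_type]
  rw [Finset.sum_eq_single (-c)]
  · have : ∀ y : K, klLam ψ c (klP 2 ((finTwoArrowEquiv K).symm (-c, y))) = 1 := by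
      intro y
      rw [klLam_klP ψ c 0]
      simp [hc]
      rw [show -y - c * (y / -c) = 0 by field_simp; ring]
      simp
    rw [Finset.sum_congr rfl fun y _ => this y]
    simp
  · intro x _ hx
    have : ∀ y : K, klLam ψ c (klP 2 ((finTwoArrowEquiv K).symm (x, y))) =
        if x = 0 then 0 else ψ (y * (-1 - c / x)) := by
      intro y
      rw [klLam_klP ψ c 0]
      simp
      split_ifs
      · rfl
      · congr 1; ring
    simp only [this]
    split_ifs with h0
    · simp
    · rw [AddChar.sum_mulShift _ hψ, if_neg]
      · simp
      intro h
      apply hx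
      field_simp at h
      linear_combination -h
  · simp

lemma klA_ge {K : Type*} [Field K] [Fintype K] [DecidableEq K] (ψ : AddChar K ℂ)
    (hψ : ψ ≠ 1) (c : K) (n : ℕ) : klA ψ c (n + 3) = 0 := by
  obtain ⟨t, ht⟩ := (AddChar.ne_one_iff).1 hψ
  have key : klA ψ c (n + 3) = ψ t * klA ψ c (n + 3) := by
    rw [klA_eq]
    conv_lhs => rw [← Equiv.sum_comp (Equiv.addRight (Pi.single (Fin.last _) (-t) : Fin (n + 3) → K))]
    rw [Finset.mul_sum]
    refine Finset.sum_congr rfl fun v _ => ?_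
    rw [klLam_klP ψ c (n + 1), klLam_klP ψ c (n + 1)]
    have e0 : (Pi.single (Fin.last _) (-t) : Fin (n + 3) → K) 0 = 0 :=
      Pi.single_eq_of_ne (by simp [Fin.ext_iff]) _
    have e1 : (Pi.single (Fin.last _) (-t) : Fin (n + 3) → K) 1 = 0 :=
      Pi.single_eq_of_ne (by simp [Fin.ext_iff]) _
    simp only [Equiv.coe_addRight, Pi.add_apply, e0, e1, add_zero, Pi.single_eq_same]
    split_ifs
    · simp
    · rw [← AddChar.map_add_eq_mul]; congr 1; ring
  by_contra h
  apply ht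
  have : (ψ t - 1) * klA ψ c (n + 3) = 0 := by linear_combination -key
  rcases mul_eq_zero.1 this with h1 | h1
  · exact sub_eq_zero.1 h1
  · exact absurd h1 h

open UniqueFactorizationMonoid Classical in
lemma kl_natDegree_eq {K : Type*} [Field K] (n : ℕ) (h : K[X]) (hm : h.Monic)
    (hn : h.natDegree = n) (I : Finset K[X])
    (hI : ∀ P, P ∈ I ↔ P.Monic ∧ Irreducible P ∧ P.natDegree ≤ n) :
    n = ∑ P ∈ I, ∑ k ∈ Finset.Icc 1 n, if P ^ k ∣ h then P.natDegree else 0 := by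
  have h0 : h ≠ 0 := hm.ne_zero
  have hmon : ∀ P ∈ normalizedFactors h, P.Monic := by
    intro P hP
    have h1 := normalize_normalized_factor P hP
    have h2 : P ≠ 0 := (irreducible_of_normalized_factor P hP).ne_zero
    rw [← h1]; exact monic_normalize h2
  have hprod : (normalizedFactors h).prod = h := by
    apply eq_of_monic_of_associated _ hm (prod_normalizedFactors h0)
    exact monic_multiset_prod_of_monic _ _ hmon |> fun h => by simpa using h
  have hmem : ∀ P ∈ normalizedFactors h, P ∈ I := by
    intro P hP
    rw [hI]
    refine ⟨hmon P hP, irreducible_of_normalized_factor P hP, ?_⟩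
    rw [← hn]
    exact natDegree_le_of_dvd (dvd_of_mem_normalizedFactors hP) h0
  have hdeg : n = ∑ P ∈ I, (normalizedFactors h).count P * P.natDegree := by
    conv_lhs => rw [← hn, ← hprod, natDegree_multiset_prod_of_monic _ hmon,
      Finset.sum_multiset_map_count]
    simp only [smul_eq_mul]
    apply Finset.sum_subset
    · intro P hP; exact hmem P (Multiset.mem_toFinset.1 hP)
    · intro P _ hP
      rw [Multiset.mem_toFinset] at hP
      rw [Multiset.count_eq_zero_of_notMem hP, zero_mul]
  conv_lhs => rw [hdeg]
  refine Finset.sum_congr rfl fun P hP => ?_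
  obtain ⟨hPm, hPi, hPd⟩ := (hI P).1 hP
  have hiff : ∀ k, P ^ k ∣ h ↔ k ≤ (normalizedFactors h).count P := by
    intro k
    have e := emultiplicity_eq_count_normalizedFactors hPi h0
    rw [hPm.normalize_eq_self] at e
    rw [pow_dvd_iff_le_emultiplicity, e]
    exact_mod_cast Iff.rfl
  have hcn : (normalizedFactors h).count P ≤ n := by
    have h1 := natDegree_le_of_dvd ((hiff _).2 le_rfl) h0
    rw [natDegree_pow, hn] at h1
    have h2 := hPi.natDegree_pos
    nlinarith
  rw [← Finset.sum_filter, Finset.sum_const, smul_eq_mul]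
  congr 1
  have : Finset.filter (fun k => P ^ k ∣ h) (Finset.Icc 1 n) = 
      Finset.Icc 1 ((normalizedFactors h).count P) := by
    ext k
    rw [Finset.mem_filter, Finset.mem_Icc, Finset.mem_Icc, hiff]
    omega
  rw [this]; simp

lemma kl_sum_dvd {K : Type*} [Field K] [Fintype K] [DecidableEq K] (ψ : AddChar K ℂ) (c : K)
    (n k : ℕ) (P : K[X]) (hP : P.Monic) [DecidablePred fun h => P ^ k ∣ h] :
    ∑ h ∈ klM K n with P ^ k ∣ h, klLam ψ c h =
      if k * P.natDegree ≤ n then klLam ψ c P ^ k * klA ψ c (n - k * P.natDegree) else 0 := by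
  split_ifs with hk
  · rw [klA, Finset.mul_sum]
    symm
    refine Finset.sum_bij (fun g _ => P ^ k * g) ?_ ?_ ?_ ?_
    · intro g hg
      rw [mem_klM] at hg
      rw [Finset.mem_filter, mem_klM]
      refine ⟨⟨(hP.pow k).mul hg.1, ?_⟩, dvd_mul_right _ _⟩
      rw [(hP.pow k).natDegree_mul hg.1, hP.natDegree_pow, hg.2]; omega
    · intro g _ g' _ h
      exact mul_left_cancel₀ (hP.pow k).ne_zero h
    · intro h hh
      rw [Finset.mem_filter, mem_klM] at hh
      obtain ⟨⟨hm, hn⟩, g, rfl⟩ := hh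
      have hg : g.Monic := (hP.pow k).of_mul_monic_left hm
      refine ⟨g, ?_, rfl⟩
      rw [mem_klM]
      refine ⟨hg, ?_⟩
      rw [(hP.pow k).natDegree_mul hg, hP.natDegree_pow] at hn; omega
    · intro g hg
      rw [mem_klM] at hg
      rw [klLam_mul _ _ _ _ (hP.pow k) hg.1, klLam_pow _ _ _ hP]
  · apply Finset.sum_eq_zero
    intro h hh
    rw [Finset.mem_filter, mem_klM] at hh
    exfalso
    have := natDegree_le_of_dvd hh.2 hh.1.1.ne_zero
    rw [hP.natDegree_pow] at this; omega

lemma kl_newton {K : Type*} [Field K] [Fintype K] [DecidableEq K] (ψ : AddChar K ℂ) (c : K)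
    (κ : ℕ → ℂ) (n : ℕ)
    (hκ : ∀ j, 1 ≤ j → ∀ I : Finset K[X], j ≤ n → 
      (∀ P, P ∈ I ↔ P.Monic ∧ Irreducible P ∧ P.natDegree ≤ n) →
      κ j = ∑ P ∈ I, ∑ k ∈ Finset.Icc 1 n, if k * P.natDegree = j then
        (P.natDegree : ℂ) * klLam ψ c P ^ k else 0) :
    n * klA ψ c n = ∑ j ∈ Finset.Icc 1 n, κ j * klA ψ c (n - j) := by
  classical
  let I : Finset K[X] := ((Finset.range (n + 1)).biUnion (klM K)).filter Irreducible
  have hI : ∀ P, P ∈ I ↔ P.Monic ∧ Irreducible P ∧ P.natDegree ≤ n := by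
    intro P
    simp only [I, Finset.mem_filter, Finset.mem_biUnion, Finset.mem_range, mem_klM]
    constructor
    · rintro ⟨⟨d, hd, hm, hdd⟩, hi⟩; exact ⟨hm, hi, by omega⟩
    · rintro ⟨hm, hi, hd⟩; exact ⟨⟨_, by omega, hm, rfl⟩, hi⟩
  have lhs : n * klA ψ c n = ∑ P ∈ I, ∑ k ∈ Finset.Icc 1 n, (P.natDegree : ℂ) *
      (if k * P.natDegree ≤ n then klLam ψ c P ^ k * klA ψ c (n - k * P.natDegree) else 0) := by
    rw [klA, Finset.mul_sum]
    have e : ∀ h ∈ klM K n, (n : ℂ) * klLam ψ c h = ∑ P ∈ I, ∑ k ∈ Finset.Icc 1 n,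
        if P ^ k ∣ h then (P.natDegree : ℂ) * klLam ψ c h else 0 := by
      intro h hh
      rw [mem_klM] at hh
      have := congrArg (fun z : ℕ => (z : ℂ)) (kl_natDegree_eq n h hh.1 hh.2 I hI)
      conv_lhs => rw [this]
      push_cast
      rw [Finset.sum_mul]
      refine Finset.sum_congr rfl fun P _ => ?_
      rw [Finset.sum_mul]
      refine Finset.sum_congr rfl fun k _ => ?_
      split_ifs <;> simp
    rw [Finset.sum_congr rfl e, Finset.sum_comm]
    refine Finset.sum_congr rfl fun P hP => ?_
    rw [Finset.sum_comm]
    refine Finset.sum_congr rfl fun k _ => ?_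
    rw [← kl_sum_dvd ψ c n k P ((hI P).1 hP).1, Finset.mul_sum, Finset.sum_filter]
  rw [lhs]
  have rhs : ∀ j ∈ Finset.Icc 1 n, κ j * klA ψ c (n - j) = ∑ P ∈ I, ∑ k ∈ Finset.Icc 1 n,
      (if k * P.natDegree = j then
        (P.natDegree : ℂ) * (klLam ψ c P ^ k * klA ψ c (n - k * P.natDegree)) else 0) := by
    intro j hj
    rw [Finset.mem_Icc] at hj
    rw [hκ j hj.1 I hj.2 hI, Finset.sum_mul]
    refine Finset.sum_congr rfl fun P _ => ?_
    rw [Finset.sum_mul]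
    refine Finset.sum_congr rfl fun k _ => ?_
    split_ifs with h
    · rw [h]; ring
    · simp
  rw [Finset.sum_congr rfl rhs]
  conv_rhs => rw [Finset.sum_comm]
  refine Finset.sum_congr rfl fun P hP => ?_
  conv_rhs => rw [Finset.sum_comm]
  refine Finset.sum_congr rfl fun k hk => ?_
  have hpos := ((hI P).1 hP).2.1.natDegree_pos
  rw [Finset.mem_Icc] at hk
  rw [Finset.sum_ite_eq]
  have : k * P.natDegree ∈ Finset.Icc 1 n ↔ k * P.natDegree ≤ n := by
    rw [Finset.mem_Icc]
    have : 1 ≤ k * P.natDegree := Nat.mul_pos hk.1 hpos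
    tauto
  simp only [this]
  split_ifs <;> simp

open IntermediateField in
lemma kl_adjoin_inv {K L : Type*} [Field K] [Field L] [Algebra K L] (x : L) :
    K⟮x⁻¹⟯ = K⟮x⟯ := by
  apply le_antisymm
  · rw [adjoin_simple_le_iff]
    exact inv_mem (mem_adjoin_simple_self K x)
  · rw [adjoin_simple_le_iff]
    have := inv_mem (mem_adjoin_simple_self K x⁻¹)
    rwa [inv_inv] at this

open IntermediateField in
lemma kl_nextCoeff_inv {K L : Type*} [Field K] [Field L] [Algebra K L] [FiniteDimensional K L]
    (x : L) (hx : x ≠ 0) :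
    (minpoly K x⁻¹).nextCoeff = (minpoly K x).coeff 1 / (minpoly K x).coeff 0 := by
  set f := minpoly K x with hf
  have hix : IsIntegral K x := .of_finite K x
  have hiy : IsIntegral K x⁻¹ := .of_finite K _
  have h0 : f.coeff 0 ≠ 0 := minpoly.coeff_zero_ne_zero hix hx
  have hd : (minpoly K x⁻¹).natDegree = f.natDegree := by
    rw [← adjoin.finrank hix, ← adjoin.finrank hiy, kl_adjoin_inv]
  have hpos : 0 < f.natDegree := minpoly.natDegree_pos hix
  have htr : f.natTrailingDegree = 0 := by
    rw [natTrailingDegree_eq_zero]; exact Or.inr h0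
  have hrd : f.reverse.natDegree = f.natDegree := by rw [reverse_natDegree, htr]; simp
  have hrl : f.reverse.leadingCoeff = f.coeff 0 := by
    rw [reverse_leadingCoeff, trailingCoeff, htr]
  have hgm : (C (f.coeff 0)⁻¹ * f.reverse).Monic := by
    rw [Monic, leadingCoeff_mul, leadingCoeff_C, hrl, inv_mul_cancel₀ h0]
  have hge : aeval x⁻¹ (C (f.coeff 0)⁻¹ * f.reverse) = 0 := by
    rw [map_mul]
    haveI := invertibleOfNonzero hx
    have := (eval₂_reverse_eq_zero_iff (algebraMap K L) x f).2 (by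
      rw [← aeval_def, hf, minpoly.aeval])
    rw [invOf_eq_inv, ← aeval_def] at this
    rw [this, mul_zero]
  have hgd : (C (f.coeff 0)⁻¹ * f.reverse).natDegree = f.natDegree := by
    rw [natDegree_C_mul (inv_ne_zero h0), hrd]
  have heq := eq_of_monic_of_dvd_of_natDegree_le (minpoly.monic hiy) hgm (minpoly.dvd K _ hge)
    (by rw [hgd, hd])
  rw [← heq, nextCoeff_of_natDegree_pos (by rw [hgd]; exact hpos), hgd, coeff_C_mul, coeff_reverse,
    revAt_le (by omega)]
  rw [show f.natDegree - (f.natDegree - 1) = 1 by omega]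
  field_simp

open IntermediateField in
lemma kl_term {K L : Type*} [Field K] [DecidableEq K] [Field L] [DecidableEq L] [Algebra K L]
    [FiniteDimensional K L] (ψ : AddChar K ℂ) (c : K) (x : L) (k : ℕ)
    (hk : k * (minpoly K x).natDegree = Module.finrank K L) :
    (if x = 0 then 0 else ψ (Algebra.trace K L (x + algebraMap K L c * x⁻¹))) =
      klLam ψ c (minpoly K x) ^ k := by
  have hix : IsIntegral K x := .of_finite K x
  have hpos : 0 < (minpoly K x).natDegree := minpoly.natDegree_pos hix
  have hfr : Module.finrank K⟮x⟯ L = k := by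
    have h1 := Module.finrank_mul_finrank K K⟮x⟯ L
    rw [adjoin.finrank hix, ← hk, mul_comm] at h1
    exact Nat.eq_of_mul_eq_mul_right hpos h1
  have hk0 : k ≠ 0 := by
    rintro rfl
    have : 0 < Module.finrank K L := Module.finrank_pos
    omega
  split_ifs with hx
  · subst hx
    simp [klLam, hk0]
  · have h0 : (minpoly K x).coeff 0 ≠ 0 := minpoly.coeff_zero_ne_zero hix hx
    rw [klLam, if_neg h0, ← AddChar.map_nsmul_eq_pow]
    congr 1
    rw [map_add, ← Algebra.smul_def, map_smul, trace_eq_finrank_mul_minpoly_nextCoeff,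
      trace_eq_finrank_mul_minpoly_nextCoeff K (x⁻¹), kl_nextCoeff_inv x hx, kl_adjoin_inv, hfr,
      nsmul_eq_mul, smul_eq_mul]
    ring

lemma kl_fiber_card {K L : Type*} [Field K] [Fintype K] [Field L] [Fintype L] [DecidableEq L]
    [Algebra K L] (P : K[X]) (hm : P.Monic) (hi : Irreducible P)
    [DecidableEq K[X]] (hd : P.natDegree ∣ Module.finrank K L) :
    (Finset.univ.filter fun x : L => minpoly K x = P).card = P.natDegree := by
  have hdvd := hi.natDegree_dvd_iff_dvd_X_pow_card_pow_sub_X.1 hd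
  have hcard : Nat.card K ^ Module.finrank K L = Fintype.card L := by
    rw [← Nat.card_eq_fintype_card]; exact (Module.natCard_eq_pow_finrank (K := K) (V := L)).symm
  rw [hcard] at hdvd
  have hspl : (P.map (algebraMap K L)).Splits := by
    have h1 : ((X ^ Fintype.card L - X : K[X]).map (algebraMap K L)).Splits := by
      have := (FiniteField.isSplittingField_sub L K).splits
      exact this
    refine h1.of_dvd ?_ (Polynomial.map_dvd _ hdvd)
    rw [Polynomial.map_sub, Polynomial.map_pow, map_X]
    exact FiniteField.X_pow_card_sub_X_ne_zero L Fintype.one_lt_card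
  have hsep : P.Separable := PerfectField.separable_of_irreducible hi
  have := card_rootSet_eq_natDegree hsep hspl
  rw [← this, ← Set.toFinset_card]
  congr 1
  ext x
  simp only [Finset.mem_filter, Finset.mem_univ, true_and, Set.mem_toFinset]
  rw [mem_rootSet]
  constructor
  · rintro rfl; exact ⟨hm.ne_zero, minpoly.aeval _ _⟩
  · rintro ⟨_, h⟩; exact (minpoly.eq_of_irreducible_of_monic hi h hm).symm

lemma kl_ext {K L : Type*} [Field K] [Fintype K] [DecidableEq K] [Field L] [Fintype L]
    [DecidableEq L] [Algebra K L] (ψ : AddChar K ℂ) (c : K) (n j : ℕ)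
    (hj : Module.finrank K L = j) (hjn : j ≤ n) (I : Finset K[X])
    (hI : ∀ P, P ∈ I ↔ P.Monic ∧ Irreducible P ∧ P.natDegree ≤ n) :
    (∑ x : L, if x = 0 then 0 else ψ (Algebra.trace K L (x + algebraMap K L c * x⁻¹))) =
      ∑ P ∈ I, ∑ k ∈ Finset.Icc 1 n, if k * P.natDegree = j then
        (P.natDegree : ℂ) * klLam ψ c P ^ k else 0 := by
  classical
  haveI : FiniteDimensional K L := .of_finite
  have hjpos : 0 < j := hj ▸ Module.finrank_pos
  have hmem : ∀ x ∈ (Finset.univ : Finset L), minpoly K x ∈ I := by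
    intro x _
    have hix : IsIntegral K x := .of_finite K x
    rw [hI]
    refine ⟨minpoly.monic hix, minpoly.irreducible hix, ?_⟩
    have := Nat.le_of_dvd (hj ▸ hjpos) (minpoly.degree_dvd hix)
    omega
  rw [← Finset.sum_fiberwise_of_maps_to hmem]
  refine Finset.sum_congr rfl fun P hP => ?_
  obtain ⟨hm, hi, hPn⟩ := (hI P).1 hP
  have hpos := hi.natDegree_pos
  by_cases hd : P.natDegree ∣ j
  · obtain ⟨k, hk⟩ := hd
    have hk1 : 1 ≤ k := by
      rcases Nat.eq_zero_or_pos k with h | h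
      · subst h; omega
      · exact h
    have hkn : k ≤ n := by nlinarith
    rw [Finset.sum_eq_single k]
    · rw [if_pos (by rw [hk, mul_comm])]
      have : ∀ x ∈ Finset.univ.filter (fun x : L => minpoly K x = P),
        (if x = 0 then 0 else ψ (Algebra.trace K L (x + algebraMap K L c * x⁻¹))) =
          klLam ψ c P ^ k := by
        intro x hx
        rw [Finset.mem_filter] at hx
        rw [kl_term ψ c x k (by rw [hx.2, hj, hk, mul_comm]), hx.2]
      rw [Finset.sum_congr rfl this, Finset.sum_const, nsmul_eq_mul,
        kl_fiber_card P hm hi (by rw [hj, hk]; exact dvd_mul_right _ _)]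
    · intro k' _ hne
      rw [if_neg]
      intro h
      rw [hk, mul_comm] at h
      exact hne (Nat.eq_of_mul_eq_mul_left hpos h)
    · intro h
      exact absurd (Finset.mem_Icc.2 ⟨hk1, hkn⟩) h
  · rw [Finset.sum_eq_zero, Finset.sum_eq_zero]
    · intro k _
      rw [if_neg]
      intro h; exact hd ⟨k, by rw [← h, mul_comm]⟩
    · intro x hx
      rw [Finset.mem_filter] at hx
      exfalso
      apply hd
      rw [← hx.2, ← hj]
      exact minpoly.degree_dvd (.of_finite K x)

lemma kl_powersum {ι : Type*} [Fintype ι] (γ : ι → ℂ) (ρ C : ℝ) (hρ : 0 < ρ) (k0 : ℕ)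
    (h : ∀ k, k0 ≤ k → ‖∑ i, γ i ^ k‖ ≤ C * ρ ^ k) (i0 : ι) : ‖γ i0‖ ≤ ρ := by
  classical
  by_contra hlt
  push Not at hlt
  set S := (Finset.univ.image γ).erase (γ i0) with hS
  set p : ℂ[X] := ∏ g ∈ S, (X - Polynomial.C g) with hp
  have hp0 : p.eval (γ i0) ≠ 0 := by
    rw [hp, eval_prod, Finset.prod_ne_zero_iff]
    intro g hg
    rw [eval_sub, eval_X, eval_C, sub_ne_zero]
    exact (Finset.ne_of_mem_erase hg).symm
  have hpi : ∀ i, γ i ≠ γ i0 → p.eval (γ i) = 0 := by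
    intro i hi
    rw [hp, eval_prod, Finset.prod_eq_zero_iff]
    exact ⟨γ i, Finset.mem_erase.2 ⟨hi, Finset.mem_image_of_mem _ (Finset.mem_univ _)⟩, by simp⟩
  set m := (Finset.univ.filter fun i => γ i = γ i0).card with hm
  have hm1 : 0 < m := Finset.card_pos.2 ⟨i0, by simp⟩
  set D := ∑ l ∈ Finset.range (p.natDegree + 1), ‖p.coeff l‖ * (C * ρ ^ l) with hD
  have hmain : ∀ k, k0 ≤ k → (m * ‖p.eval (γ i0)‖) * ‖γ i0‖ ^ k ≤ D * ρ ^ k := by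
    intro k hk
    have e1 : ∑ i, γ i ^ k * p.eval (γ i) = m * (γ i0 ^ k * p.eval (γ i0)) := by
      rw [hm, ← nsmul_eq_mul, ← Finset.sum_const, Finset.sum_filter]
      refine Finset.sum_congr rfl fun i _ => ?_
      split_ifs with hi
      · rw [hi]
      · rw [hpi i hi, mul_zero]
    have e2 : ∑ i, γ i ^ k * p.eval (γ i) =
        ∑ l ∈ Finset.range (p.natDegree + 1), p.coeff l * ∑ i, γ i ^ (k + l) := by
      simp_rw [eval_eq_sum_range, Finset.mul_sum]
      rw [Finset.sum_comm]
      refine Finset.sum_congr rfl fun l _ => Finset.sum_congr rfl fun i _ => ?_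
      rw [pow_add]; ring
    have e3 : ‖∑ i, γ i ^ k * p.eval (γ i)‖ ≤ D * ρ ^ k := by
      rw [e2, hD, Finset.sum_mul]
      refine (norm_sum_le _ _).trans (Finset.sum_le_sum fun l _ => ?_)
      rw [norm_mul, mul_assoc]
      refine mul_le_mul_of_nonneg_left ?_ (norm_nonneg _)
      refine (h (k + l) (by omega)).trans (le_of_eq ?_)
      rw [pow_add]; ring
    rw [e1] at e3
    refine le_trans (le_of_eq ?_) e3
    simp only [norm_mul, norm_pow, Complex.norm_natCast]; ring
  have hpos : 0 < (m : ℝ) * ‖p.eval (γ i0)‖ :=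
    mul_pos (by exact_mod_cast hm1) (norm_pos_iff.2 hp0)
  have hr : 1 < ‖γ i0‖ / ρ := by rwa [one_lt_div hρ]
  have ht := tendsto_pow_atTop_atTop_of_one_lt hr
  obtain ⟨k, hk1, hk2⟩ := ((ht.eventually_gt_atTop (D / (m * ‖p.eval (γ i0)‖))).and
    (Filter.eventually_ge_atTop k0)).exists
  have := hmain k hk2
  rw [div_pow, div_lt_div_iff₀ hpos (pow_pos hρ k)] at hk1
  linarith

lemma kl_seq {K : Type} [Field K] [Fintype K] [DecidableEq K] (ψ : AddChar K ℂ)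
    (hψ : ψ.IsPrimitive) (c : K) (hc : c ≠ 0) :
    ∃ α β : ℂ, α + β = - klA ψ c 1 ∧ ∀ (L : Type) [Field L] [Fintype L] [DecidableEq L]
      [Algebra K L], 
      (∑ x : L, if x = 0 then 0 else ψ (Algebra.trace K L (x + algebraMap K L c * x⁻¹))) =
        -(α ^ (Module.finrank K L) + β ^ (Module.finrank K L)) := by
  classical
  have hψ1 : ψ ≠ 1 := by
    have := hψ (one_ne_zero)
    rwa [AddChar.mulShift_one] at this
  obtain ⟨p, hp⟩ := CharP.exists K
  haveI : Fact p.Prime := ⟨CharP.char_is_prime K p⟩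
  have hex : ∀ j : ℕ, ∃ z : ℂ, 1 ≤ j → ∀ n, j ≤ n → ∀ I : Finset K[X],
      (∀ P, P ∈ I ↔ P.Monic ∧ Irreducible P ∧ P.natDegree ≤ n) →
      z = ∑ P ∈ I, ∑ k ∈ Finset.Icc 1 n, if k * P.natDegree = j then
        (P.natDegree : ℂ) * klLam ψ c P ^ k else 0 := by
    intro j
    by_cases hj : 1 ≤ j
    · haveI : NeZero j := ⟨by omega⟩
      letI : Fintype (FiniteField.Extension K p j) := Fintype.ofFinite _
      exact ⟨_, fun _ n hn I hI => kl_ext (L := FiniteField.Extension K p j) ψ c n j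
        (FiniteField.finrank_extension K p j) hn I hI⟩
    · exact ⟨0, fun h => absurd h hj⟩
  choose κ hκ using hex
  have hnew : ∀ n, n * klA ψ c n = ∑ j ∈ Finset.Icc 1 n, κ j * klA ψ c (n - j) := fun n =>
    kl_newton ψ c κ n fun j hj I hjn hI => hκ j hj n hjn I hI
  set a := klA ψ c 1 with ha
  have h2 := klA_two ψ hψ c hc
  have k1 : κ 1 = a := by
    have := hnew 1
    simp [klA_zero] at this
    exact this.symm
  have k2 : κ 2 = 2 * Fintype.card K - a ^ 2 := by
    have := hnew 2
    rw [Finset.sum_Icc_succ_top (by norm_num)] at this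
    simp [klA_zero, h2, k1, ← ha] at this
    linear_combination -this
  have k3 : ∀ n, κ (n + 3) = - a * κ (n + 2) - Fintype.card K * κ (n + 1) := by
    intro n
    have := hnew (n + 3)
    rw [Finset.sum_Icc_succ_top (by omega), Finset.sum_Icc_succ_top (by omega),
      Finset.sum_Icc_succ_top (by omega), Finset.sum_eq_zero, klA_ge ψ hψ1] at this
    · rw [show n + 3 - (n + 1) = 2 by omega, show n + 3 - (n + 1 + 1) = 1 by omega,
        show n + 3 - (n + 2 + 1) = 0 by omega, klA_zero, h2, ← ha] at this
      linear_combination -this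
    · intro j hj
      rw [Finset.mem_Icc] at hj
      obtain ⟨i, hi⟩ : ∃ i, n + 3 - j = i + 3 := ⟨n - j, by omega⟩
      rw [hi, klA_ge ψ hψ1, mul_zero]
  obtain ⟨α, hα⟩ : ∃ α : ℂ, α ^ 2 + a * α + Fintype.card K = 0 := by
    obtain ⟨α, hα⟩ := IsAlgClosed.exists_root (C (1:ℂ) * X ^ 2 + C a * X + C (Fintype.card K : ℂ))
      (by rw [degree_quadratic one_ne_zero]; norm_num)
    refine ⟨α, ?_⟩
    simpa [IsRoot] using hα
  refine ⟨α, -a - α, by ring, ?_⟩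
  have hpow : ∀ n, κ (n + 1) = -(α ^ (n + 1) + (-a - α) ^ (n + 1)) ∧
      κ (n + 2) = -(α ^ (n + 2) + (-a - α) ^ (n + 2)) := by
    intro n
    induction n with
    | zero =>
      refine ⟨by rw [zero_add, k1]; ring, ?_⟩
      rw [zero_add, k2]
      linear_combination 2 * hα
    | succ n ih =>
      refine ⟨ih.2, ?_⟩
      rw [show n + 1 + 2 = n + 3 by ring, k3, ih.1, ih.2]
      linear_combination (α ^ (n + 1) + (-a - α) ^ (n + 1)) * hα
  intro L _ _ _ _
  have hpos : 0 < Module.finrank K L := by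
    haveI : FiniteDimensional K L := .of_finite
    exact Module.finrank_pos
  obtain ⟨n, hn⟩ : ∃ n, Module.finrank K L = n + 1 := ⟨_, (Nat.succ_pred_eq_of_pos hpos).symm⟩
  rw [hn, ← (hpow n).1]
  let I : Finset K[X] := ((Finset.range (n + 1 + 1)).biUnion (klM K)).filter Irreducible
  have hI : ∀ P, P ∈ I ↔ P.Monic ∧ Irreducible P ∧ P.natDegree ≤ n + 1 := by
    intro P
    simp only [I, Finset.mem_filter, Finset.mem_biUnion, Finset.mem_range, mem_klM]
    constructor
    · rintro ⟨⟨d, hd, hm, hdd⟩, hi⟩; exact ⟨hm, hi, by omega⟩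
    · rintro ⟨hm, hi, hd⟩; exact ⟨⟨_, by omega, hm, rfl⟩, hi⟩
  rw [hκ (n + 1) (by omega) (n + 1) le_rfl I hI]
  exact kl_ext ψ c (n + 1) (n + 1) hn le_rfl I hI

lemma kl_sum_bound {K : Type} [Field K] [Fintype K] [DecidableEq K] (hK : ringChar K ≠ 2)
    (ψ : AddChar K ℂ) (hψ : ψ.IsPrimitive) (c : K) (hc : c ≠ 0)
    (α β : {s : K // s ≠ 0} → ℂ)
    (hαβ : ∀ s, ∀ (L : Type) [Field L] [Fintype L] [DecidableEq L]
      [Algebra K L], 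
      (∑ x : L, if x = 0 then 0 else
        ψ.mulShift s.1 (Algebra.trace K L (x + algebraMap K L c * x⁻¹))) =
        -(α s ^ (Module.finrank K L) + β s ^ (Module.finrank K L))) (k : ℕ) (hk : 5 ≤ k) :
    ‖∑ s, (α s ^ (2 * k) + β s ^ (2 * k))‖ ≤
      (16 * Fintype.card K + 6) * (Fintype.card K : ℝ) ^ k := by
  classical
  obtain ⟨p, hp⟩ := CharP.exists K
  haveI : Fact p.Prime := ⟨CharP.char_is_prime K p⟩
  haveI : NeZero (2 * k) := ⟨by omega⟩
  set L := FiniteField.Extension K p (2 * k) with hLdef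
  letI : Fintype L := Fintype.ofFinite _
  set q := Fintype.card K with hq
  have hfin : Module.finrank K L = 2 * k := FiniteField.finrank_extension K p (2 * k)
  have hcard : Fintype.card L = (q ^ k) ^ 2 := by
    rw [← Nat.card_eq_fintype_card, hLdef, FiniteField.natCard_extension, Nat.card_eq_fintype_card,
      ← pow_mul, mul_comm]
  have hLc : ringChar L ≠ 2 := by
    rwa [← Algebra.ringChar_eq K L]
  have hq2 : 2 ≤ q := Fintype.one_lt_card
  have hq3 : 3 ≤ q := by
    have := FiniteField.odd_card_of_char_ne_two hK
    omega
  have hq0 : (q : L) = 0 := by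
    have : ((q : K)) = 0 := FiniteField.cast_card_eq_zero K
    have h := congrArg (algebraMap K L) this
    simpa using h
  have hRq : 8 * q + 5 ≤ q ^ k := by
    calc 8 * q + 5 ≤ 81 * q := by omega
      _ = 3 ^ 4 * q := by norm_num
      _ ≤ q ^ 4 * q := by gcongr
      _ = q ^ 5 := by ring
      _ ≤ q ^ k := Nat.pow_le_pow_right (by omega) hk
  have hcL : algebraMap K L c ≠ 0 := by simpa using hc
  have h1 := kl_count (L := L) hLc ψ hψ (algebraMap K L c) hcL
  have h2 := kl_charsum hLc (q ^ k) hcard q hq2 hq0 hRq (algebraMap K L c) hcL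
  rw [← hq] at h1
  set T := ∑ y : L, quadraticChar L ((y ^ q - y) ^ 2 - 4 * algebraMap K L c) with hT
  have h3 : ∑ s : K, ∑ x : L, (if x = 0 then 0 else
      ψ (s * Algebra.trace K L (x + algebraMap K L c * x⁻¹))) = 
      (Fintype.card L - 1) + -∑ s, (α s ^ (2 * k) + β s ^ (2 * k)) := by
    rw [Fintype.sum_eq_add_sum_subtype_ne _ (0 : K)]
    congr 1
    · simp only [zero_mul, AddChar.map_zero_eq_one]
      rw [Finset.sum_ite, Finset.sum_const_zero, zero_add, Finset.sum_const, nsmul_eq_mul, mul_one]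
      have : (Finset.univ.filter fun x : L => ¬ x = 0) = Finset.univ.erase 0 := by ext; simp
      rw [this, Finset.card_erase_of_mem (Finset.mem_univ _), Finset.card_univ,
        Nat.cast_sub Fintype.card_pos, Nat.cast_one]
    · rw [← Finset.sum_neg_distrib]
      refine Finset.sum_congr rfl fun s _ => ?_
      have := hαβ s L
      rw [hfin] at this
      rw [← this]
      rfl
  have h4 : ∑ s, (α s ^ (2 * k) + β s ^ (2 * k)) = -((T : ℂ) + 1) := by
    linear_combination h3 - h1
  have h5 : |(T : ℝ)| ≤ ((q:ℝ) ^ k * (14 * q + 5) + 2 * q) := by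
    exact_mod_cast h2
  rw [h4, norm_neg]
  refine (norm_add_le _ _).trans ?_
  rw [Complex.norm_intCast, norm_one]
  have h6 : (1 : ℝ) ≤ (q : ℝ) ^ k := one_le_pow₀ (by exact_mod_cast (by omega : 1 ≤ q))
  have hq' : (0 : ℝ) ≤ q := by positivity
  nlinarith

lemma kl_weil {K : Type} [Field K] [Fintype K] [DecidableEq K] (hK : ringChar K ≠ 2)
    (ψ : AddChar K ℂ) (hψ : ψ.IsPrimitive) (c : K) (hc : c ≠ 0) :
    ‖∑ x : K, if x = 0 then 0 else ψ (x + c * x⁻¹)‖ ≤ 2 * √(Fintype.card K : ℝ) := by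
  classical
  have hprim : ∀ s : {s : K // s ≠ 0}, (ψ.mulShift s.1).IsPrimitive := by
    intro s t ht
    rw [AddChar.mulShift_mulShift]
    exact hψ (mul_ne_zero s.2 ht)
  choose α β hs hL using fun s : {s : K // s ≠ 0} => kl_seq (ψ.mulShift s.1) (hprim s) c hc
  have hb := kl_sum_bound hK ψ hψ c hc α β hL
  have hq : (0 : ℝ) < Fintype.card K := by exact_mod_cast Fintype.card_pos
  have key := kl_powersum (ι := {s : K // s ≠ 0} × Bool)
    (fun i => if i.2 then α i.1 ^ 2 else β i.1 ^ 2) (Fintype.card K) _ hq 5 (by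
      intro k hk
      refine le_trans (le_of_eq ?_) (hb k hk)
      congr 1
      rw [Fintype.sum_prod_type]
      refine Finset.sum_congr rfl fun s _ => ?_
      simp [pow_mul])
  have h1 := key (⟨1, one_ne_zero⟩, true)
  have h2 := key (⟨1, one_ne_zero⟩, false)
  simp only [if_true, norm_pow, Bool.false_eq_true, if_false] at h1 h2
  have h1' := Real.le_sqrt_of_sq_le h1
  have h2' := Real.le_sqrt_of_sq_le h2
  have h3 := hs ⟨1, one_ne_zero⟩
  rw [AddChar.mulShift_one, klA_one] at h3
  rw [← norm_neg, ← h3]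
  exact (norm_add_le _ _).trans (by linarith)

noncomputable def gsE {K : Type} [Field K] [Fintype K] [DecidableEq K] (s : K) : ℂ :=
  ((quadraticChar K s : ℤ) : ℂ)

lemma gsE_mul {K : Type} [Field K] [Fintype K] [DecidableEq K] (s t : K) :
    gsE (s * t) = gsE s * gsE t := by
  unfold gsE; rw [map_mul]; push_cast; rfl

lemma gsE_sq {K : Type} [Field K] [Fintype K] [DecidableEq K] (s : K) (hs : s ≠ 0) :
    gsE s * gsE s = 1 := by
  have := quadraticChar_sq_one hs
  rw [gsE, ← sq]; exact_mod_cast this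

lemma gsE_norm {K : Type} [Field K] [Fintype K] [DecidableEq K] (s : K) (hs : s ≠ 0) :
    ‖gsE s‖ = 1 := by
  have h := congrArg norm (gsE_sq s hs)
  rw [norm_mul, norm_one] at h
  nlinarith [norm_nonneg (gsE s)]

lemma gsE_sq' {K : Type} [Field K] [Fintype K] [DecidableEq K] (s : K) (hs : s ≠ 0) :
    gsE (s ^ 2) = 1 := by rw [sq, gsE_mul, gsE_sq s hs]

lemma gsE_inv {K : Type} [Field K] [Fintype K] [DecidableEq K] (s : K) :
    gsE s⁻¹ = gsE s := by
  by_cases hs : s = 0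
  · simp [hs]
  · have h1 : gsE s⁻¹ * gsE s = 1 := by
      rw [← gsE_mul, inv_mul_cancel₀ hs]; simp [gsE]
    have h2 := gsE_sq s hs
    calc gsE s⁻¹ = gsE s⁻¹ * (gsE s * gsE s) := by rw [h2, mul_one]
      _ = (gsE s⁻¹ * gsE s) * gsE s := by ring
      _ = gsE s := by rw [h1, one_mul]

lemma gs_gauss {K : Type} [Field K] [Fintype K] [DecidableEq K] (hK : ringChar K ≠ 2)
    (ψ : AddChar K ℂ) (hψ : ψ.IsPrimitive) :
    ∃ G : ℂ, G ^ 2 = gsE (-1 : K) * Fintype.card K ∧ ‖G‖ = √(Fintype.card K : ℝ) ∧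
      ∀ s : K, s ≠ 0 → ∑ x : K, ψ (s * x ^ 2) = gsE s * G := by
  set χ : MulChar K ℂ := (quadraticChar K).ringHomComp (Int.castRingHom ℂ) with hχ
  have hχe : ∀ s, χ s = gsE s := fun s => by simp [χ, gsE, MulChar.ringHomComp_apply]
  have hχ1 : χ ≠ 1 := (MulChar.ringHomComp_ne_one_iff (RingHom.injective_int _)).2
    (quadraticChar_ne_one hK)
  have hχq : χ.IsQuadratic := (quadraticChar_isQuadratic K).comp _
  have hsq := gaussSum_sq hχ1 hχq hψ
  rw [hχe] at hsq
  refine ⟨gaussSum χ ψ, hsq, ?_, ?_⟩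
  · have h := congrArg norm hsq
    rw [norm_pow, norm_mul, gsE_norm _ (neg_ne_zero.2 one_ne_zero), one_mul,
      Complex.norm_natCast] at h
    rw [← h, Real.sqrt_sq (norm_nonneg _)]
  · intro s hs
    have h1 : ∑ x : K, ψ (s * x ^ 2) = ∑ y : K, (gsE y + 1) * ψ (s * y) := by
      rw [← Finset.sum_fiberwise_of_maps_to (t := Finset.univ) (g := fun x : K => x ^ 2)
        (fun _ _ => Finset.mem_univ _)]
      refine Finset.sum_congr rfl fun y _ => ?_
      have : ∀ x ∈ Finset.univ.filter (fun x : K => x ^ 2 = y), ψ (s * x ^ 2) = ψ (s * y) := by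
        intro x hx
        rw [(Finset.mem_filter.1 hx).2]
      rw [Finset.sum_congr rfl this, Finset.sum_const, nsmul_eq_mul]
      congr 1
      have := quadraticChar_card_sqrts hK y
      have h' := congrArg (fun z : ℤ => (z : ℂ)) this
      simp only [Int.cast_natCast, Int.cast_add, Int.cast_one] at h'
      rw [gsE, ← h']
      congr 2
      ext; simp
    rw [h1]
    simp_rw [add_mul, one_mul, Finset.sum_add_distrib]
    have h2 : ∑ y : K, ψ (s * y) = 0 := by
      have := AddChar.sum_mulShift s hψ
      rw [if_neg hs, Nat.cast_zero] at this
      rw [← this]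
      exact Finset.sum_congr rfl fun y _ => by rw [mul_comm]
    rw [h2, add_zero]
    have h3 := gaussSum_mulShift χ ψ (Units.mk0 s hs)
    rw [Units.val_mk0, hχe] at h3
    rw [← h3, ← mul_assoc, gsE_sq s hs, one_mul]
    unfold gaussSum
    refine Finset.sum_congr rfl fun y _ => ?_
    rw [hχe, AddChar.mulShift_apply]

lemma gs_salie {K : Type} [Field K] [Fintype K] [DecidableEq K] (hK : ringChar K ≠ 2)
    (ψ : AddChar K ℂ) (hψ : ψ.IsPrimitive) (b : K) :
    ‖∑ s : K, if s = 0 then 0 else gsE s * ψ (s + b * s⁻¹)‖ ≤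
      (if b = 0 then 1 else 2) * √(Fintype.card K : ℝ) := by
  obtain ⟨G, hG2, hGn, hG⟩ := gs_gauss hK ψ hψ
  have h2 : (2 : K) ≠ 0 := Ring.two_ne_zero hK
  have h4 : (4 : K) ≠ 0 := by
    have : (4 : K) = 2 * 2 := by norm_num
    rw [this]; exact mul_ne_zero h2 h2
  have hgs4 : gsE (4⁻¹ : K) = 1 := by
    rw [gsE_inv, show (4 : K) = 2 ^ 2 by norm_num, gsE_sq' _ h2]
  set V := Finset.univ.filter fun v : K => v ^ 2 = 4 * b with hV
  have hVc : (V.card : ℝ) ≤ if b = 0 then 1 else 2 := by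
    split_ifs with hb
    · have : V ⊆ {0} := by
        intro v hv
        rw [hV, Finset.mem_filter, hb, mul_zero] at hv
        simpa using hv.2
      exact_mod_cast (Finset.card_le_card this)
    · have h := quadraticChar_card_sqrts hK (4 * b)
      have h' : V.card = (Set.toFinset {x : K | x ^ 2 = 4 * b}).card := by
        congr 1; ext; simp [hV]
      rw [← h'] at h
      have h'' : quadraticChar K (4 * b) ≤ 1 := by
        rcases quadraticChar_isQuadratic K (4 * b) with h | h | h <;> rw [h] <;> norm_num
      have : (V.card : ℤ) ≤ 2 := by omega
      exact_mod_cast this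
  have key : (Fintype.card K : ℂ) * ∑ v ∈ V, ψ v = gsE (-1 : K) * G *
      ∑ s : K, if s = 0 then 0 else gsE s * ψ (s + b * s⁻¹) := by
    have e1 : (Fintype.card K : ℂ) * ∑ v ∈ V, ψ v =
        ∑ v : K, ∑ c : K, ψ (v + c * (b - v ^ 2 / 4)) := by
      rw [hV, Finset.sum_filter, Finset.mul_sum]
      refine Finset.sum_congr rfl fun v _ => ?_
      simp_rw [AddChar.map_add_eq_mul, ← Finset.mul_sum]
      rw [AddChar.sum_mulShift _ hψ]
      have : b - v ^ 2 / 4 = 0 ↔ v ^ 2 = 4 * b := by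
        rw [sub_eq_zero, eq_div_iff h4]
        constructor <;> intro h <;> linear_combination -h
      simp only [this]
      split_ifs <;> simp [mul_comm]
    rw [e1, Finset.sum_comm, Finset.mul_sum]
    rw [← Equiv.sum_comp (Equiv.inv K)]
    refine Finset.sum_congr rfl fun s _ => ?_
    rw [Equiv.inv_apply]
    split_ifs with hs
    · simp only [hs, inv_zero, zero_mul, add_zero, mul_zero]
      have := AddChar.sum_mulShift (1 : K) hψ
      simpa using this
    · have e2 : ∀ v : K, ψ (v + s⁻¹ * (b - v ^ 2 / 4)) =
          ψ (s + b * s⁻¹) * ψ (-(s⁻¹ * 4⁻¹) * (v - 2 * s) ^ 2) := by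
        intro v
        rw [← AddChar.map_add_eq_mul]
        congr 1
        field_simp
        ring
      simp_rw [e2, ← Finset.mul_sum]
      rw [show ∑ v : K, ψ (-(s⁻¹ * 4⁻¹) * (v - 2 * s) ^ 2) = ∑ v : K, ψ (-(s⁻¹ * 4⁻¹) * v ^ 2) from
        Equiv.sum_comp (Equiv.subRight (2 * s)) (fun v => ψ (-(s⁻¹ * 4⁻¹) * v ^ 2)),
        hG _ (neg_ne_zero.2 (mul_ne_zero (inv_ne_zero hs) (inv_ne_zero h4))),
        show -(s⁻¹ * 4⁻¹) = -1 * (s⁻¹ * 4⁻¹) by ring, gsE_mul, gsE_mul, hgs4, gsE_inv]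
      ring
  have hn := congrArg norm key
  rw [norm_mul, norm_mul, norm_mul, gsE_norm _ (neg_ne_zero.2 one_ne_zero), one_mul, hGn,
    Complex.norm_natCast] at hn
  have hb : ‖∑ v ∈ V, ψ v‖ ≤ if b = 0 then 1 else 2 := by
    refine le_trans ((norm_sum_le _ _).trans (le_of_eq ?_)) hVc
    simp [AddChar.norm_apply]
  have hq : (0 : ℝ) < Fintype.card K := by exact_mod_cast Fintype.card_pos
  have hsq := Real.mul_self_sqrt hq.le
  have hsp := Real.sqrt_pos.2 hq
  set B : ℝ := if b = 0 then 1 else 2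
  set r := √(Fintype.card K : ℝ)
  rw [← hsq] at hn
  have : r * ‖∑ s : K, if s = 0 then 0 else gsE s * ψ (s + b * s⁻¹)‖ ≤ r * (B * r) := by
    rw [← hn]
    nlinarith
  exact le_of_mul_le_mul_left this hsp

lemma gs_K {K : Type} [Field K] [Fintype K] [DecidableEq K] (hK : ringChar K ≠ 2)
    (ψ : AddChar K ℂ) (hψ : ψ.IsPrimitive) (d : ℕ) (t b : K) (ht : t ≠ 0) :
    ‖∑ s : K, if s = 0 then 0 else gsE s ^ d * ψ (-(s * t) - b * s⁻¹)‖ ≤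
      (if b = 0 then 1 else 2) * √(Fintype.card K : ℝ) := by
  have hprim : (ψ.mulShift (-t)).IsPrimitive := by
    intro u hu
    rw [AddChar.mulShift_mulShift]
    exact hψ (mul_ne_zero (neg_ne_zero.2 ht) hu)
  have harg : ∀ s : K, ψ (-(s * t) - b * s⁻¹) = ψ.mulShift (-t) (s + (b / t) * s⁻¹) := by
    intro s
    rw [AddChar.mulShift_apply]
    congr 1
    field_simp
    ring
  simp_rw [harg]
  have hbt : b / t = 0 ↔ b = 0 := by simp [ht]
  have hq : (1 : ℝ) ≤ Fintype.card K := by exact_mod_cast Fintype.card_pos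
  rcases Nat.even_or_odd d with he | ho
  · have e1 : ∀ s : K, (if s = 0 then 0 else gsE s ^ d * ψ.mulShift (-t) (s + (b / t) * s⁻¹)) =
        if s = 0 then 0 else ψ.mulShift (-t) (s + (b / t) * s⁻¹) := by
      intro s
      split_ifs with hs
      · rfl
      · obtain ⟨k, rfl⟩ := he
        rw [pow_add, ← mul_pow, gsE_sq s hs, one_pow, one_mul]
    simp_rw [e1]
    by_cases hb : b = 0
    · rw [if_pos hb, one_mul]
      have e2 : (∑ s : K, if s = 0 then 0 else ψ.mulShift (-t) (s + (b / t) * s⁻¹)) = -1 := by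
        have h0 : ∑ s : K, ψ.mulShift (-t) s = 0 := by
          have := AddChar.sum_mulShift (1 : K) hprim
          simpa using this
        have h1 : ∀ s : K, (if s = 0 then 0 else ψ.mulShift (-t) (s + (b / t) * s⁻¹)) =
            ψ.mulShift (-t) s - if s = 0 then 1 else 0 := by
          intro s
          split_ifs with hs
          · simp [hs]
          · simp [hb]
        rw [Finset.sum_congr rfl fun s _ => h1 s, Finset.sum_sub_distrib, h0]
        simp
      rw [e2, norm_neg, norm_one]
      exact Real.one_le_sqrt.2 hq
    · rw [if_neg hb]
      exact kl_weil hK _ hprim _ (fun h => hb (hbt.1 h))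
  · have e1 : ∀ s : K, (if s = 0 then 0 else gsE s ^ d * ψ.mulShift (-t) (s + (b / t) * s⁻¹)) =
        if s = 0 then 0 else gsE s * ψ.mulShift (-t) (s + (b / t) * s⁻¹) := by
      intro s
      split_ifs with hs
      · rfl
      · obtain ⟨k, rfl⟩ := ho
        rw [pow_succ, two_mul, pow_add, ← mul_pow, gsE_sq s hs, one_pow, one_mul]
    simp_rw [e1]
    have := gs_salie hK _ hprim (b / t)
    simpa only [hbt] using this

lemma gf_map_sum {K ι : Type} [Field K] (ψ : AddChar K ℂ) (s : Finset ι) (f : ι → K) :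
    ψ (∑ i ∈ s, f i) = ∏ i ∈ s, ψ (f i) := by
  classical
  induction s using Finset.induction_on with
  | empty => simp
  | insert a s ha ih => rw [Finset.sum_insert ha, Finset.prod_insert ha, AddChar.map_add_eq_mul, ih]

lemma gf_sum_pi {K : Type} [Field K] [Fintype K] (ψ : AddChar K ℂ) (d : ℕ)
    (f : Fin d → K → K) :
    ∑ m : Fin d → K, ψ (∑ j, f j (m j)) = ∏ j, ∑ x : K, ψ (f j x) := by
  classical
  simp_rw [gf_map_sum]
  rw [Finset.prod_univ_sum, Fintype.piFinset_univ]

lemma gf_gauss_one {K : Type} [Field K] [Fintype K] [DecidableEq K] (hK : ringChar K ≠ 2)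
    (ψ : AddChar K ℂ) (G : ℂ) (hG2 : G ^ 2 = gsE (-1 : K) * Fintype.card K)
    (hG : ∀ s : K, s ≠ 0 → ∑ x : K, ψ (s * x ^ 2) = gsE s * G) (s : K) (hs : s ≠ 0) (z : K) :
    (gsE s * G) * ∑ m : K, ψ (-(m ^ 2 / 4 * s⁻¹) + m * z) = Fintype.card K * ψ (s * z ^ 2) := by
  have h2 : (2 : K) ≠ 0 := Ring.two_ne_zero hK
  have h4 : (4 : K) ≠ 0 := by
    have : (4 : K) = 2 * 2 := by norm_num
    rw [this]; exact mul_ne_zero h2 h2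
  have hgs4 : gsE (4⁻¹ : K) = 1 := by
    rw [gsE_inv, show (4 : K) = 2 ^ 2 by norm_num, gsE_sq' _ h2]
  have e2 : ∀ m : K, ψ (-(m ^ 2 / 4 * s⁻¹) + m * z) =
      ψ (s * z ^ 2) * ψ (-(s⁻¹ * 4⁻¹) * (m - 2 * s * z) ^ 2) := by
    intro v
    rw [← AddChar.map_add_eq_mul]
    congr 1
    field_simp
    ring
  simp_rw [e2, ← Finset.mul_sum]
  rw [show ∑ v : K, ψ (-(s⁻¹ * 4⁻¹) * (v - 2 * s * z) ^ 2) = ∑ v : K, ψ (-(s⁻¹ * 4⁻¹) * v ^ 2) from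
    Equiv.sum_comp (Equiv.subRight (2 * s * z)) (fun v => ψ (-(s⁻¹ * 4⁻¹) * v ^ 2)),
    hG _ (neg_ne_zero.2 (mul_ne_zero (inv_ne_zero hs) (inv_ne_zero h4))),
    show -(s⁻¹ * 4⁻¹) = -1 * (s⁻¹ * 4⁻¹) by ring, gsE_mul, gsE_mul, hgs4, gsE_inv]
  have h5 := gsE_sq s hs
  have h6 := gsE_sq (-1 : K) (neg_ne_zero.2 one_ne_zero)
  linear_combination (ψ (s * z ^ 2) * gsE s * gsE s * gsE (-1 : K)) * hG2 +
    (ψ (s * z ^ 2) * Fintype.card K * gsE (-1 : K) * gsE (-1 : K)) * h5 +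
    (ψ (s * z ^ 2) * Fintype.card K) * h6

lemma gf_gauss_d {K : Type} [Field K] [Fintype K] [DecidableEq K] (hK : ringChar K ≠ 2)
    (ψ : AddChar K ℂ) (G : ℂ) (hG2 : G ^ 2 = gsE (-1 : K) * Fintype.card K)
    (hG : ∀ s : K, s ≠ 0 → ∑ x : K, ψ (s * x ^ 2) = gsE s * G) (s : K) (hs : s ≠ 0) (d : ℕ)
    (z : Fin d → K) :
    (gsE s * G) ^ d * ∑ m : Fin d → K, ψ (-((∑ j, m j ^ 2) / 4 * s⁻¹) + ∑ j, m j * z j) =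
      (Fintype.card K : ℂ) ^ d * ψ (s * ∑ j, z j ^ 2) := by
  have e : ∀ m : Fin d → K, ψ (-((∑ j, m j ^ 2) / 4 * s⁻¹) + ∑ j, m j * z j) =
      ψ (∑ j, (-(m j ^ 2 / 4 * s⁻¹) + m j * z j)) := by
    intro m
    rw [Finset.sum_add_distrib, Finset.sum_neg_distrib, Finset.sum_div, Finset.sum_mul]
  simp_rw [e]
  rw [gf_sum_pi ψ d (fun j x => -(x ^ 2 / 4 * s⁻¹) + x * z j), Finset.mul_sum, gf_map_sum,
    show (gsE s * G) ^ d = ∏ _j : Fin d, (gsE s * G) by simp,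
    show (Fintype.card K : ℂ) ^ d = ∏ _j : Fin d, (Fintype.card K : ℂ) by simp,
    ← Finset.prod_mul_distrib, ← Finset.prod_mul_distrib]
  exact Finset.prod_congr rfl fun j _ => gf_gauss_one hK ψ G hG2 hG s hs (z j)

lemma gf_W {K : Type} [Field K] [Fintype K] [DecidableEq K] (ψ : AddChar K ℂ) (d : ℕ)
    (E : Finset (Fin d → K)) (m : Fin d → K) :
    ∑ x ∈ E, ∑ y ∈ E, ψ (∑ j, m j * (x j - y j)) =
      ((‖∑ x ∈ E, ψ (∑ j, m j * x j)‖ ^ 2 : ℝ) : ℂ) := by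
  rw [Complex.ofReal_pow, ← Complex.mul_conj', map_sum, Finset.sum_mul_sum]
  refine Finset.sum_congr rfl fun x _ => Finset.sum_congr rfl fun y _ => ?_
  rw [← AddChar.map_neg_eq_conj, ← AddChar.map_add_eq_mul]
  congr 1
  rw [← Finset.sum_neg_distrib, ← Finset.sum_add_distrib]
  exact Finset.sum_congr rfl fun j _ => by ring

lemma gf_parseval {K : Type} [Field K] [Fintype K] [DecidableEq K] (ψ : AddChar K ℂ)
    (hψ : ψ.IsPrimitive) (d : ℕ) (E : Finset (Fin d → K)) :
    ∑ m : Fin d → K, ‖∑ x ∈ E, ψ (∑ j, m j * x j)‖ ^ 2 =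
      (Fintype.card K : ℝ) ^ d * E.card := by
  have h : ((∑ m : Fin d → K, ‖∑ x ∈ E, ψ (∑ j, m j * x j)‖ ^ 2 : ℝ) : ℂ) =
      (Fintype.card K : ℂ) ^ d * E.card := by
    rw [Complex.ofReal_sum]
    simp_rw [← gf_W]
    rw [Finset.sum_comm]
    have e : ∀ x ∈ E, ∑ m : Fin d → K, ∑ y ∈ E, ψ (∑ j, m j * (x j - y j)) =
        (Fintype.card K : ℂ) ^ d := by
      intro x hx
      rw [Finset.sum_comm, Finset.sum_eq_single x]
      · simp
      · intro y _ hy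
        rw [gf_sum_pi ψ d (fun j u => u * (x j - y j))]
        obtain ⟨j, hj⟩ := Function.ne_iff.1 hy
        refine Finset.prod_eq_zero (Finset.mem_univ j) ?_
        rw [AddChar.sum_mulShift _ hψ, if_neg (sub_ne_zero.2 hj.symm), Nat.cast_zero]
      · intro h; exact absurd hx h
    rw [Finset.sum_congr rfl e, Finset.sum_const, nsmul_eq_mul, mul_comm]
  exact_mod_cast h

lemma gf_main_eq {K : Type} [Field K] [Fintype K] [DecidableEq K] (hK : ringChar K ≠ 2)
    (ψ : AddChar K ℂ) (hψ : ψ.IsPrimitive) (G : ℂ) (hG2 : G ^ 2 = gsE (-1 : K) * Fintype.card K)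
    (hG : ∀ s : K, s ≠ 0 → ∑ x : K, ψ (s * x ^ 2) = gsE s * G) (d : ℕ)
    (E : Finset (Fin d → K)) (t : K)
    (hne : ∀ x ∈ E, ∀ y ∈ E, ∑ j, (x j - y j) ^ 2 ≠ t) :
    (Fintype.card K : ℂ) ^ d * (E.card : ℂ) ^ 2 = - (G ^ d * ∑ m : Fin d → K,
      ((‖∑ x ∈ E, ψ (∑ j, m j * x j)‖ ^ 2 : ℝ) : ℂ) *
      ∑ s : K, if s = 0 then 0 else gsE s ^ d * ψ (-(s * t) - (∑ j, m j ^ 2) / 4 * s⁻¹)) := by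
  have h0 : ∑ s : K, ∑ x ∈ E, ∑ y ∈ E, ψ (s * (∑ j, (x j - y j) ^ 2 - t)) = 0 := by
    rw [Finset.sum_comm]
    refine Finset.sum_eq_zero fun x hx => ?_
    rw [Finset.sum_comm]
    refine Finset.sum_eq_zero fun y hy => ?_
    rw [AddChar.sum_mulShift _ hψ, if_neg (sub_ne_zero.2 (hne x hx y hy)), Nat.cast_zero]
  have h1 : ∀ s : K, (Fintype.card K : ℂ) ^ d *
      ∑ x ∈ E, ∑ y ∈ E, ψ (s * (∑ j, (x j - y j) ^ 2 - t)) =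
      (if s = 0 then (Fintype.card K : ℂ) ^ d * (E.card : ℂ) ^ 2 else 0) +
      G ^ d * ∑ m : Fin d → K,
        ((‖∑ x ∈ E, ψ (∑ j, m j * x j)‖ ^ 2 : ℝ) : ℂ) *
        if s = 0 then 0 else gsE s ^ d * ψ (-(s * t) - (∑ j, m j ^ 2) / 4 * s⁻¹) := by
    intro s
    by_cases hs : s = 0
    · simp [hs]; ring
    · simp only [if_neg hs, zero_add]
      simp_rw [← gf_W, Finset.sum_mul, Finset.mul_sum]
      rw [Finset.sum_comm]
      rw [Finset.sum_comm (s := Finset.univ (α := Fin d → K))]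
      rw [Finset.sum_comm (s := E)]
      refine Finset.sum_congr rfl fun x _ => ?_
      rw [Finset.sum_comm]
      refine Finset.sum_congr rfl fun y _ => ?_
      have := gf_gauss_d hK ψ G hG2 hG s hs d (fun j => x j - y j)
      rw [show s * (∑ j, (x j - y j) ^ 2 - t) = s * (∑ j, (x j - y j) ^ 2) + -(s * t) by ring,
        AddChar.map_add_eq_mul, ← mul_assoc, ← this, Finset.mul_sum, Finset.sum_mul]
      refine Finset.sum_congr rfl fun m _ => ?_
      rw [sub_eq_add_neg (-(s * t)), AddChar.map_add_eq_mul, AddChar.map_add_eq_mul]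
      ring
  have h2 : ∑ s : K, (Fintype.card K : ℂ) ^ d *
      ∑ x ∈ E, ∑ y ∈ E, ψ (s * (∑ j, (x j - y j) ^ 2 - t)) = 0 := by
    rw [← Finset.mul_sum, h0, mul_zero]
  rw [Finset.sum_congr rfl fun s _ => h1 s, Finset.sum_add_distrib, Finset.sum_ite_eq',
    if_pos (Finset.mem_univ _), ← Finset.mul_sum, Finset.sum_comm] at h2
  simp_rw [← Finset.mul_sum] at h2
  linear_combination h2

lemma gf_main {K : Type} [Field K] [Fintype K] [DecidableEq K] (hK : ringChar K ≠ 2) (d : ℕ)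
    (E : Finset (Fin d → K)) (hE0 : E.Nonempty) (t : K) (ht : t ≠ 0)
    (hne : ∀ x ∈ E, ∀ y ∈ E, ∑ j, (x j - y j) ^ 2 ≠ t) :
    (E.card : ℝ) < 2 * √(Fintype.card K : ℝ) ^ (d + 1) := by
  set ψ := AddChar.FiniteField.primitiveChar_to_Complex K with hψd
  have hψ : ψ.IsPrimitive := AddChar.FiniteField.primitiveChar_to_Complex_isPrimitive K
  obtain ⟨G, hG2, hGn, hG⟩ := gs_gauss hK ψ hψ
  have hmain := congrArg norm (gf_main_eq hK ψ hψ G hG2 hG d E t hne)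
  set r := √(Fintype.card K : ℝ) with hr
  set F : (Fin d → K) → ℝ := fun m => ‖∑ x ∈ E, ψ (∑ j, m j * x j)‖ ^ 2 with hF
  have hFn : ∀ m, 0 ≤ F m := fun m => by positivity
  have hF0 : F 0 = (E.card : ℝ) ^ 2 := by simp [hF]
  have hpar : ∑ m, F m = (Fintype.card K : ℝ) ^ d * E.card := gf_parseval ψ hψ d E
  have hq : (0 : ℝ) < Fintype.card K := by exact_mod_cast Fintype.card_pos
  have hr0 : 0 < r := Real.sqrt_pos.2 hq
  have hc : (0 : ℝ) < E.card := by exact_mod_cast hE0.card_pos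
  rw [norm_neg, norm_mul, norm_mul, norm_pow, norm_pow, norm_pow, hGn, Complex.norm_natCast,
    Complex.norm_natCast] at hmain
  have hb : ‖∑ m : Fin d → K, ((F m : ℝ) : ℂ) *
      ∑ s : K, if s = 0 then 0 else gsE s ^ d * ψ (-(s * t) - (∑ j, m j ^ 2) / 4 * s⁻¹)‖ ≤
      ∑ m, (F m * (2 * r) - if m = 0 then (E.card : ℝ) ^ 2 * r else 0) := by
    refine (norm_sum_le _ _).trans (Finset.sum_le_sum fun m _ => ?_)
    have hk := gs_K hK ψ hψ d t ((∑ j, m j ^ 2) / 4) ht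
    rw [norm_mul, Complex.norm_real, Real.norm_of_nonneg (hFn m)]
    split_ifs with hm
    · subst hm
      rw [← hF0]
      have h0 : (∑ j, (0 : Fin d → K) j ^ 2) / 4 = (0 : K) := by simp
      rw [if_pos h0, one_mul] at hk
      have := mul_le_mul_of_nonneg_left hk (hFn 0)
      linarith
    · rw [sub_zero]
      refine mul_le_mul_of_nonneg_left (hk.trans ?_) (hFn m)
      split_ifs <;> linarith
  rw [Finset.sum_sub_distrib, ← Finset.sum_mul, hpar, Finset.sum_ite_eq',
    if_pos (Finset.mem_univ _)] at hb
  have h3 : (Fintype.card K : ℝ) ^ d * (E.card : ℝ) ^ 2 ≤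
      r ^ d * ((Fintype.card K : ℝ) ^ d * E.card * (2 * r) - (E.card : ℝ) ^ 2 * r) := by
    rw [hmain]
    exact mul_le_mul_of_nonneg_left hb (by positivity)
  have h4 : 0 < r ^ d * ((E.card : ℝ) ^ 2 * r) := by positivity
  have h5 : 0 < (Fintype.card K : ℝ) ^ d * E.card := by positivity
  refine lt_of_mul_lt_mul_left ?_ h5.le
  calc _ = (Fintype.card K : ℝ) ^ d * (E.card : ℝ) ^ 2 := by ring
    _ < r ^ d * ((Fintype.card K : ℝ) ^ d * E.card * (2 * r)) := by linarith
    _ = _ := by ring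

/-- Iosevich–Rudnev: for `d ≥ 2`, `P(x) = x_1² + ⋯ + x_d²`, and
`E ⊆ F_q^d` with `|E| ≥ 2q^{(d+1)/2}` over a finite field of odd characteristic,
the distance set `Δ_P(E,E)` is all of `F_q`, i.e. `|Δ_P(E,E)| = q`. -/
theorem stmt16 (d : ℕ) (hd : 2 ≤ d)
    (K : Type) [Field K] [Fintype K] [DecidableEq K] (hchar : ringChar K ≠ 2)
    (E : Finset (Fin d → K))
    (hE : 2 * (Fintype.card K : ℝ) ^ (((d : ℝ) + 1) / 2) ≤ (E.card : ℝ)) :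
    ((E ×ˢ E).image (fun p => ∑ j, (p.1 j - p.2 j) ^ 2)).card =
      Fintype.card K := by
  have hq : (0 : ℝ) < Fintype.card K := by exact_mod_cast Fintype.card_pos
  have hpow : (Fintype.card K : ℝ) ^ (((d : ℝ) + 1) / 2) = √(Fintype.card K : ℝ) ^ (d + 1) := by
    rw [Real.sqrt_eq_rpow, ← Real.rpow_natCast, ← Real.rpow_mul hq.le]
    congr 1
    push_cast; ring
  rw [hpow] at hE
  have hE0 : E.Nonempty := by
    rw [← Finset.card_pos]
    have : (0 : ℝ) < E.card := lt_of_lt_of_le (by positivity) hE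
    exact_mod_cast this
  rw [← Finset.card_univ]
  congr 1
  rw [Finset.eq_univ_iff_forall]
  intro t
  rw [Finset.mem_image]
  by_cases ht : t = 0
  · obtain ⟨x, hx⟩ := hE0
    exact ⟨(x, x), Finset.mk_mem_product hx hx, by simp [ht]⟩
  · by_contra hcon
    push Not at hcon
    have := gf_main hchar d E hE0 t ht fun x hx y hy =>
      hcon (x, y) (Finset.mk_mem_product hx hy)
    linarith
end
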